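/- Let M be a matroid without large uniform minors. Then M is representable over both 𝔽₄ and 𝔽₅ if and only if M is representable over every field with at least three elements. -/

import Mathlib

universe u v w

open Matroid Set

namespace Paper

/-- The deletion of the set `D` from the matroid `M`. -/
def delete {α : Type u} (M : Matroid α) (D : Set α) : Matroid α := M ↾ (M.E \ D)

/-- The contraction of the set `C` in the matroid `M`. -/
def contract {α : Type u} (M : Matroid α) (C : Set α) : Matroid α := (delete M✶ C)✶

/-- `N` is a minor of `M`: it is obtained from `M` by a sequence of deletions and
contractions, equivalently by a single contraction followed by a single deletion. -/
def IsMinor {α : Type u} (N M : Matroid α) : Prop :=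
  ∃ C D : Set α, N = delete (contract M C) D

/-- `M` is a copy of the uniform matroid `U(r,n)`: its ground set has `n` elements and its
independent sets are exactly the subsets of the ground set with at most `r` elements. -/
def IsUniform {α : Type u} (M : Matroid α) (r n : ℕ) : Prop :=
  M.E.Finite ∧ M.E.ncard = n ∧ ∀ I ⊆ M.E, (M.Indep I ↔ I.ncard ≤ r)

/-- `M` has a minor isomorphic to the uniform matroid `U(r,n)`. -/
def HasUniformMinor {α : Type u} (M : Matroid α) (r n : ℕ) : Prop :=
  ∃ N : Matroid α, IsMinor N M ∧ IsUniform N r n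

/-- `M` is without large uniform minors: no minor of `M` is isomorphic to `U(2,5)` or
`U(3,5)`. -/
def NoLargeUniformMinors {α : Type u} (M : Matroid α) : Prop :=
  ¬ HasUniformMinor M 2 5 ∧ ¬ HasUniformMinor M 3 5

/-- `M` is isomorphic to the Fano matroid `F₇`, the matroid on the seven nonzero vectors of
`(𝔽₂)³` whose independent sets are the `𝔽₂`-linearly independent subsets. -/
def IsFano {α : Type u} (M : Matroid α) : Prop :=
  ∃ f : α → (Fin 3 → ZMod 2),
    Set.BijOn f M.E {x | x ≠ 0} ∧
    ∀ I ⊆ M.E, (M.Indep I ↔ Set.InjOn f I ∧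
      LinearIndependent (ZMod 2) (fun x : (f '' I) => (x : Fin 3 → ZMod 2)))

/-- `M` has a minor isomorphic to the Fano matroid `F₇`. -/
def HasFanoMinor {α : Type u} (M : Matroid α) : Prop :=
  ∃ N : Matroid α, IsMinor N M ∧ IsFano N

/-- `M` has a minor isomorphic to the dual Fano matroid `F₇*`. -/
def HasFanoDualMinor {α : Type u} (M : Matroid α) : Prop :=
  ∃ N : Matroid α, IsMinor N M ∧ IsFano N✶

/-- `M` is representable over the field `K`: there are a `K`-vector space `V` and a map
`φ` from the ground type to `V` such that a set `I ⊆ M.E` is independent in `M` if and only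
if the family `φ` restricted to `I` is linearly independent over `K` (equivalently, `φ` is
injective on `I` and the image `φ '' I` is linearly independent). -/
def Representable {α : Type u} (M : Matroid α) (K : Type v) [Field K] : Prop :=
  ∃ (V : Type (max u v)) (_ : AddCommGroup V) (_ : Module K V) (φ : α → V),
    ∀ I ⊆ M.E, (M.Indep I ↔ LinearIndependent K (fun x : I => φ x))

end Paper

instance : Fact (Nat.Prime 5) := ⟨by norm_num⟩

namespace PartialField

section Scalars

variable {S : Type*} [CommRing S]

/-- The elements of the partial field `(S, Γ)`: zero together with the units in `Γ`. -/
def Mem (Γ : Subgroup Sˣ) (x : S) : Prop := x = 0 ∨ ∃ g ∈ Γ, (g : S) = x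

variable {Γ : Subgroup Sˣ} {x y : S}

theorem Mem.zero : Mem Γ 0 := Or.inl rfl

theorem mem_coe {g : Sˣ} (hg : g ∈ Γ) : Mem Γ (g : S) := Or.inr ⟨g, hg, rfl⟩

theorem Mem.one : Mem Γ 1 := mem_coe (one_mem Γ)

theorem Mem.mul (hx : Mem Γ x) (hy : Mem Γ y) : Mem Γ (x * y) := by
  rcases hx with rfl | ⟨g, hg, rfl⟩
  · simp [Mem]
  · rcases hy with rfl | ⟨h, hh, rfl⟩
    · simp [Mem]
    · exact Or.inr ⟨g * h, mul_mem hg hh, by simp⟩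

theorem Mem.neg (h1 : -1 ∈ Γ) (hx : Mem Γ x) : Mem Γ (-x) := by
  have := (mem_coe h1).mul hx
  simpa using this

theorem Mem.exists_unit (hx : Mem Γ x) (h0 : x ≠ 0) : ∃ g ∈ Γ, (g : S) = x :=
  hx.resolve_left h0

theorem Mem.isUnit (hx : Mem Γ x) (h0 : x ≠ 0) : IsUnit x := by
  obtain ⟨g, -, rfl⟩ := hx.exists_unit h0
  exact g.isUnit

theorem mem_unit_mul_iff {g : Sˣ} (hg : g ∈ Γ) : Mem Γ (g * x) ↔ Mem Γ x := by
  refine ⟨fun h => ?_, fun h => (mem_coe hg).mul h⟩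
  simpa using (mem_coe (inv_mem hg)).mul h

theorem Mem.map_ne_zero {P : Type*} [CommRing P] [Nontrivial P] (π : S →+* P) (hx : Mem Γ x)
    (h0 : x ≠ 0) : π x ≠ 0 := ((hx.isUnit h0).map π).ne_zero

theorem Mem.map_eq_zero_iff {P : Type*} [CommRing P] [Nontrivial P] (π : S →+* P)
    (hx : Mem Γ x) : π x = 0 ↔ x = 0 :=
  ⟨fun h => by_contra fun h0 => hx.map_ne_zero π h0 h, fun h => by simp [h]⟩

end Scalars

section Matrices

variable {R C S : Type*} [CommRing S]

/-- The Schur complement of the entry in position `(r, c)`. The row `r` and the column `c` are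
kept, and become zero when the entry is a unit. -/
noncomputable def schur (A : Matrix R C S) (r : R) (c : C) : Matrix R C S :=
  fun i j => A i j - A i c * Ring.inverse (A r c) * A r j

theorem schur_transpose (A : Matrix R C S) (r : R) (c : C) :
    schur A.transpose c r = (schur A r c).transpose := by
  ext i j
  simp only [schur, Matrix.transpose_apply]
  ring

theorem schur_row (A : Matrix R C S) {r : R} {c : C} (h : IsUnit (A r c)) (j : C) :
    schur A r c r j = 0 := by
  simp [schur, Ring.mul_inverse_cancel _ h]

theorem schur_col (A : Matrix R C S) {r : R} {c : C} (h : IsUnit (A r c)) (i : R) :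
    schur A r c i c = 0 := by
  simp [schur, mul_assoc, Ring.inverse_mul_cancel _ h]

theorem schur_of_left (A : Matrix R C S) {r : R} {c : C} {i : R} (h : A i c = 0) (j : C) :
    schur A r c i j = A i j := by
  simp [schur, h]

theorem schur_of_right (A : Matrix R C S) {r : R} {c : C} {j : C} (h : A r j = 0) (i : R) :
    schur A r c i j = A i j := by
  simp [schur, h]

theorem det_cons (A : Matrix R C S) {r : R} {c : C} (h : IsUnit (A r c)) {n : ℕ}
    (f : Fin n → R) (g : Fin n → C) :
    (A.submatrix (Fin.cons r f : Fin (n + 1) → R) (Fin.cons c g : Fin (n + 1) → C)).det =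
      A r c * ((schur A r c).submatrix f g).det := by
  have h1 : (A.submatrix (Fin.cons r f : Fin (n + 1) → R) (Fin.cons c g : Fin (n + 1) → C)).det =
      Matrix.det (Matrix.of fun i j : Fin (n + 1) =>
        if i = 0 then A r ((Fin.cons c g : Fin (n + 1) → C) j)
        else schur A r c ((Fin.cons r f : Fin (n + 1) → R) i)
          ((Fin.cons c g : Fin (n + 1) → C) j)) := by
    refine Matrix.det_eq_of_forall_row_eq_smul_add_const
      (fun i => if i = 0 then 0 else
        A ((Fin.cons r f : Fin (n + 1) → R) i) c * Ring.inverse (A r c)) 0 (by simp) ?_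
    intro i j
    by_cases hi : i = 0
    · subst hi; simp
    · simp only [Matrix.submatrix_apply, Matrix.of_apply, if_neg hi, if_true, schur]
      ring
  rw [h1, Matrix.det_succ_column_zero, Finset.sum_eq_single 0]
  · simp only [Fin.val_zero, pow_zero, one_mul, Matrix.of_apply, if_true, Fin.cons_zero]
    congr 2
  · intro i _ hi
    simp [hi, schur_col A h]
  · simp

theorem det_eq_schur (A : Matrix R C S) {n : ℕ} (f : Fin (n + 1) → R) (g : Fin (n + 1) → C)
    (a b : Fin (n + 1)) (h : IsUnit (A (f a) (g b))) :
    ∃ (f' : Fin n → R) (g' : Fin n → C) (e : ℤˣ), (A.submatrix f g).det =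
      e * (A (f a) (g b) * ((schur A (f a) (g b)).submatrix f' g').det) := by
  refine ⟨fun i => f (Equiv.swap 0 a i.succ), fun i => g (Equiv.swap 0 b i.succ),
    (Equiv.swap 0 a).sign * (Equiv.swap 0 b).sign, ?_⟩
  rw [← det_cons A h]
  have hf : (Fin.cons (f a) fun i => f (Equiv.swap 0 a i.succ) : Fin (n + 1) → R)
      = f ∘ Equiv.swap 0 a := by
    ext i; refine Fin.cases ?_ (fun i => ?_) i <;> simp
  have hg : (Fin.cons (g b) fun i => g (Equiv.swap 0 b i.succ) : Fin (n + 1) → C)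
      = g ∘ Equiv.swap 0 b := by
    ext i; refine Fin.cases ?_ (fun i => ?_) i <;> simp
  have h2 : A.submatrix (f ∘ Equiv.swap 0 a) (g ∘ Equiv.swap 0 b) =
      ((A.submatrix f g).submatrix (Equiv.swap 0 a) id).submatrix id (Equiv.swap 0 b) := rfl
  rw [hf, hg, h2, Matrix.det_permute', Matrix.det_permute]
  have e1 : ∀ e : ℤˣ, ((e : ℤ) : S) * (e : ℤ) = 1 := fun e => by
    rw [← Int.cast_mul]; norm_cast; simp
  push_cast
  linear_combination (-(A.submatrix f g).det) *
    (e1 (Equiv.swap 0 a).sign * (((Equiv.swap 0 b).sign : ℤ) : S) * ((Equiv.swap 0 b).sign : ℤ)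
      + e1 (Equiv.swap 0 b).sign)

variable (Γ : Subgroup Sˣ)

/-- A matrix over the partial field `(S, Γ)`: all of its minors are zero or lie in `Γ`. -/
def IsMatrix (A : Matrix R C S) : Prop :=
  ∀ (n : ℕ) (f : Fin n → R) (g : Fin n → C), Mem Γ (A.submatrix f g).det

variable {Γ} {A : Matrix R C S}

theorem IsMatrix.mem (hA : IsMatrix Γ A) (i : R) (j : C) : Mem Γ (A i j) := by
  simpa using hA 1 (fun _ => i) (fun _ => j)

theorem IsMatrix.mem_det (hA : IsMatrix Γ A) (i i' : R) (j j' : C) :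
    Mem Γ (A i j * A i' j' - A i j' * A i' j) := by
  have := hA 2 ![i, i'] ![j, j']
  rw [Matrix.det_fin_two] at this
  simpa using this

theorem IsMatrix.isUnit (hA : IsMatrix Γ A) {i : R} {j : C} (h : A i j ≠ 0) : IsUnit (A i j) :=
  (hA.mem i j).isUnit h

theorem IsMatrix.transpose (hA : IsMatrix Γ A) : IsMatrix Γ A.transpose := by
  intro n f g
  rw [← Matrix.det_transpose]
  exact hA n g f

theorem IsMatrix.schur (hA : IsMatrix Γ A) {r : R} {c : C} (h : A r c ≠ 0) :
    IsMatrix Γ (schur A r c) := by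
  intro n f g
  obtain ⟨u, hu, hur⟩ := (hA.mem r c).exists_unit h
  rw [← mem_unit_mul_iff hu, hur, ← det_cons A (hA.isUnit h)]
  exact hA _ _ _

theorem mem_det_of_schur (h1 : -1 ∈ Γ) {n : ℕ} (f : Fin (n + 1) → R) (g : Fin (n + 1) → C)
    (a b : Fin (n + 1)) (hm : Mem Γ (A (f a) (g b))) (h0 : A (f a) (g b) ≠ 0)
    (h : ∀ (f' : Fin n → R) (g' : Fin n → C),
      Mem Γ ((PartialField.schur A (f a) (g b)).submatrix f' g').det) :
    Mem Γ (A.submatrix f g).det := by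
  obtain ⟨f', g', e, he⟩ := det_eq_schur A f g a b (hm.isUnit h0)
  rw [he]
  have := hm.mul (h f' g')
  rcases Int.units_eq_one_or e with rfl | rfl
  · simpa using this
  · simpa using this.neg h1

/-- Rows and columns scaled. -/
def scale (l : R → Sˣ) (m : C → Sˣ) (A : Matrix R C S) : Matrix R C S :=
  fun i j => l i * m j * A i j

theorem IsMatrix.scale (hA : IsMatrix Γ A) {l : R → Sˣ} {m : C → Sˣ} (hl : ∀ i, l i ∈ Γ)
    (hm : ∀ j, m j ∈ Γ) : IsMatrix Γ (scale l m A) := by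
  intro n f g
  have : (PartialField.scale l m A).submatrix f g =
      Matrix.diagonal (fun i => (l (f i) : S)) * A.submatrix f g *
        Matrix.diagonal (fun i => (m (g i) : S)) := by
    ext i j
    simp [PartialField.scale]
    ring
  rw [this, Matrix.det_mul, Matrix.det_mul, Matrix.det_diagonal, Matrix.det_diagonal]
  have hp : ∀ {k : Fin n → Sˣ}, (∀ i, k i ∈ Γ) → Mem Γ (∏ i, (k i : S)) := fun {k} hk => by
    have := mem_coe (Γ.prod_mem (t := Finset.univ) (fun i _ => hk i))
    simpa using this
  exact ((hp fun i => hl (f i)).mul (hA n f g)).mul (hp fun i => hm (g i))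

theorem schur_scale (l : R → Sˣ) (m : C → Sˣ) (A : Matrix R C S) (r : R) (c : C)
    (h : IsUnit (A r c)) : schur (scale l m A) r c = scale l m (schur A r c) := by
  obtain ⟨u, hu⟩ := h
  ext i j
  have : Ring.inverse ((l r : S) * m c * A r c) = ↑(l r * m c * u)⁻¹ := by
    rw [← hu, ← Units.val_mul, ← Units.val_mul, Ring.inverse_unit]
  simp only [schur, scale]
  rw [this, ← hu, Ring.inverse_unit]
  have e : ((l r * m c * u)⁻¹ : Sˣ) * (l r : S) * m c = (u⁻¹ : Sˣ) := by
    norm_cast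
    group
  linear_combination (-(l i : S) * m j * A i c * A r j) * e

open Classical in
/-- The matrix obtained by replacing all entries outside of the rows and columns in `W` by
zero. -/
noncomputable def restrict (A : Matrix R C S) (W : Set (R ⊕ C)) : Matrix R C S :=
  fun i j => if Sum.inl i ∈ W ∧ Sum.inr j ∈ W then A i j else 0

theorem restrict_pos {W : Set (R ⊕ C)} {i : R} {j : C} (hi : Sum.inl i ∈ W)
    (hj : Sum.inr j ∈ W) : restrict A W i j = A i j := if_pos ⟨hi, hj⟩

theorem restrict_left {W : Set (R ⊕ C)} {i : R} {j : C} (hi : Sum.inl i ∉ W) :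
    restrict A W i j = 0 := if_neg fun h => hi h.1

theorem restrict_right {W : Set (R ⊕ C)} {i : R} {j : C} (hj : Sum.inr j ∉ W) :
    restrict A W i j = 0 := if_neg fun h => hj h.2

theorem restrict_ne_zero {W : Set (R ⊕ C)} {i : R} {j : C} (h : restrict A W i j ≠ 0) :
    Sum.inl i ∈ W ∧ Sum.inr j ∈ W ∧ restrict A W i j = A i j := by
  by_cases h' : Sum.inl i ∈ W ∧ Sum.inr j ∈ W
  · exact ⟨h'.1, h'.2, if_pos h'⟩
  · exact absurd (if_neg h') h

theorem IsMatrix.restrict (hA : IsMatrix Γ A) (W : Set (R ⊕ C)) : IsMatrix Γ (restrict A W) := by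
  intro n f g
  by_cases hf : ∃ a, Sum.inl (f a) ∉ W
  · obtain ⟨a, ha⟩ := hf
    exact Or.inl (Matrix.det_eq_zero_of_row_eq_zero a fun j => restrict_left (A := A) ha)
  by_cases hg : ∃ a, Sum.inr (g a) ∉ W
  · obtain ⟨a, ha⟩ := hg
    exact Or.inl (Matrix.det_eq_zero_of_column_eq_zero a fun j => restrict_right (A := A) ha)
  push Not at hf hg
  have : (PartialField.restrict A W).submatrix f g = A.submatrix f g := by
    ext i j
    exact restrict_pos (hf i) (hg j)
  rw [this]
  exact hA n f g

theorem restrict_schur {W : Set (R ⊕ C)} {r : R} {c : C} (h : restrict A W r c ≠ 0) :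
    schur (restrict A W) r c = restrict (schur A r c) W := by
  obtain ⟨hr, hc, -⟩ := restrict_ne_zero h
  ext i j
  by_cases hi : Sum.inl i ∈ W <;> by_cases hj : Sum.inr j ∈ W <;>
    simp [schur, restrict, hr, hc, hi, hj]

theorem restrict_restrict (W W' : Set (R ⊕ C)) :
    restrict (restrict A W) W' = restrict A (W ∩ W') := by
  ext i j
  by_cases hi : Sum.inl i ∈ W <;> by_cases hj : Sum.inr j ∈ W <;>
    by_cases hi' : Sum.inl i ∈ W' <;> by_cases hj' : Sum.inr j ∈ W' <;>
    simp [restrict, hi, hj, hi', hj']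

end Matrices

section Pivot

variable {R C P : Type*} [CommRing P]

open Classical in
/-- The pivot in position `(r, c)`, normalized so that it commutes with transposition. -/
noncomputable def piv (A : Matrix R C P) (r : R) (c : C) : Matrix R C P := fun i j =>
  if i = r then if j = c then -Ring.inverse (A r c) else Ring.inverse (A r c) * A r j
  else if j = c then Ring.inverse (A r c) * A i c else schur A r c i j

theorem piv_transpose (A : Matrix R C P) (r : R) (c : C) :
    piv A.transpose c r = (piv A r c).transpose := by
  ext i j
  by_cases hi : i = c <;> by_cases hj : j = r <;>
    simp [piv, hi, hj, schur_transpose]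

theorem piv_submatrix {R' C' : Type*} (A : Matrix R C P) {f : R' → R} {g : C' → C}
    (hf : Function.Injective f) (hg : Function.Injective g) (r : R') (c : C') :
    piv (A.submatrix f g) r c = (piv A (f r) (g c)).submatrix f g := by
  ext i j
  by_cases hi : i = r <;> by_cases hj : j = c <;>
    simp [piv, hi, hj, mt (@hf i r), mt (@hg j c), schur]

theorem piv_restrict {A : Matrix R C P} {W : Set (R ⊕ C)} {r : R} {c : C}
    (h : restrict A W r c ≠ 0) : piv (restrict A W) r c = restrict (piv A r c) W := by
  have hs := restrict_schur h
  obtain ⟨hr, hc, -⟩ := restrict_ne_zero h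
  ext i j
  by_cases hi : i = r <;> by_cases hj : j = c <;>
    by_cases hi' : Sum.inl i ∈ W <;> by_cases hj' : Sum.inr j ∈ W <;>
      simp_all [piv, restrict]

theorem piv_scale {A : Matrix R C P} (l : R → Pˣ) (m : C → Pˣ) {r : R} {c : C}
    (h : IsUnit (A r c)) :
    ∃ (l' : R → Pˣ) (m' : C → Pˣ), piv (scale l m A) r c = scale l' m' (piv A r c) := by
  classical
  have hs := schur_scale l m A r c h
  obtain ⟨u, hu⟩ := h
  have h1 : Ring.inverse ((l r : P) * m c * A r c) = ↑(l r * m c * u)⁻¹ := by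
    rw [← hu, ← Units.val_mul, ← Units.val_mul, Ring.inverse_unit]
  have h2 : Ring.inverse (A r c) = ↑(u⁻¹) := by rw [← hu, Ring.inverse_unit]
  refine ⟨Function.update l r (m c)⁻¹, Function.update m c (l r)⁻¹, ?_⟩
  ext i j
  have e1 : ((l r * m c * u)⁻¹ : Pˣ) * (l r : P) = ((m c)⁻¹ : Pˣ) * (u⁻¹ : Pˣ) := by
    norm_cast; rw [mul_inv, mul_inv]
    rw [mul_comm, ← mul_assoc, ← mul_assoc, mul_inv_cancel, one_mul]
  have e2 : ((l r * m c * u)⁻¹ : Pˣ) * (m c : P) = ((l r)⁻¹ : Pˣ) * (u⁻¹ : Pˣ) := by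
    norm_cast; rw [mul_comm (l r), mul_inv, mul_inv]
    rw [mul_comm, ← mul_assoc, ← mul_assoc, mul_inv_cancel, one_mul]
  have e3 : ((l r * m c * u)⁻¹ : Pˣ) = ((m c)⁻¹ : Pˣ) * ((l r)⁻¹ : Pˣ) * ((u⁻¹ : Pˣ) : P) := by
    norm_cast; rw [mul_inv, mul_inv, mul_comm (l r)⁻¹]
  by_cases hi : i = r
  · by_cases hj : j = c
    · subst hi hj
      simp only [piv, if_true, scale, Function.update_self, h1, h2]
      linear_combination -e3
    · subst hi
      simp only [piv, if_true, if_neg hj, scale, Function.update_self, h1, h2,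
        Function.update_of_ne hj]
      linear_combination (m j : P) * A i j * e1
  · by_cases hj : j = c
    · subst hj
      simp only [piv, if_true, if_neg hi, scale, Function.update_self, h1, h2,
        Function.update_of_ne hi]
      linear_combination (l i : P) * A i j * e2
    · simp only [piv, if_neg hi, if_neg hj, hs]
      simp only [scale, Function.update_of_ne hi, Function.update_of_ne hj, piv, if_neg hi,
        if_neg hj]

theorem schur_eq_restrict_piv {A : Matrix R C P} {r : R} {c : C} (h : IsUnit (A r c)) :
    schur A r c = restrict (piv A r c) {x | x ≠ Sum.inl r ∧ x ≠ Sum.inr c} := by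
  ext i j
  by_cases hi : i = r
  · subst hi
    rw [schur_row A h, restrict_left]
    simp
  by_cases hj : j = c
  · subst hj
    rw [schur_col A h, restrict_right]
    simp
  rw [restrict_pos (by simpa using hi) (by simpa using hj)]
  simp [piv, hi, hj]

/-- A `2 × 3` submatrix without vanishing minors. -/
def Generic (A : Matrix R C P) (r s : R) (c d e : C) : Prop :=
  (A r c ≠ 0 ∧ A r d ≠ 0 ∧ A r e ≠ 0) ∧ (A s c ≠ 0 ∧ A s d ≠ 0 ∧ A s e ≠ 0) ∧
    A r c * A s d - A r d * A s c ≠ 0 ∧ A r c * A s e - A r e * A s c ≠ 0 ∧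
    A r d * A s e - A r e * A s d ≠ 0

/-- A ring element which is zero or a unit. -/
def ZeroOrUnit (x : P) : Prop := x = 0 ∨ IsUnit x

/-- All entries are zero or units, and no `2 × 3` or `3 × 2` submatrix is generic. -/
structure Tame (A : Matrix R C P) : Prop where
  entry : ∀ i j, ZeroOrUnit (A i j)
  not_generic : ∀ r s c d e, ¬ Generic A r s c d e
  not_generic_transpose : ∀ c d r s t, ¬ Generic A.transpose c d r s t

/-- One matrix is obtained from the other by pivoting. -/
def PivStep (A B : Matrix R C P) : Prop := ∃ r c, A r c ≠ 0 ∧ B = piv A r c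

/-- All matrices obtained by pivoting are tame. -/
def Valid (A : Matrix R C P) : Prop := ∀ B, Relation.ReflTransGen PivStep A B → Tame B

variable {A : Matrix R C P}

theorem Valid.tame (hA : Valid A) : Tame A := hA A .refl

theorem Valid.isUnit (hA : Valid A) {r : R} {c : C} (h : A r c ≠ 0) : IsUnit (A r c) :=
  (hA.tame.entry r c).resolve_left h

theorem Valid.piv (hA : Valid A) {r : R} {c : C} (h : A r c ≠ 0) : Valid (piv A r c) :=
  fun B hB => hA B (.head ⟨r, c, h, rfl⟩ hB)

theorem Tame.transpose (hA : Tame A) : Tame A.transpose :=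
  ⟨fun i j => hA.entry j i, hA.not_generic_transpose, hA.not_generic⟩

theorem Valid.transpose (hA : Valid A) : Valid A.transpose := by
  suffices h : ∀ B, Relation.ReflTransGen PivStep A.transpose B →
      Relation.ReflTransGen PivStep A B.transpose from
    fun B hB => (hA _ (h B hB)).transpose
  intro B hB
  induction hB with
  | refl => exact .refl
  | tail _ h ih =>
    obtain ⟨c, r, h0, rfl⟩ := h
    refine ih.tail ⟨r, c, h0, ?_⟩
    rw [← piv_transpose]

theorem Valid.restrict (hA : Valid A) (W : Set (R ⊕ C)) : Valid (restrict A W) := by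
  intro B hB
  have : ∃ B', Relation.ReflTransGen PivStep A B' ∧ B = PartialField.restrict B' W := by
    induction hB with
    | refl => exact ⟨A, .refl, rfl⟩
    | tail _ h ih =>
      obtain ⟨B', hB', rfl⟩ := ih
      obtain ⟨r, c, h0, rfl⟩ := h
      refine ⟨_, hB'.tail ⟨r, c, ?_, rfl⟩, piv_restrict h0⟩
      rwa [← (restrict_ne_zero h0).2.2]
  obtain ⟨B', hB', rfl⟩ := this
  have ht := hA B' hB'
  refine ⟨fun i j => ?_, fun r s c d e h => ?_, fun r s c d e h => ?_⟩
  · by_cases h : PartialField.restrict B' W i j = 0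
    · exact Or.inl h
    · rw [(restrict_ne_zero h).2.2]; exact ht.entry i j
  · have h' := h
    obtain ⟨⟨h1, h2, h3⟩, ⟨h4, h5, h6⟩, -⟩ := h
    rw [Generic, (restrict_ne_zero h1).2.2, (restrict_ne_zero h2).2.2, (restrict_ne_zero h3).2.2,
      (restrict_ne_zero h4).2.2, (restrict_ne_zero h5).2.2, (restrict_ne_zero h6).2.2] at h'
    exact ht.not_generic _ _ _ _ _ h'
  · have h' := h
    obtain ⟨⟨h1, h2, h3⟩, ⟨h4, h5, h6⟩, -⟩ := h
    simp only [Generic, Matrix.transpose_apply] at h1 h2 h3 h4 h5 h6 h'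
    rw [(restrict_ne_zero h1).2.2, (restrict_ne_zero h2).2.2, (restrict_ne_zero h3).2.2,
      (restrict_ne_zero h4).2.2, (restrict_ne_zero h5).2.2, (restrict_ne_zero h6).2.2] at h'
    exact ht.not_generic_transpose _ _ _ _ _ h'

theorem Valid.schur (hA : Valid A) {r : R} {c : C} (h : A r c ≠ 0) : Valid (schur A r c) := by
  rw [schur_eq_restrict_piv (hA.isUnit h)]
  exact (hA.piv h).restrict _

theorem Valid.submatrix {R' C' : Type*} {f : R' → R} {g : C' → C} (hA : Valid A)
    (hf : Function.Injective f) (hg : Function.Injective g) : Valid (A.submatrix f g) := by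
  intro B hB
  have : ∃ B', Relation.ReflTransGen PivStep A B' ∧ B = B'.submatrix f g := by
    induction hB with
    | refl => exact ⟨A, .refl, rfl⟩
    | tail _ h ih =>
      obtain ⟨B', hB', rfl⟩ := ih
      obtain ⟨r, c, h0, rfl⟩ := h
      exact ⟨_, hB'.tail ⟨f r, g c, h0, rfl⟩, piv_submatrix _ hf hg _ _⟩
  obtain ⟨B', hB', rfl⟩ := this
  have ht := hA B' hB'
  exact ⟨fun i j => ht.entry _ _, fun r s c d e h => ht.not_generic _ _ _ _ _ h,
    fun r s c d e h => ht.not_generic_transpose _ _ _ _ _ h⟩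

theorem scale_ne_zero {l : R → Pˣ} {m : C → Pˣ} {i : R} {j : C} :
    scale l m A i j ≠ 0 ↔ A i j ≠ 0 := by
  simp [scale, ← Units.val_mul]

theorem Generic.of_scale {l : R → Pˣ} {m : C → Pˣ} {r s : R} {c d e : C}
    (h : Generic (scale l m A) r s c d e) : Generic A r s c d e := by
  obtain ⟨⟨h1, h2, h3⟩, ⟨h4, h5, h6⟩, h7, h8, h9⟩ := h
  have key : ∀ c d, scale l m A r c * scale l m A s d - scale l m A r d * scale l m A s c ≠ 0 →
      A r c * A s d - A r d * A s c ≠ 0 := by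
    intro c d h h0
    apply h
    simp only [scale]
    linear_combination (l r * m c * l s * m d : P) * h0
  rw [scale_ne_zero] at h1 h2 h3 h4 h5 h6
  exact ⟨⟨h1, h2, h3⟩, ⟨h4, h5, h6⟩, key _ _ h7, key _ _ h8, key _ _ h9⟩

theorem Valid.scale (hA : Valid A) (l : R → Pˣ) (m : C → Pˣ) : Valid (scale l m A) := by
  intro B hB
  have : ∃ B' l' m', Relation.ReflTransGen PivStep A B' ∧ B = PartialField.scale l' m' B' := by
    induction hB with
    | refl => exact ⟨A, l, m, .refl, rfl⟩
    | tail _ h ih =>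
      obtain ⟨B', l', m', hB', rfl⟩ := ih
      obtain ⟨r, c, h0, rfl⟩ := h
      rw [scale_ne_zero] at h0
      obtain ⟨l₁, m₁, h₁⟩ := piv_scale l' m' (((hA _ hB').entry r c).resolve_left h0)
      exact ⟨_, l₁, m₁, hB'.tail ⟨r, c, h0, rfl⟩, h₁⟩
  obtain ⟨B', l', m', hB', rfl⟩ := this
  have ht := hA B' hB'
  refine ⟨fun i j => ?_, fun r s c d e h => ht.not_generic _ _ _ _ _ h.of_scale,
    fun r s c d e h => ht.not_generic_transpose r s c d e ?_⟩
  · refine (ht.entry i j).imp (fun h => by simp [PartialField.scale, h]) fun h => ?_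
    exact ((l' i * m' j).isUnit.mul h)
  · have e : (PartialField.scale l' m' B').transpose =
        PartialField.scale m' l' B'.transpose := by
      ext i j
      simp only [PartialField.scale, Matrix.transpose_apply]
      ring
    rw [e] at h
    exact h.of_scale

theorem Valid.zeroOrUnit_det (hA : Valid A) (i i' : R) (j j' : C) :
    ZeroOrUnit (A i j * A i' j' - A i j' * A i' j) := by
  have hmul : ∀ {x y : P}, ZeroOrUnit x → ZeroOrUnit y → ZeroOrUnit (x * y) := by
    rintro x y (rfl | hx) (rfl | hy)
    · simp [ZeroOrUnit]
    · simp [ZeroOrUnit]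
    · simp [ZeroOrUnit]
    · exact Or.inr (hx.mul hy)
  by_cases h : A i j = 0
  · have h1 := hmul (hA.tame.entry i j') (hA.tame.entry i' j)
    rw [h, zero_mul, zero_sub]
    exact h1.imp (fun h => by rw [h, neg_zero]) fun h => h.neg
  · have h1 := hmul (hA.tame.entry i j) ((hA.schur h).tame.entry i' j')
    have e : A i j * PartialField.schur A i j i' j' = A i j * A i' j' - A i j' * A i' j := by
      have := Ring.mul_inverse_cancel _ (hA.isUnit h)
      simp only [PartialField.schur]
      linear_combination (-A i' j * A i j') * this
    rwa [e] at h1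

end Pivot

section Lifting

variable {S P : Type*} [CommRing S] [CommRing P]

/-- The properties of a homomorphism from a partial field `(S, Γ)` to a ring `P` which allow
to lift valid matrices over `P` to matrices over `(S, Γ)`. -/
structure Lifting (Γ : Subgroup Sˣ) (π : S →+* P) : Prop where
  neg_one_mem : -1 ∈ Γ
  surj : ∀ p, IsUnit p → ∃ g ∈ Γ, π (g : Sˣ) = p
  exists_fundamental : ∀ p, IsUnit p → ZeroOrUnit (1 - p) →
    ∃ g ∈ Γ, π (g : Sˣ) = p ∧ Mem Γ (1 - (g : S))
  inj : ∀ g ∈ Γ, ∀ h ∈ Γ, Mem Γ (1 - (g : S)) → Mem Γ (1 - (h : S)) → π (g : Sˣ) = π (h : Sˣ) →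
    g = h
  of_valid : ∀ x z w : P, IsUnit x → IsUnit z → IsUnit w →
    Valid !![1, 0, 1, 1; 1, 1, x, 0; 0, 1, z, w] →
      x = 1 ∧ w = z - 1 ∨ z = x ∧ w * (1 - z) = z ∨ z = x - 1 ∧ w = -1 ∨ z = x - 1 ∧ w = z

variable {Γ : Subgroup Sˣ} {π : S →+* P}

theorem Mem.sub_symm (h1 : -1 ∈ Γ) {x y : S} (h : Mem Γ (x - y)) : Mem Γ (y - x) := by
  simpa using h.neg h1

theorem Lifting.mul_eq_mul (L : Lifting Γ π) {a b a' b' : S} (ha : Mem Γ a) (hb : Mem Γ b)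
    (ha' : Mem Γ a') (hb' : Mem Γ b') (ha0 : a ≠ 0) (hb0 : b ≠ 0) (ha0' : a' ≠ 0) (hb0' : b' ≠ 0)
    (h : Mem Γ (a - b)) (h' : Mem Γ (a' - b')) (hπ : π a * π b' = π a' * π b) :
    a * b' = a' * b := by
  obtain ⟨a, haΓ, rfl⟩ := ha.exists_unit ha0
  obtain ⟨b, hbΓ, rfl⟩ := hb.exists_unit hb0
  obtain ⟨a', haΓ', rfl⟩ := ha'.exists_unit ha0'
  obtain ⟨b', hbΓ', rfl⟩ := hb'.exists_unit hb0'
  have key : ∀ {x y : Sˣ}, x ∈ Γ → Mem Γ ((x : S) - y) → Mem Γ (1 - ((x⁻¹ * y : Sˣ) : S)) := by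
    intro x y hx h
    have := (mem_unit_mul_iff (inv_mem hx)).2 h
    simpa [mul_sub] using this
  have hu : ∀ x : Sˣ, π ((x⁻¹ : Sˣ) : S) * π x = 1 := fun x => by rw [← map_mul]; simp
  have := L.inj _ (mul_mem (inv_mem haΓ) hbΓ) _ (mul_mem (inv_mem haΓ') hbΓ') (key haΓ h)
    (key haΓ' h') (by
      rw [Units.val_mul, Units.val_mul, map_mul, map_mul]
      linear_combination (-π ((a⁻¹ : Sˣ) : S) * π ((a'⁻¹ : Sˣ) : S)) * hπ
        + π ((a'⁻¹ : Sˣ) : S) * π b' * hu a - π ((a⁻¹ : Sˣ) : S) * π b * hu a')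
  rw [inv_mul_eq_iff_eq_mul, ← mul_assoc, mul_comm a, mul_assoc, eq_inv_mul_iff_mul_eq] at this
  rw [← Units.val_mul, ← Units.val_mul, this]

theorem Lifting.eq_of_map_eq (L : Lifting Γ π) {a b : S} (ha : Mem Γ a) (hb : Mem Γ b)
    (ha0 : a ≠ 0) (hb0 : b ≠ 0) (h : Mem Γ (1 - a)) (h' : Mem Γ (1 - b)) (hπ : π a = π b) :
    a = b := by
  have : (1 : S) ≠ 0 := by
    rintro h1
    exact ha0 (by rw [← mul_one a, h1, mul_zero])
  simpa using (L.mul_eq_mul Mem.one ha Mem.one hb this ha0 this hb0 h h' (by simp [hπ])).symm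

variable [Nontrivial P]

theorem Mem.eq_of_map_eq {x y : S} (h : Mem Γ (x - y)) (hπ : π x = π y) : x = y := by
  rw [← sub_eq_zero, ← h.map_eq_zero_iff π, map_sub, hπ, sub_self]

/-- If two minors of a `2 × 3` matrix with nonzero entries lie in the partial field and the image
is not generic, then so does the third minor. -/
theorem Lifting.mem_det_of_not_generic (L : Lifting Γ π) {a b c a' b' c' : S}
    (ha : Mem Γ a) (hb : Mem Γ b) (hc : Mem Γ c) (ha' : Mem Γ a') (hb' : Mem Γ b') (hc' : Mem Γ c')
    (ha0 : a ≠ 0) (hb0 : b ≠ 0) (hc0 : c ≠ 0) (ha0' : a' ≠ 0) (hb0' : b' ≠ 0) (hc0' : c' ≠ 0)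
    (hab : Mem Γ (a * b' - b * a')) (hac : Mem Γ (a * c' - c * a'))
    (h : π a * π b' - π b * π a' = 0 ∨ π a * π c' - π c * π a' = 0 ∨
      π b * π c' - π c * π b' = 0) : Mem Γ (b * c' - c * b') := by
  have hS := π.domain_nontrivial
  have hne : ∀ {x y : S}, Mem Γ x → Mem Γ y → x ≠ 0 → y ≠ 0 → x * y ≠ 0 :=
    fun hx hy hx0 hy0 => ((hx.isUnit hx0).mul (hy.isUnit hy0)).ne_zero
  obtain ⟨u', huΓ', hu'⟩ := ha'.exists_unit ha0'
  rw [← mem_unit_mul_iff huΓ', hu']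
  rcases h with h | h | h
  · rw [← map_mul, ← map_mul, ← map_sub, hab.map_eq_zero_iff] at h
    convert hb'.mul hac using 1
    linear_combination -c' * h
  · rw [← map_mul, ← map_mul, ← map_sub, hac.map_eq_zero_iff] at h
    convert (hc'.mul hab).neg L.neg_one_mem using 1
    linear_combination b' * h
  · have := L.mul_eq_mul (ha.mul hb') (hb.mul ha') (ha.mul hc') (hc.mul ha') (hne ha hb' ha0 hb0')
      (hne hb ha' hb0 ha0') (hne ha hc' ha0 hc0') (hne hc ha' hc0 ha0') hab hac (by
        simp only [map_mul]
        linear_combination (-π a * π a') * h)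
    refine Or.inl ((ha.isUnit ha0).mul_left_cancel ?_)
    linear_combination -this

/-- If the image of a matrix of the form `!![1, 0, 1, 1; 1, 1, x, 0; 0, 1, z, w]` is valid, then the
minors not involving both of the last two columns determine that the remaining ones lie in the
partial field. -/
theorem Lifting.mem_sub_of_valid (L : Lifting Γ π) {x z w : S} (hx : Mem Γ x) (hz : Mem Γ z)
    (hw : Mem Γ w) (hx0 : x ≠ 0) (hz0 : z ≠ 0) (hw0 : w ≠ 0) (h1x : Mem Γ (1 - x))
    (hxz : Mem Γ (x - z)) (hxz1 : Mem Γ (1 + z - x)) (h1w : Mem Γ (1 + w))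
    (hV : Valid !![1, 0, 1, 1; 1, 1, π x, 0; 0, 1, π z, π w]) : Mem Γ (w - z) := by
  have hS := π.domain_nontrivial
  have h1 := L.neg_one_mem
  have hu : ∀ {y : S}, Mem Γ y → y ≠ 0 → IsUnit (π y) := fun hy hy0 => (hy.isUnit hy0).map π
  have hwπ := (hu hw hw0).ne_zero
  have hzπ := (hu hz hz0).ne_zero
  have h1w' : Mem Γ (1 - -w) := by simpa using h1w
  rcases L.of_valid _ _ _ (hu hx hx0) (hu hz hz0) (hu hw hw0) hV with
    ⟨hx1, hwz⟩ | ⟨hzx, hwz⟩ | ⟨hzx, hwz⟩ | ⟨hzx, hwz⟩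
  · obtain rfl : 1 = x := h1x.eq_of_map_eq (π := π) (by simp [hx1])
    have hz1 : 1 - z ≠ 0 := by
      intro h
      apply hwπ
      rw [hwz, ← neg_sub, ← map_one π, ← map_sub, h, map_zero, neg_zero]
    have := L.eq_of_map_eq (hw.neg h1) hxz (neg_ne_zero.2 hw0) hz1 h1w' (by simpa using hz)
      (by simp [hwz])
    convert Mem.one.neg h1 using 1
    linear_combination -this
  · obtain rfl : x = z := hxz.eq_of_map_eq hzx.symm
    have hx1 : 1 - x ≠ 0 := by
      intro h
      apply hzπ
      rw [← hwz, ← map_one π, ← map_sub, h, map_zero, mul_zero]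
    have := L.mul_eq_mul Mem.one (hw.neg h1) h1x (hx.neg h1) one_ne_zero (neg_ne_zero.2 hw0) hx1
      (neg_ne_zero.2 hx0) h1w' (by simpa using Mem.one) (by
        simp only [map_one, map_sub, map_neg]
        linear_combination hwz)
    convert hw.mul hx using 1
    linear_combination this
  · have e1 : 1 + z = x := hxz1.eq_of_map_eq (π := π) (by simp [hzx])
    have e2 : -w = 1 := (h1w'.sub_symm h1).eq_of_map_eq (π := π) (by simp [hwz])
    convert hx.neg h1 using 1
    linear_combination -e1 - e2
  · have e1 : 1 + z = x := hxz1.eq_of_map_eq (π := π) (by simp [hzx])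
    have := L.eq_of_map_eq (hw.neg h1) (hz.neg h1) (neg_ne_zero.2 hw0) (neg_ne_zero.2 hz0)
      h1w' (by simpa [e1] using hx) (by simp [hwz])
    left
    linear_combination -this

end Lifting

section Chain

variable {R C S P : Type*} [CommRing S] [CommRing P] {A : Matrix R C S} {D : Set C} {r s t : R}

/-- There is a chain of `k + 1` rows from `r` to `s` such that consecutive rows have nonzero
entries in a common column in `D`. -/
def Chain (A : Matrix R C S) (D : Set C) : ℕ → R → R → Prop
  | 0, r, s => r = s
  | k + 1, r, s => ∃ c ∈ D, ∃ t, A r c ≠ 0 ∧ A t c ≠ 0 ∧ Chain A D k t s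

theorem Chain.trans {k m : ℕ} (h : Chain A D k r s) (h' : Chain A D m s t) :
    Chain A D (k + m) r t := by
  induction k generalizing r with
  | zero => obtain rfl : r = s := h; simpa using h'
  | succ k ih =>
    obtain ⟨c, hc, q, h1, h2, h3⟩ := h
    rw [Nat.add_right_comm]
    exact ⟨c, hc, q, h1, h2, ih h3⟩

theorem chain_one {c : C} (hc : c ∈ D) (hr : A r c ≠ 0) (hs : A s c ≠ 0) : Chain A D 1 r s :=
  ⟨c, hc, s, hr, hs, rfl⟩

theorem Chain.symm {k : ℕ} (h : Chain A D k r s) : Chain A D k s r := by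
  induction k generalizing r with
  | zero => exact Eq.symm h
  | succ k ih =>
    obtain ⟨c, hc, q, h1, h2, h3⟩ := h
    exact (ih h3).trans (chain_one hc h2 h1)

theorem Chain.schur_of_forall {c : C} {k : ℕ} (h : Chain A D k r s)
    (h0 : ∀ m ≤ k, ∀ q, Chain A D m q s → A q c = 0) : Chain (schur A t c) D k r s := by
  induction k generalizing r with
  | zero => exact h
  | succ k ih =>
    have hr := h0 _ le_rfl _ h
    obtain ⟨d, hd, q, h1, h2, h3⟩ := h
    refine ⟨d, hd, q, ?_, ?_, ih h3 fun m hm => h0 m (by omega)⟩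
    · rwa [schur_of_left _ hr]
    · rwa [schur_of_left _ (h0 k (by omega) _ h3)]

/-- A chain of minimal length at least two gets shorter in some Schur complement. -/
theorem Chain.exists_schur {k : ℕ} (hA : ∀ i j, A i j ≠ 0 → IsUnit (A i j))
    (h : Chain A D (k + 2) r s) (hmin : ∀ m < k + 2, ¬ Chain A D m r s) :
    ∃ c ∈ D, ∃ d ∈ D, ∃ t, A r c ≠ 0 ∧ A t c ≠ 0 ∧ A t d ≠ 0 ∧ A r d = 0 ∧
      Chain A D (k + 1) t s ∧ Chain (schur A t d) D (k + 1) r s ∧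
      ((A s d ≠ 0 ∧ A s c = 0 ∧ k = 0) ∨ A s d = 0) := by
  obtain ⟨c, hc, t, hrc, htc, h⟩ := h
  have h' := h
  obtain ⟨d, hd, q, htd, hqd, hq⟩ := h'
  have hrd : A r d = 0 := by
    by_contra hrd
    exact hmin (k + 1) (by omega) ⟨d, hd, q, hrd, hqd, hq⟩
  have hqc : A q c = 0 := by
    by_contra hqc
    exact hmin (k + 1) (by omega) ⟨c, hc, q, hrc, hqc, hq⟩
  refine ⟨c, hc, d, hd, t, hrc, htc, htd, hrd, h, ⟨c, hc, q, ?_, ?_, ?_⟩, ?_⟩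
  · rwa [schur_of_left _ hrd]
  · rw [schur, hqc, zero_sub]
    intro h0
    obtain ⟨x, hx⟩ := hA _ _ htd
    obtain ⟨y, hy⟩ := hA _ _ hqd
    rw [← hx, ← hy, Ring.inverse_unit, neg_eq_zero, ← Units.val_mul, Units.mul_right_eq_zero] at h0
    exact htc h0
  · cases k with
    | zero => exact hq
    | succ k =>
      obtain ⟨e, he, p, hqe, hpe, hp⟩ := hq
      have hte : A t e = 0 := by
        by_contra hte
        exact hmin (k + 2) (by omega) ⟨c, hc, t, hrc, htc, e, he, p, hte, hpe, hp⟩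
      have h0 : ∀ m ≤ k, ∀ q, Chain A D m q s → A q d = 0 := by
        intro m hm q hq
        by_contra hqd
        exact hmin (m + 2) (by omega) ⟨c, hc, t, hrc, htc, d, hd, q, htd, hqd, hq⟩
      refine ⟨e, he, p, ?_, ?_, hp.schur_of_forall h0⟩
      · rwa [schur_of_right _ hte]
      · rwa [schur_of_left _ (h0 k le_rfl p hp)]
  · cases k with
    | zero => obtain rfl : q = s := hq; exact Or.inl ⟨hqd, hqc, rfl⟩
    | succ k =>
      right
      by_contra hsd
      exact hmin 2 (by omega) ⟨c, hc, t, hrc, htc, d, hd, s, htd, hsd, rfl⟩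

theorem map_schur (π : S →+* P) {c : C} (h : IsUnit (A r c)) :
    (schur A r c).map π = schur (A.map π) r c := by
  obtain ⟨u, hu⟩ := h
  have : Ring.inverse (π u) = π ((u⁻¹ : Sˣ) : S) := by
    have := Ring.inverse_unit (Units.map (π : S →* P) u)
    simpa using this
  ext i j
  simp [schur, ← hu, this]

theorem map_restrict (π : S →+* P) (W : Set (R ⊕ C)) :
    (restrict A W).map π = restrict (A.map π) W := by
  ext i j
  by_cases h : Sum.inl i ∈ W ∧ Sum.inr j ∈ W <;> simp [restrict, h]

/-- Functions which are constant on the classes of an equivalence relation. -/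
theorem exists_extension {X G : Type*} [Group G] {Γ : Subgroup G} (q : X → G) (hq : ∀ x, q x ∈ Γ)
    (U : Set X) (rel : X → X → Prop) (hrel : Equivalence rel)
    (hU : ∀ x ∈ U, ∀ y ∈ U, rel x y → q x = q y) :
    ∃ k : X → G, (∀ x, k x ∈ Γ) ∧ (∀ x y, rel x y → k x = k y) ∧ ∀ x ∈ U, k x = q x := by
  classical
  have key : ∀ x, ∃ g ∈ Γ, (∀ y ∈ U, rel x y → g = q y) ∧ ((¬ ∃ y ∈ U, rel x y) → g = 1) := by
    intro x
    by_cases h : ∃ y ∈ U, rel x y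
    · obtain ⟨y, hy, hxy⟩ := h
      exact ⟨q y, hq y, fun z hz hxz => hU y hy z hz (hrel.trans (hrel.symm hxy) hxz),
        fun h => absurd ⟨y, hy, hxy⟩ h⟩
    · exact ⟨1, one_mem _, fun y hy hxy => absurd ⟨y, hy, hxy⟩ h, fun _ => rfl⟩
  choose k hk hk' hk1 using key
  refine ⟨k, hk, fun x y hxy => ?_, fun x hx => hk' x x hx (hrel.refl x)⟩
  by_cases h : ∃ z ∈ U, rel x z
  · obtain ⟨z, hz, hxz⟩ := h
    rw [hk' x z hz hxz, hk' y z hz (hrel.trans (hrel.symm hxy) hxz)]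
  · rw [hk1 x h, hk1 y fun ⟨z, hz, hyz⟩ => h ⟨z, hz, hrel.trans hxy hyz⟩]

variable {Γ : Subgroup Sˣ} {π : S →+* P} [Nontrivial P]

theorem IsMatrix.map_eq_zero_iff (hA : IsMatrix Γ A) (π : S →+* P) (i : R) (j : C) :
    π (A i j) = 0 ↔ A i j = 0 := (hA.mem i j).map_eq_zero_iff π

theorem IsMatrix.ne_zero_iff {A₁ A₂ : Matrix R C S} (h₁ : IsMatrix Γ A₁) (h₂ : IsMatrix Γ A₂)
    (h : A₁.map π = A₂.map π) (i : R) (j : C) : A₁ i j = 0 ↔ A₂ i j = 0 := by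
  rw [← h₁.map_eq_zero_iff π, ← h₂.map_eq_zero_iff π]
  exact Eq.congr_left (congrFun (congrFun h i) j)

theorem Lifting.scale_eq_of_chain (L : Lifting Γ π) (l : R → Sˣ) (m : C → Sˣ) {u : C} {k : ℕ}
    {A₁ A₂ : Matrix R C S} (h₁ : IsMatrix Γ A₁) (h₂ : IsMatrix Γ A₂) (h : A₁.map π = A₂.map π)
    (hs : ∀ i, ∀ j ∈ D, A₁ i j = scale l m A₂ i j) (hc : Chain A₁ D k r s) (hr0 : A₁ r u ≠ 0)
    (hs0 : A₁ s u ≠ 0) : l r * A₁ s u * A₂ r u = A₁ r u * l s * A₂ s u := by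
  have hS := π.domain_nontrivial
  induction k using Nat.strong_induction_on generalizing A₁ A₂ r with
  | _ k ih =>
    by_cases hmin : ∃ k' < k, Chain A₁ D k' r s
    · obtain ⟨k', hk', hc'⟩ := hmin
      exact ih k' hk' h₁ h₂ h hs hc' hr0 hs0
    push Not at hmin
    have hne : ∀ {x y : S}, IsUnit x → IsUnit y → x * y ≠ 0 := fun hx hy => (hx.mul hy).ne_zero
    have h0 := h₁.ne_zero_iff h₂ h
    have hU₁ : ∀ {i j}, A₁ i j ≠ 0 → IsUnit (A₁ i j) := fun h => h₁.isUnit h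
    have hU₂ : ∀ {i j}, A₁ i j ≠ 0 → IsUnit (A₂ i j) := fun h => h₂.isUnit (mt (h0 _ _).2 h)
    have one : ∀ {r t} (c), c ∈ D → A₁ r c ≠ 0 → A₁ t c ≠ 0 → A₁ r u ≠ 0 → A₁ t u ≠ 0 →
        l r * A₁ t u * A₂ r u = A₁ r u * l t * A₂ t u := by
      intro r t c hc hrc htc hru htu
      have := L.mul_eq_mul ((h₁.mem r c).mul (h₁.mem t u)) ((h₁.mem r u).mul (h₁.mem t c))
        ((h₂.mem r c).mul (h₂.mem t u)) ((h₂.mem r u).mul (h₂.mem t c))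
        (hne (hU₁ hrc) (hU₁ htu)) (hne (hU₁ hru) (hU₁ htc)) (hne (hU₂ hrc) (hU₂ htu))
        (hne (hU₂ hru) (hU₂ htc)) (h₁.mem_det r t c u) (h₂.mem_det r t c u) (by
          have := fun i j => congrFun (congrFun h i) j
          simp only [Matrix.map_apply] at this
          simp only [map_mul, this])
      rw [hs r c hc, hs t c hc] at this
      refine (((m c).isUnit.mul (hU₂ hrc)).mul (hU₂ htc)).mul_left_cancel ?_
      simp only [scale] at this
      linear_combination this
    match k, hc with
    | 0, hc => obtain rfl : r = s := hc; ring
    | 1, hc =>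
      obtain ⟨c, hcD, t, hrc, htc, rfl⟩ := hc
      exact one _ hcD hrc htc hr0 hs0
    | k + 2, hc =>
      obtain ⟨c, hc, d, hd, t, hrc, htc, htd, hrd, hts, hc', -⟩ :=
        hc.exists_schur (fun i j => h₁.isUnit) hmin
      by_cases htu : A₁ t u = 0
      · have e₁ := fun i => schur_of_right (c := d) A₁ htu i
        have e₂ := fun i => schur_of_right (c := d) A₂ ((h0 _ _).1 htu) i
        have := ih (k + 1) (by omega) (h₁.schur htd) (h₂.schur (mt (h0 _ _).2 htd))
          (by rw [map_schur π (hU₁ htd), map_schur π (hU₂ htd), h]) (fun i j hj => by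
            rw [← schur_scale l m A₂ t d (hU₂ htd)]
            simp only [schur, hs _ _ hd, hs _ _ hj]) hc' (by rwa [e₁]) (by rwa [e₁])
        rwa [e₁, e₁, e₂, e₂] at this
      · have e₁ := one _ hc hrc htc hr0 htu
        have e₂ := ih (k + 1) (by omega) h₁ h₂ h hs hts htu hs0
        refine (((l t).isUnit.mul (hU₁ htu)).mul (hU₂ htu)).mul_left_cancel ?_
        linear_combination (l t * A₁ s u * A₂ t u : S) * e₁ + (A₁ r u * A₂ t u * l t : S) * e₂

/-- Lifts of matrices are unique up to scaling. -/
theorem Lifting.exists_eq_scale (L : Lifting Γ π) {A₁ A₂ : Matrix R C S} (h₁ : IsMatrix Γ A₁)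
    (h₂ : IsMatrix Γ A₂) (h : A₁.map π = A₂.map π) {T : Set C} (hT : T.Finite)
    (h0 : ∀ i, ∀ j ∉ T, A₁ i j = 0) :
    ∃ (l : R → Sˣ) (m : C → Sˣ), (∀ i, l i ∈ Γ) ∧ (∀ j, m j ∈ Γ) ∧ A₁ = scale l m A₂ := by
  classical
  induction T, hT using Set.Finite.induction_on generalizing A₁ A₂ with
  | empty =>
    refine ⟨1, 1, fun _ => one_mem _, fun _ => one_mem _, ?_⟩
    ext i j
    have := h0 i j (by simp)
    simp [scale, this, (h₁.ne_zero_iff h₂ h i j).1 this]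
  | @insert u T hu hT ih =>
    have hz := h₁.ne_zero_iff h₂ h
    set W : Set (R ⊕ C) := {x | x ≠ Sum.inr u}
    obtain ⟨l, m, hl, hm, hlm⟩ := ih (h₁.restrict W) (h₂.restrict W)
      (by rw [map_restrict, map_restrict, h]) (fun i j hj => by
        by_cases hju : j = u
        · exact restrict_right (by simp [W, hju])
        · rw [restrict_pos (by simp [W]) (by simpa [W] using hju)]
          exact h0 i j (by simp [hju, hj]))
    have hs : ∀ i, ∀ j ∈ ({u}ᶜ : Set C), A₁ i j = scale l m A₂ i j := by
      intro i j hj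
      have := congrFun (congrFun hlm i) j
      simp only [scale] at this
      rwa [restrict_pos (by simp [W]) (by simpa [W] using hj),
        restrict_pos (by simp [W]) (by simpa [W] using hj)] at this
    have hq : ∀ r, ∃ g ∈ Γ, A₁ r u = l r * g * A₂ r u := by
      intro r
      by_cases hr : A₁ r u = 0
      · exact ⟨1, one_mem _, by rw [hr, (hz r u).1 hr, mul_zero]⟩
      · obtain ⟨x, hx, hx'⟩ := (h₁.mem r u).exists_unit hr
        obtain ⟨y, hy, hy'⟩ := (h₂.mem r u).exists_unit (mt (hz r u).2 hr)
        refine ⟨(l r)⁻¹ * x * y⁻¹, mul_mem (mul_mem (inv_mem (hl r)) hx) (inv_mem hy), ?_⟩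
        rw [← hx', ← hy']
        norm_cast
        group
    choose q hq hqe using hq
    obtain ⟨k, hk, hkr, hkq⟩ := exists_extension q hq {r | A₁ r u ≠ 0}
      (fun r s => ∃ n, Chain A₁ {u}ᶜ n r s) ⟨fun r => ⟨0, rfl⟩, fun ⟨n, hn⟩ => ⟨n, hn.symm⟩,
        fun ⟨n, hn⟩ ⟨n', hn'⟩ => ⟨_, hn.trans hn'⟩⟩ (by
        rintro r hr s hs' ⟨n, hn⟩
        have e := L.scale_eq_of_chain l m h₁ h₂ h hs hn hr hs'
        obtain ⟨y, hy, hy'⟩ := (h₂.mem r u).exists_unit (mt (hz r u).2 hr)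
        obtain ⟨y', hy, hy''⟩ := (h₂.mem s u).exists_unit (mt (hz s u).2 hs')
        rw [hqe r, hqe s, ← hy', ← hy''] at e
        have e' : l r * (l s * q s * y') * y = l r * q r * y * l s * y' := by exact_mod_cast e
        have : (l r * l s * y * y') * q s = (l r * l s * y * y') * q r := by
          calc _ = l r * (l s * q s * y') * y := by ac_rfl
            _ = _ := e'
            _ = _ := by ac_rfl
        exact (mul_left_cancel this).symm)
    have hc : ∀ j, ∃ g ∈ Γ, ∀ i, j ≠ u → A₁ i j ≠ 0 → g = k i := by
      intro j
      by_cases hj : ∃ i, A₁ i j ≠ 0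
      · obtain ⟨i, hi⟩ := hj
        refine ⟨k i, hk i, fun i' hju hi' => hkr _ _ ⟨1, chain_one (by simpa using hju) hi hi'⟩⟩
      · exact ⟨1, one_mem _, fun i _ hi => absurd ⟨i, hi⟩ hj⟩
    choose g hg hgk using hc
    refine ⟨fun i => l i * k i, fun j => if j = u then 1 else m j * (g j)⁻¹,
      fun i => mul_mem (hl i) (hk i), fun j => ?_, ?_⟩
    · dsimp only
      split_ifs
      · exact one_mem _
      · exact mul_mem (hm j) (inv_mem (hg j))
    · ext i j
      by_cases hij : A₁ i j = 0
      · simp [scale, hij, (hz i j).1 hij]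
      by_cases hj : j = u
      · subst hj
        simp [scale, hqe i, hkq i hij]
      · rw [hs i j hj]
        simp only [scale, if_neg hj, Units.val_mul, hgk j i hj hij]
        linear_combination (-l i * m j * A₂ i j : S) * (k i).mul_inv

end Chain

section Glue

variable {R C S P : Type*} [CommRing S] [CommRing P] {A : Matrix R C S} {r s t : R}
  {Γ : Subgroup Sˣ} {π : S →+* P}

theorem IsMatrix.submatrix {R' C' : Type*} (hA : IsMatrix Γ A) (f : R' → R) (g : C' → C) :
    IsMatrix Γ (A.submatrix f g) :=
  fun n f' g' => hA n (f ∘ f') (g ∘ g')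

theorem map_scale (π : S →+* P) (l : R → Sˣ) (m : C → Sˣ) :
    (scale l m A).map π =
      scale (fun i => Units.map (π : S →* P) (l i)) (fun j => Units.map (π : S →* P) (m j))
        (A.map π) := by
  ext i j
  simp [scale]

/-- The set of all rows and of all columns other than `u`. -/
def off (R : Type*) {C : Type*} (u : C) : Set (R ⊕ C) := {x | x ≠ Sum.inr u}

theorem restrict_off {u j : C} (i : R) (h : j ≠ u) : restrict A (off R u) i j = A i j :=
  restrict_pos (by simp [off]) (by simpa [off] using h)

theorem restrict_off_submatrix {R' C' : Type*} {u : C} (f : R' → R) {g : C' → C}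
    (h : ∀ j, g j ≠ u) : (restrict A (off R u)).submatrix f g = A.submatrix f g := by
  ext i j
  exact restrict_off _ (h j)

variable [Nontrivial P]

theorem Lifting.mem_det_of_path (L : Lifting Γ π) {u v c d : C}
    (hu : IsMatrix Γ (restrict A (off R u))) (hv : IsMatrix Γ (restrict A (off R v)))
    (hV : Valid (A.map π)) (huv : u ≠ v) (hcu : c ≠ u) (hcv : c ≠ v) (hdu : d ≠ u) (hdv : d ≠ v)
    (hrc : A r c ≠ 0) (hrd : A r d = 0) (hru : A r u ≠ 0) (hrv : A r v ≠ 0)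
    (htc : A t c ≠ 0) (htd : A t d ≠ 0) (htu : A t u ≠ 0) (htv : A t v = 0)
    (hsc : A s c = 0) (hsd : A s d ≠ 0) (hsu : A s u ≠ 0) (hsv : A s v ≠ 0) :
    Mem Γ (A r u * A s v - A r v * A s u) := by
  have hS := π.domain_nontrivial
  have hrt : r ≠ t := by rintro rfl; exact htd hrd
  have hrs : r ≠ s := by rintro rfl; exact hsd hrd
  have hts : t ≠ s := by rintro rfl; exact htc hsc
  have hcd : c ≠ d := by rintro rfl; exact hrc hrd
  have mem : ∀ i {j}, j ≠ v → Mem Γ (A i j) := fun i {j} hj => by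
    rw [← restrict_off (A := A) i hj]; exact hv.mem i j
  have mem' : ∀ i, Mem Γ (A i v) := fun i => by
    rw [← restrict_off (A := A) i huv.symm]; exact hu.mem i v
  obtain ⟨a, ha, ha'⟩ := (mem r hcv).exists_unit hrc
  obtain ⟨b, hb, hb'⟩ := (mem t hcv).exists_unit htc
  obtain ⟨p, hp, hp'⟩ := (mem t hdv).exists_unit htd
  obtain ⟨q, hq, hq'⟩ := (mem s hdv).exists_unit hsd
  obtain ⟨e, he, he'⟩ := (mem r huv).exists_unit hru
  obtain ⟨f, hf, hf'⟩ := (mem' r).exists_unit hrv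
  obtain ⟨x, hx, hx'⟩ := (mem t huv).exists_unit htu
  obtain ⟨z, hz, hz'⟩ := (mem s huv).exists_unit hsu
  obtain ⟨w, hw, hw'⟩ := (mem' s).exists_unit hsv
  set l : Fin 3 → Sˣ := ![1, a * b⁻¹, a * p * b⁻¹ * q⁻¹]
  set m : Fin 4 → Sˣ := ![a⁻¹, b * a⁻¹ * p⁻¹, e⁻¹, f⁻¹]
  have hl : ∀ i, l i ∈ Γ := by
    intro i
    fin_cases i
    · exact one_mem _
    · exact mul_mem ha (inv_mem hb)
    · exact mul_mem (mul_mem (mul_mem ha hp) (inv_mem hb)) (inv_mem hq)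
  have hm : ∀ j, m j ∈ Γ := by
    intro j
    fin_cases j
    · exact inv_mem ha
    · exact mul_mem (mul_mem hb (inv_mem ha)) (inv_mem hp)
    · exact inv_mem he
    · exact inv_mem hf
  have hB : scale l m (A.submatrix ![r, t, s] ![c, d, u, v]) =
      !![1, 0, 1, 1; 1, 1, ↑(l 1 * m 2 * x), 0; 0, 1, ↑(l 2 * m 2 * z), ↑(l 2 * m 3 * w)] := by
    ext i j
    have h1 := a.mul_inv
    have h2 := b.mul_inv
    have h3 := p.mul_inv
    have h4 := q.mul_inv
    fin_cases i <;> fin_cases j <;>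
      simp [scale, l, m, hrd, htv, hsc, ← ha', ← hb', ← hp', ← hq', ← he', ← hf', ← hx', ← hz',
        ← hw']
    · linear_combination (b * ↑b⁻¹ : S) * h1 + h2
    · linear_combination (b * ↑b⁻¹ * p * ↑p⁻¹ : S) * h1 + (p * ↑p⁻¹ : S) * h2 + h3
    · linear_combination (b * ↑b⁻¹ * p * ↑p⁻¹ * q * ↑q⁻¹ : S) * h1 +
        (p * ↑p⁻¹ * q * ↑q⁻¹ : S) * h2 + (q * ↑q⁻¹ : S) * h3 + h4
  set X := l 1 * m 2 * x
  set Z := l 2 * m 2 * z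
  set W := l 2 * m 3 * w
  have hX : X ∈ Γ := mul_mem (mul_mem (hl 1) (hm 2)) hx
  have hZ : Z ∈ Γ := mul_mem (mul_mem (hl 2) (hm 2)) hz
  have hW : W ∈ Γ := mul_mem (mul_mem (hl 2) (hm 3)) hw
  have hsub : ∀ {y} (g : Fin 3 → Fin 4), IsMatrix Γ (restrict A (off R y)) →
      (∀ j, ![c, d, u, v] (g j) ≠ y) → IsMatrix Γ ((!![1, 0, 1, 1; 1, 1, (X : S), 0;
        0, 1, (Z : S), (W : S)]).submatrix id g) := by
    intro y g hy hg
    have := (hy.submatrix ![r, t, s] (![c, d, u, v] ∘ g)).scale hl (m := m ∘ g) (fun j => hm _)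
    rw [restrict_off_submatrix (g := ![c, d, u, v] ∘ g) _ hg] at this
    rw [← hB]
    exact this
  have hB₁ : IsMatrix Γ !![1, 0, 1; 1, 1, (X : S); 0, 1, (Z : S)] := by
    convert hsub ![0, 1, 2] hv (by intro j; fin_cases j <;> assumption) using 1
    ext i j
    fin_cases i <;> fin_cases j <;> rfl
  have hB₂ : IsMatrix Γ !![1, 0, 1; 1, 1, 0; 0, 1, (W : S)] := by
    convert hsub ![0, 1, 3] hu (by
      intro j; fin_cases j <;> first | assumption | exact huv.symm) using 1
    ext i j
    fin_cases i <;> fin_cases j <;> rfl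
  have hVB : Valid !![1, 0, 1, 1; 1, 1, π X, 0; 0, 1, π Z, π W] := by
    have h1 : Function.Injective ![r, t, s] := by
      intro i j
      fin_cases i <;> fin_cases j <;> simp [hrt, hrs, hts, hrt.symm, hrs.symm, hts.symm]
    have h2 : Function.Injective ![c, d, u, v] := by
      intro i j
      fin_cases i <;> fin_cases j <;> simp [hcd, hcu, hcv, hdu, hdv, huv, hcd.symm, hcu.symm,
        hcv.symm, hdu.symm, hdv.symm, huv.symm]
    have := (hV.submatrix h1 h2).scale (fun i => Units.map (π : S →* P) (l i))
      (fun j => Units.map (π : S →* P) (m j))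
    rw [Matrix.submatrix_map, ← map_scale, hB] at this
    convert this using 1
    ext i j
    fin_cases i <;> fin_cases j <;> simp
  have key := L.mem_sub_of_valid (mem_coe hX) (mem_coe hZ) (mem_coe hW) X.ne_zero Z.ne_zero
    W.ne_zero (by simpa using (hB₁.mem_det 0 1 0 2).neg L.neg_one_mem)
    (by simpa using (hB₁.mem_det 1 2 1 2).neg L.neg_one_mem)
    (by have := hB₁ 3 id id
        rw [Matrix.det_fin_three] at this
        simp at this
        convert this using 1
        ring)
    (by have := hB₂ 3 id id
        rw [Matrix.det_fin_three] at this
        simp at this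
        convert this using 1
        ring) hVB
  rw [← he', ← hw', ← hf', ← hz']
  rw [← mem_unit_mul_iff (mul_mem (mul_mem (hm 2) (hm 3)) (hl 2))]
  convert key using 1
  simp only [Z, W, Units.val_mul]
  have h1 := e.mul_inv
  have h2 := f.mul_inv
  have h3 : m 2 = e⁻¹ := rfl
  have h4 : m 3 = f⁻¹ := rfl
  rw [h3, h4]
  linear_combination (↑f⁻¹ * ↑(l 2) * w : S) * h1 - (↑e⁻¹ * ↑(l 2) * z : S) * h2

theorem restrict_off_schur {u c : C} (hc : c ≠ u) (h : A r c ≠ 0) :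
    restrict (schur A r c) (off R u) = schur (restrict A (off R u)) r c :=
  (restrict_schur (by rwa [restrict_off _ hc])).symm

theorem Lifting.mem_det_of_chain (L : Lifting Γ π) {u v : C} (huv : u ≠ v) {k : ℕ}
    (hu : IsMatrix Γ (restrict A (off R u))) (hv : IsMatrix Γ (restrict A (off R v)))
    (hV : Valid (A.map π)) (hc : Chain A {u, v}ᶜ k r s) :
    Mem Γ (A r u * A s v - A r v * A s u) := by
  have hS := π.domain_nontrivial
  induction k using Nat.strong_induction_on generalizing A r with
  | _ k ih =>
    by_cases hmin : ∃ k' < k, Chain A {u, v}ᶜ k' r s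
    · obtain ⟨k', hk', hc'⟩ := hmin
      exact ih k' hk' hu hv hV hc'
    push Not at hmin
    have memv : ∀ i {j}, j ≠ v → Mem Γ (A i j) := fun i {j} hj => by
      rw [← restrict_off (A := A) i hj]; exact hv.mem i j
    have mem : ∀ i j, Mem Γ (A i j) := fun i j => by
      by_cases hj : j = v
      · subst hj
        rw [← restrict_off (A := A) i huv.symm]; exact hu.mem i j
      · exact memv i hj
    have detv : ∀ i i' {j j'}, j ≠ v → j' ≠ v → Mem Γ (A i j * A i' j' - A i j' * A i' j) :=
      fun i i' {j j'} hj hj' => by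
        have := hv.mem_det i i' j j'
        simpa only [restrict_off _ hj, restrict_off _ hj'] using this
    have detu : ∀ i i' {j j'}, j ≠ u → j' ≠ u → Mem Γ (A i j * A i' j' - A i j' * A i' j) :=
      fun i i' {j j'} hj hj' => by
        have := hu.mem_det i i' j j'
        simpa only [restrict_off _ hj, restrict_off _ hj'] using this
    have hsch : ∀ {t d}, d ∈ ({u, v}ᶜ : Set C) → A t d ≠ 0 →
        ∀ k' < k, Chain (schur A t d) {u, v}ᶜ k' r s →
        Mem Γ (schur A t d r u * schur A t d s v - schur A t d r v * schur A t d s u) := by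
      intro t d hd htd k' hk' hc'
      have hdu : d ≠ u := fun h => hd (by simp [h])
      have hdv : d ≠ v := fun h => hd (by simp [h])
      refine ih k' hk' ?_ ?_ ?_ hc'
      · rw [restrict_off_schur hdu htd]
        exact hu.schur (by rwa [restrict_off _ hdu])
      · rw [restrict_off_schur hdv htd]
        exact hv.schur (by rwa [restrict_off _ hdv])
      · rw [map_schur π ((mem t d).isUnit htd)]
        exact hV.schur ((mem t d).map_ne_zero π htd)
    by_cases hru : A r u = 0
    · rw [hru, zero_mul, zero_sub]
      exact ((mem _ _).mul (mem _ _)).neg L.neg_one_mem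
    by_cases hrv : A r v = 0
    · rw [hrv, zero_mul, sub_zero]
      exact (mem _ _).mul (mem _ _)
    by_cases hsu : A s u = 0
    · rw [hsu, mul_zero, sub_zero]
      exact (mem _ _).mul (mem _ _)
    by_cases hsv : A s v = 0
    · rw [hsv, mul_zero, zero_sub]
      exact ((mem _ _).mul (mem _ _)).neg L.neg_one_mem
    have ne : ∀ {i j}, A i j ≠ 0 → π (A i j) ≠ 0 := fun h => (mem _ _).map_ne_zero π h
    have one : ∀ {r s c}, c ∈ ({u, v}ᶜ : Set C) → A r c ≠ 0 → A s c ≠ 0 → A r u ≠ 0 → A r v ≠ 0 →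
        A s u ≠ 0 → A s v ≠ 0 → Mem Γ (A r u * A s v - A r v * A s u) := by
      intro r s c hc hrc hsc hru hrv hsu hsv
      refine L.mem_det_of_not_generic (mem r c) (mem r u) (mem r v) (mem s c) (mem s u) (mem s v)
        hrc hru hrv hsc hsu hsv (detv r s (fun h => hc (by simp [h])) huv)
        (detu r s (fun h => hc (by simp [h])) huv.symm) ?_
      by_contra! h
      exact hV.tame.not_generic r s c u v ⟨⟨ne hrc, ne hru, ne hrv⟩, ⟨ne hsc, ne hsu, ne hsv⟩, h⟩
    match k, hc with
    | 0, hc =>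
      obtain rfl : r = s := hc
      left
      ring
    | 1, hc =>
      obtain ⟨c, hcD, t, hrc, htc, rfl⟩ := hc
      exact one hcD hrc htc hru hrv hsu hsv
    | k + 2, hc =>
      obtain ⟨c, hcD, d, hd, t, hrc, htc, htd, hrd, hts, hc', hs⟩ :=
        hc.exists_schur (fun i j h => (mem i j).isUnit h) hmin
      have hsch' := hsch hd htd (k + 1) (by omega) hc'
      rw [schur_of_left _ hrd, schur_of_left _ hrd] at hsch'
      rcases hs with ⟨hsd, hsc, -⟩ | hsd
      · by_cases htu : A t u = 0
        · by_cases htv : A t v = 0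
          · rwa [schur_of_right _ htu, schur_of_right _ htv] at hsch'
          · have := L.mem_det_of_path hv hu hV huv.symm (fun h => hcD (by simp [h]))
              (fun h => hcD (by simp [h])) (fun h => hd (by simp [h])) (fun h => hd (by simp [h]))
              hrc hrd hrv hru htc htd htv htu hsc hsd hsv hsu
            exact this.sub_symm L.neg_one_mem
        · by_cases htv : A t v = 0
          · exact L.mem_det_of_path hu hv hV huv (fun h => hcD (by simp [h]))
              (fun h => hcD (by simp [h])) (fun h => hd (by simp [h])) (fun h => hd (by simp [h]))
              hrc hrd hru hrv htc htd htu htv hsc hsd hsu hsv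
          · have h1 := one hcD hrc htc hru hrv htu htv
            have h2 := ih (k + 1) (by omega) hu hv hV hts
            have := L.mem_det_of_not_generic (mem t u) (mem r u) (mem s u) (mem t v) (mem r v)
              (mem s v) htu hru hsu htv hrv hsv
              (by convert h1.neg L.neg_one_mem using 1; ring)
              (by convert h2 using 1; ring) (by
                by_contra! h
                exact hV.tame.not_generic_transpose u v t r s
                  ⟨⟨ne htu, ne hru, ne hsu⟩, ⟨ne htv, ne hrv, ne hsv⟩, h⟩)
            convert this using 1
            ring
      · rwa [schur_of_left _ hsd, schur_of_left _ hsd] at hsch'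

end Glue

section Pivoting

variable {R C S P : Type*} [CommRing S] [CommRing P] {A : Matrix R C S} {r s t : R} {d : C}
  {Γ : Subgroup Sˣ} {π : S →+* P}

theorem mem_det_restrict (W : Set (R ⊕ C)) {n : ℕ} {f : Fin n → R} {g : Fin n → C}
    (h : Mem Γ (A.submatrix f g).det) : Mem Γ ((restrict A W).submatrix f g).det := by
  by_cases hf : ∃ a, Sum.inl (f a) ∉ W
  · obtain ⟨a, ha⟩ := hf
    exact Or.inl (Matrix.det_eq_zero_of_row_eq_zero a fun j => restrict_left (A := A) ha)
  by_cases hg : ∃ a, Sum.inr (g a) ∉ W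
  · obtain ⟨a, ha⟩ := hg
    exact Or.inl (Matrix.det_eq_zero_of_column_eq_zero a fun j => restrict_right (A := A) ha)
  push Not at hf hg
  convert h using 2
  ext i j
  exact restrict_pos (hf i) (hg j)

theorem mem_det_piv_of_left (hA : IsMatrix Γ A) (h : A t d ≠ 0) {n : ℕ} {f : Fin n → R}
    {g : Fin n → C} (hf : ∀ a, f a ≠ t) : Mem Γ ((piv A t d).submatrix f g).det := by
  obtain ⟨u, huΓ, hu⟩ := (hA.mem t d).exists_unit h
  by_cases hg : Function.Injective g
  swap
  · simp only [Function.Injective, not_forall] at hg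
    obtain ⟨a, b, hab, hne⟩ := hg
    exact Or.inl (Matrix.det_zero_of_column_eq hne fun i => by simp [hab])
  by_cases hd : ∃ b, g b = d
  · obtain ⟨b, rfl⟩ := hd
    have h1 : ((piv A t (g b)).submatrix f g).det =
        ((A.submatrix f g).updateCol b (((u⁻¹ : Sˣ) : S) • fun i => A (f i) (g b))).det := by
      rw [← Matrix.det_transpose, ← Matrix.det_transpose (Matrix.updateCol _ _ _)]
      refine Matrix.det_eq_of_forall_row_eq_smul_add_const
        (fun j => if j = b then 0 else -A t (g j)) b (by simp) ?_
      intro j i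
      by_cases hj : j = b
      · subst hj
        simp [piv, hf i, ← hu]
      · simp [piv, hf i, hj, hg.eq_iff, schur, ← hu]
        ring
    rw [h1, Matrix.det_updateCol_smul, mem_unit_mul_iff (inv_mem huΓ)]
    convert hA n f g using 2
    exact Matrix.updateCol_eq_self _ _
  · push Not at hd
    convert hA.schur h n f g using 2
    ext i j
    simp [piv, hf i, hd j]

theorem schur_piv (h : IsUnit (A t d)) :
    schur (piv A t d) t d = restrict A {x | x ≠ Sum.inl t ∧ x ≠ Sum.inr d} := by
  have hp : IsUnit (piv A t d t d) := by simpa [piv] using h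
  ext i j
  by_cases hi : i = t
  · subst hi
    rw [schur_row _ hp, restrict_left]
    simp
  by_cases hj : j = d
  · subst hj
    rw [schur_col _ hp, restrict_right]
    simp
  rw [restrict_pos (by simpa using hi) (by simpa using hj)]
  obtain ⟨u, hu⟩ := h
  have e : Ring.inverse (-((u⁻¹ : Sˣ) : S)) = -u := by
    rw [← Units.val_neg, Ring.inverse_unit]
    simp
  simp only [schur, piv, hi, hj, if_true, if_false, ← hu, Ring.inverse_unit, e]
  linear_combination (A i d * A t j * ((u⁻¹ : Sˣ) : S)) * u.mul_inv

theorem IsMatrix.piv (h1 : -1 ∈ Γ) (hA : IsMatrix Γ A) (h : A t d ≠ 0) :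
    IsMatrix Γ (piv A t d) := by
  intro n f g
  by_cases hf : ∃ a, f a = t
  swap
  · push Not at hf
    exact mem_det_piv_of_left hA h hf
  by_cases hg : ∃ b, g b = d
  swap
  · push Not at hg
    rw [← Matrix.det_transpose, Matrix.transpose_submatrix, ← piv_transpose]
    exact mem_det_piv_of_left hA.transpose h hg
  obtain ⟨a, rfl⟩ := hf
  obtain ⟨b, rfl⟩ := hg
  obtain ⟨u, huΓ, hu⟩ := (hA.mem _ _).exists_unit h
  have e : PartialField.piv A (f a) (g b) (f a) (g b) = ((-1 * u⁻¹ : Sˣ) : S) := by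
    simp [PartialField.piv, ← hu]
  cases n with
  | zero => exact a.elim0
  | succ n =>
    refine mem_det_of_schur h1 f g a b ?_ ?_ fun f' g' => ?_
    · rw [e]
      exact mem_coe (mul_mem h1 (inv_mem huΓ))
    · have : Nontrivial S := ⟨⟨_, _, h⟩⟩
      rw [e]
      exact Units.ne_zero _
    · rw [schur_piv (hA.isUnit h)]
      exact hA.restrict _ _ _ _

theorem map_piv (π : S →+* P) (h : IsUnit (A t d)) :
    (piv A t d).map π = piv (A.map π) t d := by
  have hs := fun i j => congrFun (congrFun (map_schur π h) i) j
  obtain ⟨u, hu⟩ := h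
  have : Ring.inverse (π u) = π ((u⁻¹ : Sˣ) : S) := by
    have := Ring.inverse_unit (Units.map (π : S →* P) u)
    simpa using this
  ext i j
  have := hs i j
  by_cases hi : i = t <;> by_cases hj : j = d <;> simp_all [piv, ← hu]

/-- All nonzero rows are connected through the columns in `D`. -/
def RowConnected (A : Matrix R C S) (D : Set C) : Prop :=
  ∀ r s, (∃ j, A r j ≠ 0) → (∃ j, A s j ≠ 0) → ∃ k, Chain A D k r s

theorem RowConnected.piv {D : Set C} (hA : RowConnected A D) (hd : d ∈ D) (h : IsUnit (A t d)) :
    RowConnected (piv A t d) D := by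
  rcases subsingleton_or_nontrivial S with hS | hS
  · exact fun r s ⟨j, hj⟩ => absurd (Subsingleton.elim _ _) hj
  obtain ⟨u, hu⟩ := h
  have htd : A t d ≠ 0 := by rw [← hu]; exact u.ne_zero
  have ht : ∀ j, A t j ≠ 0 → PartialField.piv A t d t j ≠ 0 := by
    intro j hj
    by_cases hjd : j = d <;> simp [PartialField.piv, hjd, ← hu, hj]
  have hd' : ∀ i, A i d ≠ 0 → PartialField.piv A t d i d ≠ 0 := by
    intro i hi
    by_cases hit : i = t <;> simp [PartialField.piv, hit, ← hu, hi]
  have hrow : ∀ i, A i d = 0 → ∀ j, PartialField.piv A t d i j = A i j := by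
    intro i hi j
    have hit : i ≠ t := by rintro rfl; exact htd hi
    by_cases hjd : j = d <;> simp [PartialField.piv, hit, hjd, hi, schur]
  have hcol : ∀ j, A t j = 0 → ∀ i, PartialField.piv A t d i j = A i j := by
    intro j hj i
    have hjd : j ≠ d := by rintro rfl; exact htd hj
    by_cases hit : i = t <;> simp [PartialField.piv, hit, hjd, hj, schur]
  have hconn : ∀ i, A i d ≠ 0 → Chain (PartialField.piv A t d) D 1 i t :=
    fun i hi => chain_one hd (hd' i hi) (hd' t htd)
  have key : ∀ r s c, c ∈ D → A r c ≠ 0 → A s c ≠ 0 → A s d = 0 →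
      ∃ k, Chain (PartialField.piv A t d) D k r s := by
    intro r s c hc hrc hsc hsd
    have hsc' : PartialField.piv A t d s c ≠ 0 := by rwa [hrow s hsd]
    by_cases htc : A t c = 0
    · exact ⟨1, chain_one hc (by rwa [hcol c htc]) hsc'⟩
    · by_cases hrd : A r d = 0
      · exact ⟨1, chain_one hc (by rwa [hrow r hrd]) hsc'⟩
      · exact ⟨_, (hconn r hrd).trans (chain_one hc (ht c htc) hsc')⟩
  have hlink : ∀ r s c, c ∈ D → A r c ≠ 0 → A s c ≠ 0 →
      ∃ k, Chain (PartialField.piv A t d) D k r s := by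
    intro r s c hc hrc hsc
    by_cases hsd : A s d = 0
    · exact key r s c hc hrc hsc hsd
    by_cases hrd : A r d = 0
    · obtain ⟨k, hk⟩ := key s r c hc hsc hrc hrd
      exact ⟨k, hk.symm⟩
    · exact ⟨_, (hconn r hrd).trans (hconn s hsd).symm⟩
  have hchain : ∀ k r s, Chain A D k r s → ∃ k, Chain (PartialField.piv A t d) D k r s := by
    intro k
    induction k with
    | zero => exact fun r s h => ⟨0, h⟩
    | succ k ih =>
      rintro r s ⟨c, hc, q, hrc, hqc, hq⟩
      obtain ⟨m, hm⟩ := hlink r q c hc hrc hqc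
      obtain ⟨m', hm'⟩ := ih q s hq
      exact ⟨_, hm.trans hm'⟩
  have hne : ∀ i, (∃ j, PartialField.piv A t d i j ≠ 0) → ∃ j, A i j ≠ 0 := by
    rintro i ⟨j, hj⟩
    by_cases hi : A i d = 0
    · exact ⟨j, by rwa [← hrow i hi]⟩
    · exact ⟨d, hi⟩
  intro r s hr hs
  obtain ⟨k, hk⟩ := hA r s (hne r hr) (hne s hs)
  exact hchain k r s hk

theorem piv_restrict_off {u : C} (hd : d ≠ u) (h : A t d ≠ 0) :
    restrict (piv A t d) (off R u) = piv (restrict A (off R u)) t d :=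
  (piv_restrict (by rwa [restrict_off _ hd])).symm

variable [Nontrivial P]

/-- If the restrictions of `A` avoiding one of two columns `u`, `v` are matrices over the partial
field and the rest of the matrix is connected, then `A` is a matrix over the partial field. -/
theorem Lifting.isMatrix_of_off (L : Lifting Γ π) {u v : C} (huv : u ≠ v)
    (hu : IsMatrix Γ (restrict A (off R u))) (hv : IsMatrix Γ (restrict A (off R v)))
    (hV : Valid (A.map π)) (hconn : RowConnected A {u, v}ᶜ) : IsMatrix Γ A := by
  intro n f g
  induction n generalizing A with
  | zero => simpa using Mem.one
  | succ n ih =>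
    have mem : ∀ i j, Mem Γ (A i j) := fun i j => by
      by_cases hj : j = v
      · subst hj
        rw [← restrict_off (A := A) i huv.symm]; exact hu.mem i j
      · rw [← restrict_off (A := A) i hj]; exact hv.mem i j
    by_cases h : ∃ a b, g b ≠ u ∧ g b ≠ v ∧ A (f a) (g b) ≠ 0
    · obtain ⟨a, b, hbu, hbv, h0⟩ := h
      have hU := (mem _ _).isUnit h0
      refine mem_det_of_schur L.neg_one_mem f g a b (mem _ _) h0 fun f' g' => ?_
      rw [schur_eq_restrict_piv hU]
      refine mem_det_restrict _ (ih ?_ ?_ ?_ ?_ f' g')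
      · rw [piv_restrict_off hbu h0]
        exact hu.piv L.neg_one_mem (by rwa [restrict_off _ hbu])
      · rw [piv_restrict_off hbv h0]
        exact hv.piv L.neg_one_mem (by rwa [restrict_off _ hbv])
      · rw [map_piv π hU]
        exact hV.piv ((mem _ _).map_ne_zero π h0)
      · exact hconn.piv (by simp [hbu, hbv]) hU
    push Not at h
    by_cases hg : ∃ b, g b ≠ u ∧ g b ≠ v
    · obtain ⟨b, hb⟩ := hg
      exact Or.inl (Matrix.det_eq_zero_of_column_eq_zero b fun i => h i b hb.1 hb.2)
    have hg' : ∀ b, g b = u ∨ g b = v := by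
      intro b
      by_contra! hb
      exact hg ⟨b, hb⟩
    by_cases hinj : Function.Injective g
    swap
    · simp only [Function.Injective, not_forall] at hinj
      obtain ⟨a, b, hab, hne⟩ := hinj
      exact Or.inl (Matrix.det_zero_of_column_eq hne fun i => by simp [hab])
    have hdet : ∀ r s, Mem Γ (A r u * A s v - A r v * A s u) := by
      intro r s
      by_cases hr : ∃ j, A r j ≠ 0
      · by_cases hs : ∃ j, A s j ≠ 0
        · obtain ⟨k, hk⟩ := hconn r s hr hs
          exact L.mem_det_of_chain huv hu hv hV hk
        · push Not at hs
          simp [hs, Mem]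
      · push Not at hr
        simp [hr, Mem]
    match n, f, g, hg', hinj with
    | 0, f, g, _, _ => simpa using mem (f 0) (g 0)
    | 1, f, g, hg', hinj =>
      rw [Matrix.det_fin_two]
      simp only [Matrix.submatrix_apply]
      have := hinj.ne (show (0 : Fin 2) ≠ 1 by decide)
      rcases hg' 0 with h0 | h0 <;> rcases hg' 1 with h1 | h1
      · exact absurd (h0.trans h1.symm) this
      · rw [h0, h1]; exact hdet _ _
      · rw [h0, h1]; exact (hdet _ _).sub_symm L.neg_one_mem
      · exact absurd (h0.trans h1.symm) this
    | n + 2, f, g, hg', hinj =>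
      exfalso
      have h01 := hinj.ne (show (⟨0, by omega⟩ : Fin (n + 3)) ≠ ⟨1, by omega⟩ by simp)
      have h02 := hinj.ne (show (⟨0, by omega⟩ : Fin (n + 3)) ≠ ⟨2, by omega⟩ by simp)
      have h12 := hinj.ne (show (⟨1, by omega⟩ : Fin (n + 3)) ≠ ⟨2, by omega⟩ by simp)
      rcases hg' ⟨0, by omega⟩ with h0 | h0 <;> rcases hg' ⟨1, by omega⟩ with h1 | h1 <;>
        rcases hg' ⟨2, by omega⟩ with h2 | h2 <;> rw [h0, h1] at h01 <;> rw [h0, h2] at h02 <;>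
        rw [h1, h2] at h12 <;> first | exact h01 rfl | exact h02 rfl | exact h12 rfl

end Pivoting

section Graph

variable {V : Type*} {r : V → V → Prop}

/-- The sets of vertices built by successively adding neighbours to a single vertex. -/
inductive Connected (r : V → V → Prop) : Set V → Prop
  | singleton (v : V) : Connected r {v}
  | extend {T : Set V} {a n : V} : Connected r T → a ∈ T → r a n → Connected r (insert n T)

/-- A finite connected graph with a vertex of degree at least three has a spanning tree with at
least three leaves. -/
theorem exists_three_leaves {W : Set V} (hW : W.Finite)
    (hcut : ∀ S ⊆ W, S.Nonempty → S ≠ W → ∃ a ∈ S, ∃ n ∈ W, n ∉ S ∧ r a n)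
    {T : Set V} {x y z : V} (hT : Connected r T) (hTW : T ⊆ W) (hx : x ∈ W) (hy : y ∈ W)
    (hz : z ∈ W) (hxT : x ∉ T) (hyT : y ∉ T) (hzT : z ∉ T) (hxy : x ≠ y) (hxz : x ≠ z)
    (hyz : y ≠ z) (hTx : ∃ a ∈ T, r a x) (hTy : ∃ a ∈ T, r a y) (hTz : ∃ a ∈ T, r a z) :
    ∃ T x y z, Connected r T ∧ x ∉ T ∧ y ∉ T ∧ z ∉ T ∧ x ≠ y ∧ x ≠ z ∧ y ≠ z ∧
      (∃ a ∈ T, r a x) ∧ (∃ a ∈ T, r a y) ∧ (∃ a ∈ T, r a z) ∧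
      W = insert x (insert y (insert z T)) := by
  induction hn : (W \ T).ncard using Nat.strong_induction_on generalizing T x y z with
  | _ k ih =>
  have key : ∀ n ∈ W, n ∉ T → (W \ insert n T).ncard < k := by
    intro n hn' hnT
    rw [← hn]
    refine Set.ncard_lt_ncard ⟨fun a ha => ⟨ha.1, fun h => ha.2 (Or.inr h)⟩, fun h => ?_⟩
      (hW.subset sdiff_subset)
    exact (h ⟨hn', hnT⟩).2 (Or.inl rfl)
  have mono : ∀ {n b : V}, (∃ a ∈ T, r a b) → ∃ a ∈ insert n T, r a b :=
    fun ⟨a, ha, hab⟩ => ⟨a, Or.inr ha, hab⟩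
  have replace : ∀ {x y z n : V}, x ∈ W → y ∈ W → z ∈ W → n ∈ W → x ∉ T → y ∉ T → z ∉ T → n ∉ T →
      x ≠ y → x ≠ z → y ≠ z → n ≠ x → n ≠ y → n ≠ z → (∃ a ∈ T, r a x) → (∃ a ∈ T, r a y) →
      (∃ a ∈ T, r a z) → r x n → _ :=
    fun {x y z n} hx hy hz hn hxT hyT hzT hnT hxy hxz hyz hnx hny hnz hTx hTy hTz hxn =>
      ih _ (key x hx hxT) (T := insert x T) (x := n) (y := y) (z := z)
        (.extend hT hTx.choose_spec.1 hTx.choose_spec.2) (insert_subset hx hTW) hn hy hz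
        (by simp [hnx, hnT]) (by simp [hyT, hxy.symm]) (by simp [hzT, hxz.symm]) hny hnz hyz
        ⟨x, Or.inl rfl, hxn⟩ (mono hTy) (mono hTz) rfl
  by_cases h : insert x (insert y (insert z T)) = W
  · exact ⟨T, x, y, z, hT, hxT, hyT, hzT, hxy, hxz, hyz, hTx, hTy, hTz, h.symm⟩
  obtain ⟨a, ha, n, hn', hnS, han⟩ := hcut _
    (insert_subset hx (insert_subset hy (insert_subset hz hTW))) ⟨x, by simp⟩ h
  simp only [mem_insert_iff, not_or] at hnS
  obtain ⟨hnx, hny, hnz, hnT⟩ := hnS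
  rcases ha with rfl | rfl | rfl | ha
  · exact replace hx hy hz hn' hxT hyT hzT hnT hxy hxz hyz hnx hny hnz hTx hTy hTz han
  · exact replace hy hx hz hn' hyT hxT hzT hnT hxy.symm hyz hxz hny hnx hnz hTy hTx hTz han
  · exact replace hz hy hx hn' hzT hyT hxT hnT hyz.symm hxz.symm hxy.symm hnz hny hnx hTz hTy hTx
      han
  · exact ih _ (key n hn' hnT) (T := insert n T) (.extend hT ha han) (insert_subset hn' hTW)
      hx hy hz (by simp [Ne.symm hnx, hxT]) (by simp [Ne.symm hny, hyT])
      (by simp [Ne.symm hnz, hzT])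
      hxy hxz hyz (mono hTx) (mono hTy) (mono hTz) rfl

end Graph

section Edges

variable {R C S : Type*} [CommRing S] {A : Matrix R C S}

/-- The adjacency relation of the bipartite graph of nonzero entries of a matrix. -/
def Edge (A : Matrix R C S) : R ⊕ C → R ⊕ C → Prop
  | .inl i, .inr j => A i j ≠ 0
  | .inr j, .inl i => A i j ≠ 0
  | _, _ => False

theorem Edge.symm {x y : R ⊕ C} (h : Edge A x y) : Edge A y x := by
  rcases x with i | j <;> rcases y with i' | j' <;> exact h

/-- The rows and columns with a nonzero entry. -/
def support (A : Matrix R C S) : Set (R ⊕ C) := {x | ∃ y, Edge A x y}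

theorem inl_mem_support {i : R} : Sum.inl i ∈ support A ↔ ∃ j, A i j ≠ 0 := by
  refine ⟨fun ⟨y, hy⟩ => ?_, fun ⟨j, hj⟩ => ⟨Sum.inr j, hj⟩⟩
  rcases y with i' | j
  · exact hy.elim
  · exact ⟨j, hy⟩

theorem inr_mem_support {j : C} : Sum.inr j ∈ support A ↔ ∃ i, A i j ≠ 0 := by
  refine ⟨fun ⟨y, hy⟩ => ?_, fun ⟨i, hi⟩ => ⟨Sum.inl i, hi⟩⟩
  rcases y with i | j
  · exact ⟨i, hy⟩
  · exact hy.elim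

theorem support_subset {B : Matrix R C S} {W : Set (R ⊕ C)}
    (h : ∀ i j, B i j ≠ 0 → Sum.inl i ∈ W ∧ Sum.inr j ∈ W) : support B ⊆ W := by
  rintro (i | j) hx
  · obtain ⟨j, hj⟩ := inl_mem_support.1 hx
    exact (h i j hj).1
  · obtain ⟨i, hi⟩ := inr_mem_support.1 hx
    exact (h i j hi).2

theorem support_restrict_ssubset {W : Set (R ⊕ C)} {x : R ⊕ C} (hx : x ∈ support A)
    (hxW : x ∉ W) : support (restrict A W) ⊂ support A := by
  refine ⟨support_subset fun i j h => ?_, fun h => ?_⟩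
  · rw [(restrict_ne_zero h).2.2] at h
    exact ⟨inl_mem_support.2 ⟨j, h⟩, inr_mem_support.2 ⟨i, h⟩⟩
  · exact hxW (support_subset (W := W) (fun i j h => ⟨(restrict_ne_zero h).1,
      (restrict_ne_zero h).2.1⟩) (h hx))

theorem support_schur_ssubset {r : R} {c : C} (h : IsUnit (A r c)) (h0 : A r c ≠ 0) :
    support (schur A r c) ⊂ support A := by
  refine ⟨support_subset fun i j hij => ?_, fun hs => ?_⟩
  · rw [inl_mem_support, inr_mem_support]
    by_cases hic : A i c = 0
    · rw [schur_of_left _ hic] at hij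
      exact ⟨⟨j, hij⟩, ⟨i, hij⟩⟩
    · refine ⟨⟨c, hic⟩, ?_⟩
      by_cases hrj : A r j = 0
      · rw [schur_of_right _ hrj] at hij
        exact ⟨i, hij⟩
      · exact ⟨r, hrj⟩
  · obtain ⟨j, hj⟩ := inl_mem_support.1 (hs (inl_mem_support.2 ⟨c, h0⟩))
    exact hj (schur_row _ h j)

theorem support_transpose : support A.transpose = Sum.swap '' support A := by
  ext (j | i)
  · simp [inl_mem_support, inr_mem_support]
  · simp [inl_mem_support, inr_mem_support]

theorem Connected.chain {T : Set (R ⊕ C)} {D : Set C} (hT : Connected (Edge A) T)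
    (hD : ∀ j, Sum.inr j ∈ T → j ∈ D) {x y : R ⊕ C} (hx : x ∈ T) (hy : y ∈ T) {r s : R}
    (hr : Sum.inl r = x ∨ Edge A (Sum.inl r) x) (hs : Sum.inl s = y ∨ Edge A (Sum.inl s) y) :
    ∃ k, Chain A D k r s := by
  have base : ∀ x : R ⊕ C, (∀ j, Sum.inr j = x → j ∈ D) → ∀ r s,
      (Sum.inl r = x ∨ Edge A (Sum.inl r) x) → (Sum.inl s = x ∨ Edge A (Sum.inl s) x) →
      ∃ k, Chain A D k r s := by
    rintro (i | j) hx r s hr hs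
    · obtain rfl : r = i := by simpa [Edge] using hr
      obtain rfl : s = r := by simpa [Edge] using hs
      exact ⟨0, rfl⟩
    · refine ⟨1, chain_one (hx j rfl) ?_ ?_⟩
      · simpa [Edge] using hr
      · simpa [Edge] using hs
  induction hT generalizing x y r s with
  | singleton v =>
    obtain rfl : x = v := hx
    obtain rfl : y = x := hy
    exact base _ (fun j hj => hD j hj) r s hr hs
  | @extend T a n hT ha han ih =>
    have hD' : ∀ j, Sum.inr j ∈ T → j ∈ D := fun j hj => hD j (Or.inr hj)
    have step : ∀ y ∈ T, ∀ r s, (Sum.inl r = n ∨ Edge A (Sum.inl r) n) →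
        (Sum.inl s = y ∨ Edge A (Sum.inl s) y) → ∃ k, Chain A D k r s := by
      intro z hz r s hr hs
      rcases n with i | j
      · obtain rfl : r = i := by simpa [Edge] using hr
        exact ih hD' ha hz (Or.inr han.symm) hs
      · rcases a with i | j'
        · obtain ⟨k, hk⟩ := ih hD' ha hz (Or.inl rfl) hs
          exact ⟨_, (chain_one (hD j (Or.inl rfl)) (by simpa [Edge] using hr) han).trans hk⟩
        · exact han.elim
    rcases hx with rfl | hx <;> rcases hy with rfl | hy
    · exact base _ (fun j hj => hD j (Or.inl hj)) r s hr hs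
    · exact step y hy r s hr hs
    · obtain ⟨k, hk⟩ := step x hx s r hs hr
      exact ⟨k, hk.symm⟩
    · exact ih hD' hx hy hr hs

theorem Connected.rowConnected {T : Set (R ⊕ C)} {u v : C} (hT : Connected (Edge A) T)
    (hu : Sum.inr u ∉ T) (hv : Sum.inr v ∉ T)
    (h : support A = insert (Sum.inr u) (insert (Sum.inr v) T)) : RowConnected A {u, v}ᶜ := by
  have key : ∀ r, (∃ j, A r j ≠ 0) → Sum.inl r ∈ T := by
    intro r hr
    have := inl_mem_support.2 hr
    rw [h] at this
    simpa using this
  refine fun r s hr hs => hT.chain (fun j hj => ?_) (key r hr) (key s hs) (Or.inl rfl) (Or.inl rfl)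
  simp only [mem_compl_iff, mem_insert_iff, mem_singleton_iff, not_or]
  exact ⟨by rintro rfl; exact hu hj, by rintro rfl; exact hv hj⟩

end Edges

section Gluing

variable {R C S P : Type*} [CommRing S] [CommRing P] {Γ : Subgroup Sˣ} {π : S →+* P}
  {B : Matrix R C S} {A : Matrix R C P} {t : R} {c : C}

theorem restrict_eq_self {W : Set (R ⊕ C)}
    (h : ∀ i j, B i j ≠ 0 → Sum.inl i ∈ W ∧ Sum.inr j ∈ W) : restrict B W = B := by
  ext i j
  by_cases hij : B i j = 0
  · rw [hij]
    by_contra h'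
    exact h' ((restrict_ne_zero h').2.2.trans hij)
  · exact restrict_pos (h i j hij).1 (h i j hij).2

theorem isMatrix_of_schur (h1 : -1 ∈ Γ) (hm : Mem Γ (B t c)) (h0 : B t c ≠ 0)
    (ht : IsMatrix Γ (restrict B {x | x ≠ Sum.inl t}))
    (hc : IsMatrix Γ (restrict B {x | x ≠ Sum.inr c})) (hs : IsMatrix Γ (schur B t c)) :
    IsMatrix Γ B := by
  intro n f g
  by_cases hf : ∃ a, f a = t
  swap
  · push Not at hf
    convert ht n f g using 2
    ext i j
    exact (restrict_pos (W := {x | x ≠ Sum.inl t}) (by simpa using hf i) (by simp)).symm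
  by_cases hg : ∃ b, g b = c
  swap
  · push Not at hg
    convert hc n f g using 2
    ext i j
    exact (restrict_pos (W := {x | x ≠ Sum.inr c}) (by simp) (by simpa using hg j)).symm
  obtain ⟨a, rfl⟩ := hf
  obtain ⟨b, rfl⟩ := hg
  cases n with
  | zero => exact a.elim0
  | succ n => exact mem_det_of_schur h1 f g a b hm h0 fun f' g' => hs n f' g'

theorem isMatrix_of_row (h1 : -1 ∈ Γ) (hm : Mem Γ (B t c)) (h0 : ∀ j, j ≠ c → B t j = 0)
    (ht : IsMatrix Γ (restrict B {x | x ≠ Sum.inl t})) : IsMatrix Γ B := by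
  by_cases htc : B t c = 0
  · convert ht
    refine (restrict_eq_self fun i j hij => ?_).symm
    simp only [mem_ofPred_eq, ne_eq, Sum.inl.injEq, reduceCtorEq, not_false_eq_true, and_true]
    rintro rfl
    by_cases hj : j = c
    · exact hij (hj ▸ htc)
    · exact hij (h0 j hj)
  have hU := hm.isUnit htc
  have hsub := ht.restrict {x | x ≠ Sum.inr c}
  rw [restrict_restrict] at hsub
  refine isMatrix_of_schur h1 hm htc ht ?_ ?_
  · convert hsub using 1
    ext i j
    by_cases hj : j = c
    · rw [restrict_right (by simpa using hj), restrict_right (by simp [hj])]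
    by_cases hi : i = t
    · rw [restrict_pos (by simp) (by simpa using hj), restrict_left (by simp [hi]), hi, h0 j hj]
    · rw [restrict_pos (by simp) (by simpa using hj), restrict_pos (by simpa using hi)
        (by simpa using hj)]
  · convert hsub using 1
    ext i j
    by_cases hj : j = c
    · rw [hj, schur_col _ hU, restrict_right (by simp)]
    by_cases hi : i = t
    · rw [hi, schur_row _ hU, restrict_left (by simp)]
    · rw [schur_of_right _ (h0 j hj), restrict_pos (by simpa using hi) (by simpa using hj)]

theorem restrict_transpose (W : Set (R ⊕ C)) :
    restrict B.transpose (Sum.swap '' W) = (restrict B W).transpose := by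
  have h1 : ∀ j : C, Sum.inl j ∈ Sum.swap '' W ↔ Sum.inr j ∈ W := by simp
  have h2 : ∀ i : R, Sum.inr i ∈ Sum.swap '' W ↔ Sum.inl i ∈ W := by simp
  ext j i
  simp only [restrict, Matrix.transpose_apply]
  congr 1
  rw [h1, h2, and_comm]

theorem isMatrix_of_col (h1 : -1 ∈ Γ) (hm : Mem Γ (B t c)) (h0 : ∀ i, i ≠ t → B i c = 0)
    (hc : IsMatrix Γ (restrict B {x | x ≠ Sum.inr c})) : IsMatrix Γ B := by
  refine (isMatrix_of_row (B := B.transpose) (t := c) (c := t) h1 hm h0 ?_).transpose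
  convert hc.transpose using 1
  rw [← restrict_transpose]
  congr 1
  ext (j | i) <;> simp

theorem isMatrix_of_separation (h1 : -1 ∈ Γ) {W : Set (R ⊕ C)}
    (hW : ∀ i j, B i j ≠ 0 → (Sum.inl i ∈ W ↔ Sum.inr j ∈ W))
    (h : IsMatrix Γ (restrict B W)) (h' : IsMatrix Γ (restrict B Wᶜ)) : IsMatrix Γ B := by
  intro n f g
  induction n generalizing B W with
  | zero => simpa using Mem.one
  | succ n ih =>
    by_cases h0 : ∃ a b, B (f a) (g b) ≠ 0
    swap
    · push Not at h0
      exact Or.inl (Matrix.det_eq_zero_of_row_eq_zero 0 fun j => h0 0 j)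
    obtain ⟨a, b, h0⟩ := h0
    have main : ∀ {W : Set (R ⊕ C)}, (∀ i j, B i j ≠ 0 → (Sum.inl i ∈ W ↔ Sum.inr j ∈ W)) →
        IsMatrix Γ (restrict B W) → IsMatrix Γ (restrict B Wᶜ) → Sum.inl (f a) ∈ W →
        Mem Γ (B.submatrix f g).det := by
      intro W hW h h' ha
      have hb := (hW _ _ h0).1 ha
      have e := restrict_pos (A := B) ha hb
      have hm := h.mem (f a) (g b)
      have hs := h.schur (r := f a) (c := g b) (by rwa [e])
      rw [restrict_schur (by rwa [e])] at hs
      rw [e] at hm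
      have hcol : ∀ i, Sum.inl i ∉ W → B i (g b) = 0 := fun i hi => by
        by_contra h; exact hi ((hW _ _ h).2 hb)
      have hrow : ∀ j, Sum.inr j ∉ W → B (f a) j = 0 := fun j hj => by
        by_contra h; exact hj ((hW _ _ h).1 ha)
      refine mem_det_of_schur h1 f g a b hm h0 (ih (fun i j hij => ?_) hs ?_)
      · by_cases hi : Sum.inl i ∈ W <;> by_cases hj : Sum.inr j ∈ W
        · simp [hi, hj]
        · rw [schur_of_right _ (hrow j hj)] at hij
          exact hW _ _ hij
        · rw [schur_of_left _ (hcol i hi)] at hij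
          exact hW _ _ hij
        · simp [hi, hj]
      · convert h' using 1
        ext i j
        by_cases hi : Sum.inl i ∈ Wᶜ
        · by_cases hj : Sum.inr j ∈ Wᶜ
          · rw [restrict_pos hi hj, restrict_pos hi hj, schur_of_left _ (hcol i hi)]
          · rw [restrict_right hj, restrict_right hj]
        · rw [restrict_left hi, restrict_left hi]
    by_cases ha : Sum.inl (f a) ∈ W
    · exact main hW h h' ha
    · exact main (fun i j hij => not_congr (hW i j hij)) h' (by rwa [compl_compl]) ha

variable (Γ π) in
/-- `A` is the image of a matrix over the partial field `(S, Γ)`. -/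
def Liftable (A : Matrix R C P) : Prop := ∃ B : Matrix R C S, IsMatrix Γ B ∧ B.map π = A

theorem Liftable.transpose (h : Liftable Γ π A) : Liftable Γ π A.transpose := by
  obtain ⟨B, hB, rfl⟩ := h
  exact ⟨B.transpose, hB.transpose, rfl⟩

theorem Lifting.exists_lift (L : Lifting Γ π) {p : P} (h : p ≠ 0 → IsUnit p) :
    ∃ x, Mem Γ x ∧ π x = p := by
  by_cases h0 : p = 0
  · exact ⟨0, Mem.zero, by simp [h0]⟩
  · obtain ⟨g, hg, rfl⟩ := L.surj p (h h0)
    exact ⟨g, mem_coe hg, rfl⟩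

theorem Lifting.liftable_of_row (L : Lifting Γ π) (hm : A t c ≠ 0 → IsUnit (A t c))
    (h0 : ∀ j, j ≠ c → A t j = 0) (ht : Liftable Γ π (restrict A {x | x ≠ Sum.inl t})) :
    Liftable Γ π A := by
  classical
  obtain ⟨B, hB, hBA⟩ := ht
  obtain ⟨x, hx, hxA⟩ := L.exists_lift hm
  have hBt : ∀ i j, i ≠ t → π (B i j) = A i j := fun i j hi =>
    (congrFun (congrFun hBA i) j).trans (restrict_pos (by simpa using hi) (by simp))
  obtain ⟨D, hD⟩ : ∃ D : Matrix R C S, ∀ i j, D i j =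
      if i = t then if j = c then x else 0 else B i j := ⟨_, fun _ _ => rfl⟩
  refine ⟨D, isMatrix_of_row L.neg_one_mem (t := t) (c := c) (by simpa [hD] using hx)
    (fun j hj => by simp [hD, hj]) ?_, ?_⟩
  · convert hB.restrict {x | x ≠ Sum.inl t} using 1
    ext i j
    by_cases hi : i = t
    · rw [restrict_left (by simp [hi]), restrict_left (by simp [hi])]
    · rw [restrict_pos (by simp [hi]) (by simp), restrict_pos (by simp [hi]) (by simp), hD,
        if_neg hi]
  · ext i j
    by_cases hi : i = t
    · by_cases hj : j = c
      · simp [hD, hi, hj, hxA]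
      · simp [hD, hi, hj, h0]
    · simp [hD, hi, hBt]

theorem Lifting.liftable_of_col (L : Lifting Γ π) (hm : A t c ≠ 0 → IsUnit (A t c))
    (h0 : ∀ i, i ≠ t → A i c = 0) (hc : Liftable Γ π (restrict A {x | x ≠ Sum.inr c})) :
    Liftable Γ π A := by
  refine (L.liftable_of_row (A := A.transpose) (t := c) (c := t) hm h0 ?_).transpose
  convert hc.transpose using 1
  rw [← restrict_transpose]
  congr 1
  ext (j | i) <;> simp

theorem Lifting.liftable_of_separation (L : Lifting Γ π) {W : Set (R ⊕ C)}
    (hW : ∀ i j, A i j ≠ 0 → (Sum.inl i ∈ W ↔ Sum.inr j ∈ W))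
    (h : Liftable Γ π (restrict A W)) (h' : Liftable Γ π (restrict A Wᶜ)) : Liftable Γ π A := by
  classical
  obtain ⟨B, hB, hBA⟩ := h
  obtain ⟨B', hB', hBA'⟩ := h'
  obtain ⟨D, hD⟩ : ∃ D : Matrix R C S, ∀ i j, D i j = if Sum.inl i ∈ W then
      if Sum.inr j ∈ W then B i j else 0 else if Sum.inr j ∈ W then 0 else B' i j :=
    ⟨_, fun _ _ => rfl⟩
  refine ⟨D, isMatrix_of_separation L.neg_one_mem (W := W) (fun i j hij => ?_) ?_ ?_, ?_⟩
  · by_cases hi : Sum.inl i ∈ W <;> by_cases hj : Sum.inr j ∈ W <;> simp_all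
  · convert hB.restrict W using 1
    ext i j
    by_cases hi : Sum.inl i ∈ W <;> by_cases hj : Sum.inr j ∈ W <;> simp [restrict, hi, hj, hD]
  · convert hB'.restrict Wᶜ using 1
    ext i j
    by_cases hi : Sum.inl i ∈ W <;> by_cases hj : Sum.inr j ∈ W <;> simp [restrict, hi, hj, hD]
  · ext i j
    have e := congrFun (congrFun hBA i) j
    have e' := congrFun (congrFun hBA' i) j
    by_cases hi : Sum.inl i ∈ W <;> by_cases hj : Sum.inr j ∈ W
    · simpa [hD, hi, hj, restrict] using e
    · simpa [hD, hi, hj] using (not_not.1 (mt (hW i j) (by simp [hi, hj]))).symm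
    · simpa [hD, hi, hj] using (not_not.1 (mt (hW i j) (by simp [hi, hj]))).symm
    · simpa [hD, hi, hj, restrict] using e'

theorem RowConnected.of_iff {D : Set C} (h : RowConnected A D)
    (hBA : ∀ i j, B i j = 0 ↔ A i j = 0) :
    RowConnected B D := by
  have key : ∀ k r s, Chain A D k r s → Chain B D k r s := by
    intro k
    induction k with
    | zero => exact fun _ _ h => h
    | succ k ih =>
      rintro r s ⟨c, hc, t, hrc, htc, h⟩
      exact ⟨c, hc, t, mt (hBA _ _).1 hrc, mt (hBA _ _).1 htc, ih _ _ h⟩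
  rintro r s ⟨i, hi⟩ ⟨j, hj⟩
  obtain ⟨k, hk⟩ := h r s ⟨i, mt (hBA _ _).2 hi⟩ ⟨j, mt (hBA _ _).2 hj⟩
  exact ⟨k, key k r s hk⟩

variable [Nontrivial P]

theorem Lifting.liftable_of_off (L : Lifting Γ π) {u v : C} (huv : u ≠ v)
    (hu : Liftable Γ π (restrict A (off R u))) (hv : Liftable Γ π (restrict A (off R v)))
    (hV : Valid A) (hconn : RowConnected A {u, v}ᶜ) (hA : {j | ∃ i, A i j ≠ 0}.Finite) :
    Liftable Γ π A := by
  classical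
  obtain ⟨B₁, h₁, e₁⟩ := hu
  obtain ⟨B₂, h₂, e₂⟩ := hv
  have e₁' : ∀ i j, j ≠ u → π (B₁ i j) = A i j := fun i j hj => by
    rw [← restrict_off (A := A) i hj, ← e₁]; rfl
  have e₂' : ∀ i j, j ≠ v → π (B₂ i j) = A i j := fun i j hj => by
    rw [← restrict_off (A := A) i hj, ← e₂]; rfl
  obtain ⟨l, m, hl, hm, hlm⟩ := L.exists_eq_scale (h₁.restrict (off R v)) (h₂.restrict (off R u))
    (by rw [map_restrict, map_restrict, e₁, e₂, restrict_restrict, restrict_restrict,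
      inter_comm]) hA (by
      intro i j hj
      by_contra h
      have h' := (restrict_ne_zero h).2.2
      rw [h'] at h
      refine hj ⟨i, ?_⟩
      rw [← Ne, Ne, ← h₁.map_eq_zero_iff π] at h
      have : π (B₁ i j) = restrict A (off R u) i j := by rw [← e₁]; rfl
      rw [this] at h
      rwa [← (restrict_ne_zero h).2.2])
  have hlm' : ∀ i j, j ≠ u → j ≠ v → B₁ i j = l i * B₂ i j * m j := by
    intro i j hju hjv
    have := congrFun (congrFun hlm i) j
    rw [restrict_off _ hjv] at this
    rw [this]
    simp only [scale, restrict_off _ hju]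
    ring
  have hlink : ∀ i j, j ≠ u → j ≠ v → A i j ≠ 0 → π (l i) * π (m j) = 1 := by
    intro i j hju hjv hij
    have h := congrArg π (hlm' i j hju hjv)
    rw [map_mul, map_mul, e₁' i j hju, e₂' i j hjv] at h
    obtain ⟨a, ha⟩ := hV.isUnit hij
    rw [← ha] at h
    rw [← a.mul_right_inj]
    linear_combination -h
  have hchain : ∀ k r s, Chain A {u, v}ᶜ k r s → π (l r) = π (l s) := by
    intro k
    induction k with
    | zero => rintro r s rfl; rfl
    | succ k ih =>
      rintro r s ⟨c, hc, t, hrc, htc, h⟩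
      simp only [mem_compl_iff, mem_insert_iff, mem_singleton_iff, not_or] at hc
      rw [← ih t s h]
      linear_combination (π (l r)) * hlink t c hc.1 hc.2 htc * (-1)
        + (π (l t)) * hlink r c hc.1 hc.2 hrc
  obtain ⟨q, hq, hqA⟩ : ∃ q ∈ Γ, ∀ i, A i u ≠ 0 → π (l i) * π (q : Sˣ) = 1 := by
    by_cases h : ∃ i, A i u ≠ 0
    · obtain ⟨i, hi⟩ := h
      refine ⟨(l i)⁻¹, inv_mem (hl i), fun i' hi' => ?_⟩
      obtain ⟨k, hk⟩ := hconn i' i ⟨u, hi'⟩ ⟨u, hi⟩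
      rw [hchain k _ _ hk, ← map_mul]
      simp
    · push Not at h
      exact ⟨1, one_mem _, fun i hi => absurd (h i) hi⟩
  obtain ⟨D, hD⟩ : ∃ D : Matrix R C S, ∀ i j, D i j =
      if j = u then l i * B₂ i j * q else B₁ i j := ⟨_, fun _ _ => rfl⟩
  have hDu : restrict D (off R u) = restrict B₁ (off R u) := by
    ext i j
    by_cases hj : j = u
    · rw [restrict_right (by simp [off, hj]), restrict_right (by simp [off, hj])]
    · rw [restrict_off _ hj, restrict_off _ hj]
      simp [hD, hj]
  have hDv : restrict D (off R v) =
      restrict (scale l (fun j => if j = u then q else m j) B₂) (off R v) := by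
    ext i j
    by_cases hj : j = v
    · rw [restrict_right (by simp [off, hj]), restrict_right (by simp [off, hj])]
    · rw [restrict_off _ hj, restrict_off _ hj]
      by_cases hju : j = u
      · simp only [hD, hju, scale, if_true]
        ring
      · simp only [hD, hju, scale, hlm' i j hju hj, if_false]
        ring
  have hDA : D.map π = A := by
    ext i j
    by_cases hj : j = u
    · subst hj
      simp only [hD, Matrix.map_apply, if_true, map_mul, e₂' i j huv]
      by_cases h : A i j = 0
      · simp [h]
      · linear_combination A i j * hqA i h
    · simp [hD, hj, e₁']
  have hDu' := h₁.restrict (off R u)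
  have hDv' : IsMatrix Γ (restrict D (off R v)) := by
    rw [hDv]
    refine IsMatrix.restrict (h₂.scale hl fun j => ?_) _
    by_cases hj : j = u <;> simp [hj, hq, hm]
  rw [← hDu] at hDu'
  refine ⟨D, L.isMatrix_of_off huv hDu' hDv' (by rwa [hDA]) (hconn.of_iff fun i j => ?_), hDA⟩
  rw [← hDA]
  by_cases hj : j = v
  · have := hDu'.map_eq_zero_iff π i j
    rw [restrict_off _ (by rw [hj]; exact huv.symm)] at this
    exact this.symm
  · have := hDv'.map_eq_zero_iff π i j
    rw [restrict_off _ hj] at this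
    exact this.symm

end Gluing

section FiniteLift

variable {R C S P : Type*} [CommRing S] [CommRing P] {Γ : Subgroup Sˣ} {π : S →+* P}
  {B : Matrix R C S} {A : Matrix R C P} {t r : R} {c d q : C}

theorem Lifting.exists_sub_mul [Nontrivial P] (L : Lifting Γ π) {k : Sˣ} (hk : k ∈ Γ) {w : S}
    (hw : Mem Γ w) {p s : P} (hp : IsUnit p) (hs : s ≠ 0 → IsUnit s) (h : π w = s - p * π k) :
    ∃ x y, Mem Γ x ∧ Mem Γ y ∧ π x = p ∧ π y = s ∧ y - x * k = w := by
  have hπ : ∀ u : Sˣ, π u * π ((u⁻¹ : Sˣ) : S) = 1 := fun u => by rw [← map_mul]; simp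
  by_cases h0 : s = 0
  · refine ⟨-(w * ((k⁻¹ : Sˣ) : S)), 0, (hw.mul (mem_coe (inv_mem hk))).neg L.neg_one_mem,
      Mem.zero, ?_, by simp [h0], by simp⟩
    rw [map_neg, map_mul, h, h0]
    linear_combination p * hπ k
  obtain ⟨s, rfl⟩ := hs h0
  obtain ⟨p, rfl⟩ := hp
  set κ : Pˣ := Units.map (π : S →* P) k
  have hz : ZeroOrUnit (1 - ((s * (p * κ)⁻¹ : Pˣ) : P)) := by
    have : 1 - ((s * (p * κ)⁻¹ : Pˣ) : P) = -((((p * κ)⁻¹ : Pˣ)) : P) * π w := by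
      rw [h, mul_sub]
      have : (((p * κ)⁻¹ : Pˣ) : P) * (p * π k) = 1 := (p * κ).inv_mul
      rw [Units.val_mul]
      linear_combination -this
    rw [this]
    rcases hw with rfl | ⟨u, -, rfl⟩
    · left; simp
    · right
      exact (Units.isUnit _).neg.mul (u.isUnit.map π)
  obtain ⟨g, hg, hgs, hg1⟩ := L.exists_fundamental _ (Units.isUnit _) hz
  have hgs' : (p : P) * π k * π g = s := by
    rw [hgs, Units.val_mul]
    have : (p * π k) * (((p * κ)⁻¹ : Pˣ) : P) = 1 := (p * κ).mul_inv
    linear_combination (s : P) * this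
  rcases hg1 with hg1 | ⟨u, hu, hug⟩
  · obtain ⟨x, hx, hxp⟩ := L.surj p p.isUnit
    have hg1' : π g = 1 := by rw [← sub_eq_zero, ← neg_eq_zero, neg_sub, ← map_one π, ← map_sub,
      hg1, map_zero]
    refine ⟨x, x * k, mem_coe hx, (mem_coe hx).mul (mem_coe hk), hxp, ?_, ?_⟩
    · rw [map_mul, hxp, ← hgs', hg1', mul_one]
    · rw [sub_self, eq_comm, ← hw.map_eq_zero_iff π, h, ← hgs', hg1']
      ring
  · have hu' : π u = 1 - π g := by rw [hug]; simp
    have hx : π (-(w * ((k⁻¹ * u⁻¹ : Sˣ) : S))) = p := by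
      rw [map_neg, map_mul, h, Units.val_mul, map_mul, ← hgs']
      linear_combination p * hπ u + p * π u * π ((u⁻¹ : Sˣ) : S) * hπ k -
        p * π k * π ((k⁻¹ : Sˣ) : S) * π ((u⁻¹ : Sˣ) : S) * hu'
    refine ⟨-(w * ((k⁻¹ * u⁻¹ : Sˣ) : S)), -(w * ((k⁻¹ * u⁻¹ : Sˣ) : S)) * k * g,
      (hw.mul (mem_coe (mul_mem (inv_mem hk) (inv_mem hu)))).neg L.neg_one_mem,
      (((hw.mul (mem_coe (mul_mem (inv_mem hk) (inv_mem hu)))).neg L.neg_one_mem).mul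
        (mem_coe hk)).mul (mem_coe hg), hx, ?_, ?_⟩
    · rw [map_mul, map_mul, hx, hgs']
    · rw [Units.val_mul]
      linear_combination w * u.mul_inv + w * u * ((u⁻¹ : Sˣ) : S) * k.mul_inv -
        w * k * ((k⁻¹ : Sˣ) : S) * ((u⁻¹ : Sˣ) : S) * hug

theorem isMatrix_of_path (h1 : -1 ∈ Γ) (htr : t ≠ r) (htc : Mem Γ (B t c)) (h0 : B t c ≠ 0)
    (htd : Mem Γ (B t d)) (hrc : Mem Γ (B r c)) (hrq : Mem Γ (B r q))
    (ht : ∀ j, j ≠ c → j ≠ d → B t j = 0) (hr : ∀ j, j ≠ c → j ≠ q → B r j = 0)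
    (hc : ∀ i, i ≠ t → i ≠ r → B i c = 0) (hs : IsMatrix Γ (schur B t c)) : IsMatrix Γ B := by
  have mem_restrict : ∀ (W : Set (R ⊕ C)) {i j}, Mem Γ (B i j) → Mem Γ (restrict B W i j) := by
    intro W i j h
    by_cases h' : restrict B W i j = 0
    · exact Or.inl h'
    · rwa [(restrict_ne_zero h').2.2]
  have restrict_zero : ∀ (W : Set (R ⊕ C)) {i j}, (Sum.inl i ∈ W → Sum.inr j ∈ W → B i j = 0) →
      restrict B W i j = 0 := by
    intro W i j h
    by_contra h'
    obtain ⟨hi, hj, h''⟩ := restrict_ne_zero h'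
    exact h' (h''.trans (h hi hj))
  have main : IsMatrix Γ (restrict B ({x | x ≠ Sum.inl t} ∩ {x | x ≠ Sum.inr c})) := by
    refine isMatrix_of_row h1 (t := r) (c := q) (mem_restrict _ hrq)
      (fun j hj => restrict_zero _ fun _ hj' => hr j (by rintro rfl; exact hj'.2 rfl) hj) ?_
    rw [restrict_restrict]
    convert hs.restrict (({x | x ≠ Sum.inl t} ∩ {x | x ≠ Sum.inr c}) ∩ {x | x ≠ Sum.inl r})
      using 1
    ext i j
    by_cases hi : Sum.inl i ∈ (({x | x ≠ Sum.inl t} ∩ {x | x ≠ Sum.inr c}) ∩ {x | x ≠ Sum.inl r} :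
      Set (R ⊕ C))
    · have := hc i (by rintro rfl; exact hi.1.1 rfl) (by rintro rfl; exact hi.2 rfl)
      simp only [restrict, schur_of_left B this]
    · rw [restrict_left hi, restrict_left hi]
  refine isMatrix_of_schur h1 htc h0 ?_ ?_ hs
  · refine isMatrix_of_col h1 (t := r) (c := c) (mem_restrict _ hrc)
      (fun i hi => restrict_zero _ fun hi' _ => hc i (by rintro rfl; exact hi' rfl) hi) ?_
    rwa [restrict_restrict]
  · refine isMatrix_of_row h1 (t := t) (c := d) (mem_restrict _ htd)
      (fun j hj => restrict_zero _ fun _ hj' => ht j (by rintro rfl; exact hj' rfl) hj) ?_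
    rwa [restrict_restrict, inter_comm]

variable [Nontrivial P]

theorem Lifting.liftable_of_path (L : Lifting Γ π) (hA : Valid A) (htr : t ≠ r) (hcd : c ≠ d)
    (htc : A t c ≠ 0) (htd : A t d ≠ 0) (hrc : A r c ≠ 0)
    (ht : ∀ j, j ≠ c → j ≠ d → A t j = 0) (hr : ∀ j, j ≠ c → j ≠ q → A r j = 0)
    (hc : ∀ i, i ≠ t → i ≠ r → A i c = 0) (hs : Liftable Γ π (schur A t c)) : Liftable Γ π A := by
  classical
  obtain ⟨B, hB, hBA⟩ := hs
  have hBA' : ∀ i j, π (B i j) = schur A t c i j := fun i j => congrFun (congrFun hBA i) j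
  have hBr : ∀ j, j ≠ c → j ≠ d → π (B r j) = A r j := fun j hjc hjd => by
    rw [hBA', schur_of_right _ (ht j hjc hjd)]
  have hBi : ∀ i j, i ≠ t → i ≠ r → π (B i j) = A i j := fun i j hit hir => by
    rw [hBA', schur_of_left _ (hc i hit hir)]
  have hBt : ∀ j, B t j = 0 := fun j => by
    rw [← hB.map_eq_zero_iff π, hBA', schur_row _ (hA.isUnit htc)]
  have hBc : ∀ i, B i c = 0 := fun i => by
    rw [← hB.map_eq_zero_iff π, hBA', schur_col _ (hA.isUnit htc)]
  obtain ⟨a, ha, haA⟩ := L.surj _ (hA.isUnit htc)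
  obtain ⟨b, hb, hbA⟩ := L.surj _ (hA.isUnit htd)
  obtain ⟨x, y, hx, hy, hxA, hyA, hxy⟩ := L.exists_sub_mul (mul_mem (inv_mem ha) hb)
    (hB.mem r d) (hA.isUnit hrc) (fun h => hA.isUnit h) (s := A r d) (by
      have : Ring.inverse (π a) = π ((a⁻¹ : Sˣ) : S) :=
        Ring.inverse_unit (Units.map (π : S →* P) a)
      rw [hBA', schur, ← haA, ← hbA, this, Units.val_mul, map_mul, mul_assoc])
  obtain ⟨D, hD⟩ : ∃ D : Matrix R C S, ∀ i j, D i j =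
      if i = t then if j = c then (a : S) else if j = d then b else 0
      else if i = r then if j = c then x else if j = d then y else B i j
      else B i j := ⟨_, fun _ _ => rfl⟩
  have hDt : ∀ j, D t j = if j = c then (a : S) else if j = d then b else 0 := by simp [hD]
  have hDr : ∀ j, D r j = if j = c then x else if j = d then y else B r j := by
    simp [hD, htr.symm]
  have hDi : ∀ i j, i ≠ t → i ≠ r → D i j = B i j := by
    intro i j hit hir
    simp [hD, hit, hir]
  have hDtc : D t c = a := by simp [hDt]
  have hDA : D.map π = A := by
    ext i j
    rw [Matrix.map_apply]
    by_cases hit : i = t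
    · rw [hit, hDt]
      by_cases hjc : j = c
      · simp [hjc, haA]
      · by_cases hjd : j = d
        · simp [hjd, hcd.symm, hbA]
        · simp [hjc, hjd, ht]
    · by_cases hir : i = r
      · rw [hir, hDr]
        by_cases hjc : j = c
        · simp [hjc, hxA]
        · by_cases hjd : j = d
          · simp [hjd, hcd.symm, hyA]
          · simp [hjc, hjd, hBr]
      · rw [hDi i j hit hir, hBi i j hit hir]
  have hDmem : ∀ i j, Mem Γ (D i j) := by
    intro i j
    rw [hD]
    split_ifs
    exacts [mem_coe ha, mem_coe hb, Mem.zero, hx, hy, hB.mem i j, hB.mem i j]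
  have hD0 : ∀ i j, A i j = 0 → D i j = 0 := by
    intro i j h
    rwa [← (hDmem i j).map_eq_zero_iff π, ← Matrix.map_apply (f := π), hDA]
  have hU : IsUnit (D t c) := by rw [hDtc]; exact a.isUnit
  have h0 : D t c ≠ 0 := by
    intro h
    rw [← hDA, Matrix.map_apply, h, map_zero] at htc
    exact htc rfl
  refine ⟨D, isMatrix_of_path L.neg_one_mem htr (hDmem t c) h0 (hDmem t d) (hDmem r c)
    (hDmem r q) (fun j hc hd => hD0 _ _ (ht j hc hd)) (fun j hc hq => hD0 _ _ (hr j hc hq))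
    (fun i h h' => hD0 _ _ (hc i h h')) ?_, hDA⟩
  convert hB
  ext i j
  by_cases hit : i = t
  · rw [hit, schur_row _ hU, hBt]
  by_cases hjc : j = c
  · rw [hjc, schur_col _ hU, hBc]
  by_cases hir : i = r
  · by_cases hjd : j = d
    · rw [schur, hDtc, Ring.inverse_unit, hir, hjd, ← hxy, hDr, hDr, hDt, if_pos rfl,
        if_neg hcd.symm, if_pos rfl, if_neg hcd.symm, if_pos rfl, Units.val_mul]
      ring
    · rw [schur_of_right _ (hD0 _ _ (ht j hjc hjd)), hir, hDr, if_neg hjc, if_neg hjd]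
  · rw [schur_of_left _ (hD0 _ _ (hc i hit hir)), hDi i j hit hir]

theorem Connected.map {V V' : Type*} {r : V → V → Prop} {r' : V' → V' → Prop} {f : V → V'}
    (hf : ∀ a b, r a b → r' (f a) (f b)) {T : Set V} (h : Connected r T) :
    Connected r' (f '' T) := by
  induction h with
  | singleton v => rw [image_singleton]; exact .singleton _
  | extend hT ha han ih =>
    rw [image_insert_eq]
    exact .extend ih (mem_image_of_mem f ha) (hf _ _ han)

theorem Lifting.liftable_of_leaves (L : Lifting Γ π) (hV : Valid A) (hA : (support A).Finite)
    {T : Set (R ⊕ C)} {x y : R ⊕ C} (hT : Connected (Edge A) T) (hx : x ∉ T) (hy : y ∉ T)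
    (hxy : x ≠ y) (hW : support A = insert x (insert y T)) (h : x.isLeft = y.isLeft)
    (hlx : Liftable Γ π (restrict A {z | z ≠ x})) (hly : Liftable Γ π (restrict A {z | z ≠ y})) :
    Liftable Γ π A := by
  rcases x with u | u <;> rcases y with v | v
  · have hT' : Connected (Edge A.transpose) (Sum.swap '' T) := by
      refine hT.map fun a b hab => ?_
      rcases a with a | a <;> rcases b with b | b <;> exact hab
    have hW' : support A.transpose =
        insert (Sum.inr u) (insert (Sum.inr v) (Sum.swap '' T)) := by
      rw [support_transpose, hW, image_insert_eq, image_insert_eq]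
      rfl
    have key : ∀ u, Liftable Γ π (restrict A {z | z ≠ Sum.inl u}) →
        Liftable Γ π (restrict A.transpose (off C u)) := by
      intro u h
      convert h.transpose using 1
      rw [← restrict_transpose]
      congr 1
      ext (j | i) <;> simp [off]
    refine (L.liftable_of_off (A := A.transpose) (u := u) (v := v)
      (fun h => hxy (congrArg Sum.inl h)) (key u hlx) (key v hly) hV.transpose
      (hT'.rowConnected (by simpa using hx) (by simpa using hy) hW') ?_).transpose
    refine (hA.preimage Sum.inl_injective.injOn).subset ?_
    rintro i ⟨j, hij⟩
    exact inl_mem_support.2 ⟨j, hij⟩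
  · simp at h
  · simp at h
  · refine L.liftable_of_off (fun h => hxy (congrArg Sum.inr h)) hlx hly hV
      (hT.rowConnected hx hy hW) ?_
    refine (hA.preimage Sum.inr_injective.injOn).subset ?_
    rintro j ⟨i, hij⟩
    exact inr_mem_support.2 ⟨i, hij⟩

theorem Lifting.liftable_of_finite (L : Lifting Γ π) (hV : Valid A) (hA : (support A).Finite) :
    Liftable Γ π A := by
  induction hn : (support A).ncard using Nat.strong_induction_on generalizing A with
  | _ n ih =>
  have ih' : ∀ {B : Matrix R C P}, support B ⊂ support A → Valid B → Liftable Γ π B :=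
    fun h hB => ih _ (hn ▸ Set.ncard_lt_ncard h hA) hB (hA.subset h.subset) rfl
  have off : ∀ {x}, x ∈ support A → Liftable Γ π (restrict A {z | z ≠ x}) :=
    fun hx => ih' (support_restrict_ssubset hx (by simp)) (hV.restrict _)
  by_cases hrow : ∃ t c, A t c ≠ 0 ∧ ∀ j, j ≠ c → A t j = 0
  · obtain ⟨t, c, h, hj⟩ := hrow
    exact L.liftable_of_row hV.isUnit hj (off (inl_mem_support.2 ⟨c, h⟩))
  by_cases hcol : ∃ t c, A t c ≠ 0 ∧ ∀ i, i ≠ t → A i c = 0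
  · obtain ⟨t, c, h, hi⟩ := hcol
    exact L.liftable_of_col hV.isUnit hi (off (inr_mem_support.2 ⟨t, h⟩))
  by_cases hsep : ∀ W ⊆ support A, W.Nonempty → W ≠ support A →
      ∃ a ∈ W, ∃ b ∈ support A, b ∉ W ∧ Edge A a b
  swap
  · push Not at hsep
    obtain ⟨W, hWA, ⟨x, hx⟩, hne, hW⟩ := hsep
    obtain ⟨y, hy, hyW⟩ := exists_of_ssubset (hWA.ssubset_of_ne hne)
    refine L.liftable_of_separation (W := W) (fun i j hij => ⟨fun hi => ?_, fun hj => ?_⟩)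
      (ih' (support_restrict_ssubset hy hyW) (hV.restrict _))
      (ih' (support_restrict_ssubset (hWA hx) (by simpa using hx)) (hV.restrict _))
    · by_contra h
      exact hW _ hi _ (inr_mem_support.2 ⟨i, hij⟩) h hij
    · by_contra h
      exact hW _ hj _ (inl_mem_support.2 ⟨j, hij⟩) h hij
  by_cases hdeg : ∃ w x y z, Edge A w x ∧ Edge A w y ∧ Edge A w z ∧ x ≠ y ∧ x ≠ z ∧ y ≠ z
  · obtain ⟨w, x, y, z, hwx, hwy, hwz, hxy, hxz, hyz⟩ := hdeg
    have hne : ∀ {x}, Edge A w x → x ∉ ({w} : Set (R ⊕ C)) := by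
      intro x h hxw
      rw [mem_singleton_iff.1 hxw] at h
      rcases w with i | j <;> exact h
    obtain ⟨T, x, y, z, hT, hxT, hyT, hzT, hxy, hxz, hyz, ⟨a, ha, hax⟩, ⟨b, hb, hby⟩,
      ⟨e, he, hez⟩, hW⟩ := exists_three_leaves hA hsep (.singleton w)
      (singleton_subset_iff.2 ⟨x, hwx⟩) ⟨w, hwx.symm⟩ ⟨w, hwy.symm⟩ ⟨w, hwz.symm⟩
      (hne hwx) (hne hwy) (hne hwz) hxy hxz hyz ⟨w, rfl, hwx⟩ ⟨w, rfl, hwy⟩ ⟨w, rfl, hwz⟩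
    have hx : x ∈ support A := ⟨a, hax.symm⟩
    have hy : y ∈ support A := ⟨b, hby.symm⟩
    have hz : z ∈ support A := ⟨e, hez.symm⟩
    have hside : x.isLeft = y.isLeft ∨ x.isLeft = z.isLeft ∨ y.isLeft = z.isLeft := by
      cases x.isLeft <;> cases y.isLeft <;> cases z.isLeft <;> simp
    rcases hside with h | h | h
    · exact L.liftable_of_leaves hV hA (.extend hT he hez) (by simp [hxz, hxT])
        (by simp [hyz, hyT]) hxy hW h (off hx) (off hy)
    · exact L.liftable_of_leaves hV hA (.extend hT hb hby) (by simp [hxy, hxT])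
        (by simp [hyz.symm, hzT]) hxz (by rw [hW, insert_comm y z]) h (off hx) (off hz)
    · exact L.liftable_of_leaves hV hA (.extend hT ha hax) (by simp [hxy.symm, hyT])
        (by simp [hxz.symm, hzT]) hyz (by rw [hW, insert_comm x y, insert_comm x z]) h
        (off hy) (off hz)
  by_cases h0 : ∃ t c, A t c ≠ 0
  swap
  · push Not at h0
    refine ⟨0, fun m f g => ?_, ?_⟩
    · cases m with
      | zero => simpa using Mem.one
      | succ m => exact Or.inl (Matrix.det_eq_zero_of_row_eq_zero 0 fun j => rfl)
    · ext i j
      simp [h0]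
  push Not at hrow hcol hdeg
  obtain ⟨t, c, htc⟩ := h0
  obtain ⟨d, hdc, htd⟩ := hrow t c htc
  obtain ⟨r, hrt, hrc⟩ := hcol t c htc
  obtain ⟨q, hqc, hrq⟩ := hrow r c hrc
  have row : ∀ i j k, A i j ≠ 0 → A i k ≠ 0 → k ≠ j → ∀ m, m ≠ j → m ≠ k → A i m = 0 := by
    intro i j k hj hk hkj m hmj hmk
    by_contra hm
    exact hmk (Sum.inr_injective (hdeg (Sum.inl i) (Sum.inr j) (Sum.inr m) (Sum.inr k) hj hm hk
      (by simpa using hmj.symm) (by simpa using hkj.symm)))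
  refine L.liftable_of_path hV hrt.symm hdc.symm htc htd hrc (row t c d htc htd hdc)
    (row r c q hrc hrq hqc) (fun i hit hir => ?_)
    (ih' (support_schur_ssubset (hV.isUnit htc) htc) (hV.schur htc))
  by_contra hi
  exact hir (Sum.inl_injective (hdeg (Sum.inr c) (Sum.inl t) (Sum.inl i) (Sum.inl r) htc hi hrc
    (by simpa using hit.symm) (by simpa using hrt.symm)))

end FiniteLift

section Potential

variable {V Q : Type*} [CommGroup Q] {E : V → V → Prop} {c : V → V → Q}

/-- There is a path from `x` to `y` with total weight `q`. -/
inductive Path (E : V → V → Prop) (c : V → V → Q) : V → V → Q → Prop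
  | refl (x : V) : Path E c x x 1
  | forward {x y z : V} {q : Q} : Path E c x y q → E y z → Path E c x z (q * c y z)
  | backward {x y z : V} {q : Q} : Path E c x y q → E z y → Path E c x z (q / c z y)

theorem Path.exists_finset {x y : V} {q : Q} (h : Path E c x y q) : ∃ T : Finset V,
    ∀ H : V → Q, (∀ x ∈ T, ∀ y ∈ T, E x y → c x y = H x / H y) → q = H x / H y := by
  classical
  induction h with
  | refl => exact ⟨∅, fun H _ => by simp⟩
  | @forward y z q _ hyz ih =>
    obtain ⟨T, hT⟩ := ih
    refine ⟨insert y (insert z T), fun H hH => ?_⟩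
    rw [hH y (by simp) z (by simp) hyz,
      hT H fun x hx y hy => hH x (by simp [hx]) y (by simp [hy]), div_mul_div_cancel]
  | @backward y z q _ hyz ih =>
    obtain ⟨T, hT⟩ := ih
    refine ⟨insert y (insert z T), fun H hH => ?_⟩
    rw [hH z (by simp) y (by simp) hyz,
      hT H fun x hx y hy => hH x (by simp [hx]) y (by simp [hy]), div_div_div_cancel_right]

/-- A weight function on the edges of a graph which is locally the coboundary of a potential is
globally the coboundary of a potential. -/
theorem exists_potential
    (h : ∀ T : Finset V, ∃ H : V → Q, ∀ x ∈ T, ∀ y ∈ T, E x y → c x y = H x / H y) :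
    ∃ H : V → Q, ∀ x y, E x y → c x y = H x / H y := by
  classical
  have unique : ∀ {x y q q'}, Path E c x y q → Path E c x y q' → q = q' := by
    intro x y q q' hq hq'
    obtain ⟨T, hT⟩ := hq.exists_finset
    obtain ⟨T', hT'⟩ := hq'.exists_finset
    obtain ⟨H, hH⟩ := h (T ∪ T')
    rw [hT H fun x hx y hy => hH x (by simp [hx]) y (by simp [hy]),
      hT' H fun x hx y hy => hH x (by simp [hx]) y (by simp [hy])]
  have trans : ∀ {x y}, Relation.EqvGen E x y →
      ∀ r, (∃ q, Path E c r x q) ↔ ∃ q, Path E c r y q := by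
    intro x y hxy
    induction hxy with
    | rel x y hxy => exact fun r => ⟨fun ⟨q, hq⟩ => ⟨_, hq.forward hxy⟩,
        fun ⟨q, hq⟩ => ⟨_, hq.backward hxy⟩⟩
    | refl x => exact fun r => Iff.rfl
    | symm x y _ ih => exact fun r => (ih r).symm
    | trans x y z _ _ ih ih' => exact fun r => (ih r).trans (ih' r)
  have root : ∀ x, ∃ q, Path E c (Quot.mk E x).out x q := fun x =>
    (trans (Quot.eqvGen_exact (Quot.out_eq (Quot.mk E x))) _).1 ⟨1, .refl _⟩
  choose q hq using root
  refine ⟨fun x => (q x)⁻¹, fun x y hxy => ?_⟩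
  have hy := hq y
  rw [← Quot.sound hxy] at hy
  change c x y = (q x)⁻¹ / (q y)⁻¹
  rw [unique hy ((hq x).forward hxy)]
  simp

end Potential

section Limit

variable {R C S P : Type*} [CommRing S] [CommRing P] {Γ : Subgroup Sˣ} {π : S →+* P}
  {A : Matrix R C P} [Nontrivial P]

/-- The functions which are eventually constant. -/
def eventuallyConst (ι G : Type*) [CommGroup G] (l : Filter ι) : Subgroup (ι → G) where
  carrier := {g | ∃ k, ∀ᶠ i in l, g i = k}
  mul_mem' := by
    rintro a b ⟨k, hk⟩ ⟨m, hm⟩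
    exact ⟨k * m, by filter_upwards [hk, hm] with i h h' using by simp [h, h']⟩
  one_mem' := ⟨1, by simp⟩
  inv_mem' := by
    rintro a ⟨k, hk⟩
    exact ⟨k⁻¹, by filter_upwards [hk] with i h using by simp [h]⟩

theorem Lifting.exists_locally_eq_scale (L : Lifting Γ π) (hV : Valid A) :
    ∃ B : Matrix R C S, ∀ T : Finset (R ⊕ C), ∃ (D : Matrix R C S) (l : R → Sˣ) (m : C → Sˣ),
      IsMatrix Γ D ∧ (∀ i, l i ∈ Γ) ∧ (∀ j, m j ∈ Γ) ∧ ∀ i j, Sum.inl i ∈ T → Sum.inr j ∈ T →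
        π (D i j) = A i j ∧ B i j = scale l m D i j := by
  classical
  have hfin : ∀ T : Finset (R ⊕ C), (support (restrict A (T : Set (R ⊕ C)))).Finite := fun T =>
    T.finite_toSet.subset (support_subset fun i j h => ⟨(restrict_ne_zero h).1,
      (restrict_ne_zero h).2.1⟩)
  choose D hD hDA using fun T : Finset (R ⊕ C) =>
    L.liftable_of_finite (hV.restrict (T : Set (R ⊕ C))) (hfin T)
  have hDA' : ∀ (T : Finset (R ⊕ C)) {i j}, Sum.inl i ∈ T → Sum.inr j ∈ T →
      π (D T i j) = A i j := fun T i j hi hj =>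
    (congrFun (congrFun (hDA T) i) j).trans (restrict_pos (W := (T : Set (R ⊕ C)))
      (Finset.mem_coe.2 hi) (Finset.mem_coe.2 hj))
  have hD0 : ∀ (T : Finset (R ⊕ C)) {i j}, Sum.inl i ∈ T → Sum.inr j ∈ T →
      (D T i j = 0 ↔ A i j = 0) := fun T i j hi hj => by
    rw [← hDA' T hi hj, (hD T).map_eq_zero_iff]
  have hγ : ∀ i j T, ∃ g : Γ, D T i j ≠ 0 → ((g : Sˣ) : S) = D T i j := by
    intro i j T
    by_cases h : D T i j = 0
    · exact ⟨1, fun h' => absurd h h'⟩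
    · obtain ⟨g, hg, e⟩ := ((hD T).mem i j).exists_unit h
      exact ⟨⟨g, hg⟩, fun _ => e⟩
  choose γ hγ using hγ
  set N := eventuallyConst (Finset (R ⊕ C)) Γ Filter.atTop
  have hlocal : ∀ T : Finset (R ⊕ C), ∃ H : R ⊕ C → (Finset (R ⊕ C) → Γ) ⧸ N,
      ∀ x ∈ T, ∀ y ∈ T, (∃ i j, x = Sum.inl i ∧ y = Sum.inr j ∧ A i j ≠ 0) →
      Sum.elim (fun i => Sum.elim (fun _ => 1) fun j => ((γ i j : Finset (R ⊕ C) → Γ) : _ ⧸ N))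
        (fun _ _ => 1) x y = H x / H y := by
    intro T
    have hF : ∀ F : Finset (R ⊕ C), ∃ (l : R → Γ) (m : C → Γ), T ⊆ F → ∀ i j, Sum.inl i ∈ T →
        Sum.inr j ∈ T → D F i j = scale (fun i => l i) (fun j => m j) (D T) i j := by
      intro F
      by_cases hTF : T ⊆ F
      swap
      · exact ⟨1, 1, fun h => absurd h hTF⟩
      obtain ⟨l, m, hl, hm, h⟩ := L.exists_eq_scale ((hD F).restrict (T : Set (R ⊕ C)))
        ((hD T).restrict (T : Set (R ⊕ C))) (by
          rw [map_restrict, map_restrict, hDA, hDA, restrict_restrict, restrict_restrict,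
            inter_self, inter_eq_right.2 (by simpa using hTF)])
        (T.finite_toSet.preimage Sum.inr_injective.injOn) fun i j hj => restrict_right hj
      refine ⟨fun i => ⟨l i, hl i⟩, fun j => ⟨m j, hm j⟩, fun _ i j hi hj => ?_⟩
      have := congrFun (congrFun h i) j
      rw [restrict_pos (W := (T : Set (R ⊕ C))) (Finset.mem_coe.2 hi) (Finset.mem_coe.2 hj)] at this
      rw [this]
      simp only [scale]
      rw [restrict_pos (W := (T : Set (R ⊕ C))) (Finset.mem_coe.2 hi) (Finset.mem_coe.2 hj)]
    choose l m hlm using hF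
    refine ⟨Sum.elim (fun i => ((fun F => l F i : Finset (R ⊕ C) → Γ) : _ ⧸ N))
      fun j => ((fun F => m F j : Finset (R ⊕ C) → Γ) : _ ⧸ N)⁻¹, ?_⟩
    rintro _ hx _ hy ⟨i, j, rfl, rfl, hij⟩
    simp only [Sum.elim_inl, Sum.elim_inr, div_inv_eq_mul]
    rw [← QuotientGroup.mk_mul, QuotientGroup.eq]
    refine ⟨(γ i j T)⁻¹, ?_⟩
    filter_upwards [Filter.eventually_ge_atTop T] with F hTF
    have e := hlm F hTF i j hx hy
    have e' := hγ i j F (mt (hD0 F (hTF hx) (hTF hy)).1 hij)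
    have e'' := hγ i j T (mt (hD0 T hx hy).1 hij)
    have : γ i j F = l F i * γ i j T * m F j := by
      ext
      rw [e', e]
      simp [scale, e'']
      ring
    simp only [Pi.mul_apply, Pi.inv_apply, this]
    rw [inv_mul_eq_iff_eq_mul, mul_right_comm (l F i), mul_inv_cancel_right]
  obtain ⟨H, hH⟩ := exists_potential (Q := (Finset (R ⊕ C) → Γ) ⧸ N) hlocal
  choose h hh using fun x => QuotientGroup.mk_surjective (H x)
  have hconst : ∀ i j, ∃ k : Γ, A i j ≠ 0 → ∀ᶠ F in Filter.atTop,
      γ i j F * (h (Sum.inl i) F)⁻¹ * h (Sum.inr j) F = k := by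
    intro i j
    by_cases hij : A i j = 0
    · exact ⟨1, fun h => absurd hij h⟩
    have := hH _ _ ⟨i, j, rfl, rfl, hij⟩
    simp only [Sum.elim_inl, Sum.elim_inr] at this
    rw [← hh, ← hh, eq_div_iff_mul_eq', ← QuotientGroup.mk_mul, eq_comm, QuotientGroup.eq] at this
    obtain ⟨k, hk⟩ := this
    refine ⟨k, fun _ => ?_⟩
    filter_upwards [hk] with F hF
    rw [← hF]
    simp only [Pi.mul_apply, Pi.inv_apply]
    rw [mul_assoc, mul_left_comm]
  choose k hk using hconst
  obtain ⟨B, hB⟩ : ∃ B : Matrix R C S,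
      ∀ i j, B i j = if A i j = 0 then 0 else ((k i j : Sˣ) : S) := ⟨_, fun _ _ => rfl⟩
  refine ⟨B, fun T => ?_⟩
  have hev : ∀ᶠ F in Filter.atTop, ∀ x ∈ T, ∀ y ∈ T, ∀ i j, x = Sum.inl i → y = Sum.inr j →
      A i j ≠ 0 → γ i j F * (h (Sum.inl i) F)⁻¹ * h (Sum.inr j) F = k i j := by
    rw [Filter.eventually_all_finset]
    intro x _
    rw [Filter.eventually_all_finset]
    intro y _
    rcases x with i | j
    · rcases y with i' | j
      · simp
      · by_cases hij : A i j = 0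
        · refine Filter.Eventually.of_forall ?_
          rintro F _ _ ⟨⟩ ⟨⟩ h'
          exact absurd hij h'
        · filter_upwards [hk i j hij] with F hF
          rintro _ _ ⟨⟩ ⟨⟩ _
          exact hF
    · simp
  obtain ⟨F, hF, hTF⟩ := (hev.and (Filter.eventually_ge_atTop T)).exists
  refine ⟨D F, fun i => ((h (Sum.inl i) F)⁻¹ : Γ), fun j => (h (Sum.inr j) F : Γ), hD F,
    fun i => Subtype.property _, fun j => Subtype.property _, fun i j hi hj =>
    ⟨hDA' F (hTF hi) (hTF hj), ?_⟩⟩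
  rw [hB]
  by_cases hij : A i j = 0
  · simp [hij, scale, (hD0 F (hTF hi) (hTF hj)).2 hij]
  · rw [if_neg hij, ← hF _ hi _ hj i j rfl rfl hij, scale,
      ← hγ i j F (mt (hD0 F (hTF hi) (hTF hj)).1 hij)]
    simp only [Subgroup.coe_mul, Units.val_mul]
    ring

/-- The lift theorem: a valid matrix has the same vanishing minors as some matrix over the partial
field. -/
theorem Lifting.exists_isMatrix {Q : Type*} [CommRing Q] [Nontrivial Q] (L : Lifting Γ π)
    (hV : Valid A) (ρ : P →+* Q) :
    ∃ B : Matrix R C S, IsMatrix Γ B ∧ ∀ (n : ℕ) (f : Fin n → R) (g : Fin n → C),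
      (B.submatrix f g).det = 0 ↔ ρ (A.submatrix f g).det = 0 := by
  classical
  obtain ⟨B, hB⟩ := L.exists_locally_eq_scale hV
  have key : ∀ (n : ℕ) (f : Fin n → R) (g : Fin n → C), ∃ D : Matrix R C S, IsMatrix Γ D ∧
      B.submatrix f g = D.submatrix f g ∧
      ((D.submatrix f g).det = 0 ↔ ρ (A.submatrix f g).det = 0) := by
    intro n f g
    obtain ⟨D, l, m, hD, hl, hm, h⟩ := hB
      (Finset.univ.image (fun a => Sum.inl (f a)) ∪ Finset.univ.image fun a => Sum.inr (g a))
    have h' := fun a b => h (f a) (g b) (by simp) (by simp)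
    refine ⟨scale l m D, hD.scale hl hm, ?_, ?_⟩
    · ext a b
      exact (h' a b).2
    · have e : (scale l m D).submatrix f g =
          scale (fun a => l (f a)) (fun b => m (g b)) (D.submatrix f g) := rfl
      have e' : A.submatrix f g = π.mapMatrix (D.submatrix f g) := by
        ext a b
        exact (h' a b).1.symm
      have e'' : scale (fun a => l (f a)) (fun b => m (g b)) (D.submatrix f g) =
          Matrix.diagonal (fun a => (l (f a) : S)) * D.submatrix f g *
            Matrix.diagonal (fun b => (m (g b) : S)) := by
        ext a b
        simp [scale, mul_right_comm]
      rw [e', ← RingHom.map_det, ← RingHom.comp_apply, (hD n f g).map_eq_zero_iff (ρ.comp π), e,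
        e'', Matrix.det_mul,
        Matrix.det_mul, Matrix.det_diagonal, Matrix.det_diagonal, ← Units.coe_prod,
        ← Units.coe_prod, Units.mul_left_eq_zero, Units.mul_right_eq_zero]
  refine ⟨B, fun n f g => ?_, fun n f g => ?_⟩
  · obtain ⟨D, hD, e, -⟩ := key n f g
    rw [e]
    exact hD n f g
  · obtain ⟨D, hD, e, h⟩ := key n f g
    rw [e, h]

end Limit

section FourElements

/-- The field with four elements; `(a, b)` is `a + b * ω` with `ω ^ 2 = ω + 1`. -/
def F4 : Type := Bool × Bool

namespace F4

instance : DecidableEq F4 := inferInstanceAs (DecidableEq (Bool × Bool))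
instance : Fintype F4 := inferInstanceAs (Fintype (Bool × Bool))
instance : Zero F4 := ⟨(false, false)⟩
instance : One F4 := ⟨(true, false)⟩
instance : Neg F4 := ⟨fun a => a⟩
instance : Add F4 := ⟨fun a b => (xor a.1 b.1, xor a.2 b.2)⟩
instance : Mul F4 := ⟨fun a b => (xor (a.1 && b.1) (a.2 && b.2),
  xor (xor (a.1 && b.2) (a.2 && b.1)) (a.2 && b.2))⟩
instance : Inv F4 := ⟨fun a => a * a⟩

instance : CommRing F4 where
  add_assoc := by decide
  zero_add := by decide
  add_zero := by decide
  add_comm := by decide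
  left_distrib := by decide
  right_distrib := by decide
  zero_mul := by decide
  mul_zero := by decide
  mul_assoc := by decide
  one_mul := by decide
  mul_one := by decide
  mul_comm := by decide
  neg_add_cancel := by decide
  nsmul := nsmulRec
  zsmul := zsmulRec

instance : Field F4 where
  exists_pair_ne := ⟨0, 1, by decide⟩
  mul_inv_cancel := by decide
  inv_zero := by decide
  nnqsmul := _
  nnqsmul_def := fun _ _ => rfl
  qsmul := _
  qsmul_def := fun _ _ => rfl

/-- A generator of the multiplicative group. -/
def omega : F4 := (false, true)

theorem card : Fintype.card F4 = 4 := by decide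

end F4

theorem zeroOrUnit_prod {K L : Type*} [Field K] [Field L] {x : K × L} :
    ZeroOrUnit x ↔ (x.1 = 0 ↔ x.2 = 0) := by
  rw [ZeroOrUnit, Prod.isUnit_iff, isUnit_iff_ne_zero, isUnit_iff_ne_zero, Prod.ext_iff]
  simp only [Prod.fst_zero, Prod.snd_zero]
  tauto

end FourElements

section SmallMatrices

/-- A decidable form of `ZeroOrUnit` for a product of two fields. -/
def ZeroOrUnitProd {K L : Type*} [Zero K] [Zero L] (x : K × L) : Prop := x.1 = 0 ↔ x.2 = 0

instance {K L : Type*} [Zero K] [Zero L] [DecidableEq K] [DecidableEq L] (x : K × L) :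
    Decidable (ZeroOrUnitProd x) := by
  unfold ZeroOrUnitProd
  infer_instance

set_option synthInstance.maxHeartbeats 400000 in
set_option synthInstance.maxSize 2000 in
theorem eq_of_zeroOrUnitProd : ∀ x : F4 × ZMod 5, ZeroOrUnitProd x → x ≠ 0 →
    ZeroOrUnitProd (x - 1) → ∀ z : F4 × ZMod 5, ZeroOrUnitProd z → z ≠ 0 →
    ZeroOrUnitProd (z - x) → ZeroOrUnitProd (z - (x - 1)) →
    ¬(x - 1 ≠ 0 ∧ z - x ≠ 0 ∧ z - (x - 1) ≠ 0) →
    ∀ w : F4 × ZMod 5, ZeroOrUnitProd w → w ≠ 0 → ZeroOrUnitProd (w - z) →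
    ZeroOrUnitProd (w + 1) → ZeroOrUnitProd ((x - 1) * w + z) → ZeroOrUnitProd (w - z + x) →
    ¬(x - 1 ≠ 0 ∧ z - (x - 1) ≠ 0 ∧ w + 1 ≠ 0 ∧ (x - 1) * w + z ≠ 0) →
    ¬(x - 1 ≠ 0 ∧ w - z ≠ 0 ∧ (x - 1) * w + z ≠ 0) →
    ¬(w - z ≠ 0 ∧ z - x ≠ 0 ∧ w - z + x ≠ 0) →
    ¬(z - w ≠ 0 ∧ 1 + w ≠ 0 ∧ z - w + x * w ≠ 0 ∧ z - w - x ≠ 0) →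
    ¬(z - x ≠ 0 ∧ z - x + 1 ≠ 0 ∧ w + 1 ≠ 0 ∧ w - (z - x) ≠ 0) →
    x = 1 ∧ w = z - 1 ∨ z = x ∧ w * (1 - z) = z ∨ z = x - 1 ∧ w = -1 ∨ z = x - 1 ∧ w = z := by
  decide +kernel

theorem eq_of_valid (x z w : F4 × ZMod 5) (hx : IsUnit x) (hz : IsUnit z) (hw : IsUnit w)
    (hV : Valid !![1, 0, 1, 1; 1, 1, x, 0; 0, 1, z, w]) :
    x = 1 ∧ w = z - 1 ∨ z = x ∧ w * (1 - z) = z ∨ z = x - 1 ∧ w = -1 ∨ z = x - 1 ∧ w = z := by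
  obtain ⟨A, hA⟩ : ∃ A : Matrix (Fin 3) (Fin 4) (F4 × ZMod 5),
    A = !![1, 0, 1, 1; 1, 1, x, 0; 0, 1, z, w] := ⟨_, rfl⟩
  rw [← hA] at hV
  have e1 : piv A 0 0 = !![-1, 0, 1, 1; 1, 1, x - 1, -1; 0, 1, z, w] := by
    subst hA
    refine Matrix.ext fun i j => ?_
    fin_cases i <;> fin_cases j <;> simp [piv, schur]
  have e2 : piv A 0 2 = !![1, 0, -1, 1; 1 - x, 1, x, -x; -z, 1, z, w - z] := by
    subst hA
    refine Matrix.ext fun i j => ?_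
    fin_cases i <;> fin_cases j <;> simp [piv, schur]
  have e3 : piv A 0 3 = !![1, 0, 1, -1; 1, 1, x, 0; -w, 1, z - w, w] := by
    subst hA
    refine Matrix.ext fun i j => ?_
    fin_cases i <;> fin_cases j <;> simp [piv, schur]
  have e4 : piv A 1 1 = !![1, 0, 1, 1; 1, -1, x, 0; -1, 1, z - x, w] := by
    subst hA
    refine Matrix.ext fun i j => ?_
    fin_cases i <;> fin_cases j <;> simp [piv, schur]
  have h1 := hV.piv (r := 0) (c := 0) (by simp [hA])
  have h2 := hV.piv (r := 0) (c := 2) (by simp [hA])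
  have h3 := hV.piv (r := 0) (c := 3) (by simp [hA])
  have h4 := hV.piv (r := 1) (c := 1) (by simp [hA])
  rw [e1] at h1
  rw [e2] at h2
  rw [e3] at h3
  rw [e4] at h4
  have hx0 := hx.ne_zero
  have hz0 := hz.ne_zero
  have hw0 := hw.ne_zero
  refine eq_of_zeroOrUnitProd x (zeroOrUnit_prod.1 (.inr hx)) hx0 (zeroOrUnit_prod.1 ?_)
    z (zeroOrUnit_prod.1 (.inr hz)) hz0 (zeroOrUnit_prod.1 ?_) (zeroOrUnit_prod.1 ?_) ?_
    w (zeroOrUnit_prod.1 (.inr hw)) hw0 (zeroOrUnit_prod.1 ?_) (zeroOrUnit_prod.1 ?_)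
    (zeroOrUnit_prod.1 ?_) (zeroOrUnit_prod.1 ?_) ?_ ?_ ?_ ?_ ?_
  · simpa using h1.tame.entry 1 2
  · simpa using h4.tame.entry 2 2
  · simpa using h1.zeroOrUnit_det 1 2 1 2
  · rintro ⟨a, b, c⟩
    refine h2.tame.not_generic 1 2 0 1 2 ?_
    simp [Generic]
    have e1 : 1 - x + z = z - (x - 1) := by ring
    have e2 : (1 - x) * z + x * z = z := by ring
    rw [e1, e2, ← neg_sub x 1, neg_eq_zero]
    exact ⟨⟨a, hx0⟩, hz0, c, hz0, b⟩
  · simpa using h2.tame.entry 2 3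
  · simpa [add_comm] using h1.zeroOrUnit_det 1 2 1 3
  · simpa using h1.zeroOrUnit_det 1 2 2 3
  · simpa using h2.zeroOrUnit_det 1 2 1 3
  · rintro ⟨a, b, c, d⟩
    refine h1.tame.not_generic 1 2 1 2 3 ?_
    simp [Generic]
    exact ⟨a, ⟨hz0, hw0⟩, b, c, d⟩
  · rintro ⟨a, b, c⟩
    refine h1.tame.not_generic_transpose 2 3 0 1 2 ?_
    simp [Generic]
    have e : -1 - (x - 1) = -x := by ring
    rw [e, neg_eq_zero]
    exact ⟨⟨a, hz0⟩, hw0, hx0, b, c⟩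
  · rintro ⟨a, b, c⟩
    refine h2.tame.not_generic 1 2 1 2 3 ?_
    simp [Generic]
    have e : x * (w - z) + x * z = x * w := by ring
    rw [e]
    exact ⟨hx0, ⟨hz0, a⟩, b, c, (hx.mul hw).ne_zero⟩
  · rintro ⟨a, b, c, d⟩
    refine h3.tame.not_generic 1 2 0 1 2 ?_
    simp [Generic]
    exact ⟨hx0, ⟨hw0, a⟩, b, c, d⟩
  · rintro ⟨a, b, c, d⟩
    refine h4.tame.not_generic 0 2 0 2 3 ?_
    simp [Generic]
    exact ⟨⟨a, hw0⟩, b, c, d⟩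

end SmallMatrices

section UnitEquation

theorem abs_add_eq_one {x y : ℚ} {a b : ℤ} (h : x + y = 1) (hx : |x| = 2 ^ a) (hy : |y| = 2 ^ b) :
    a = 1 ∧ b = 0 ∧ x = 2 ∨ a = 0 ∧ b = 1 ∧ x = -1 ∨ a = -1 ∧ b = -1 ∧ x = 1 / 2 := by
  have key : ∀ {a b : ℤ}, (2 : ℚ) ^ a = 1 + 2 ^ b → a = 1 ∧ b = 0 := by
    intro a b h
    have hb : (0 : ℚ) < 2 ^ b := by positivity
    have ha : 0 < a := by
      rw [← zpow_lt_zpow_iff_right₀ (one_lt_two (α := ℚ)), zpow_zero]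
      linarith
    have hba : b < a := by
      rw [← zpow_lt_zpow_iff_right₀ (one_lt_two (α := ℚ))]
      linarith
    rcases lt_trichotomy b 0 with hb | rfl | hb
    · have h1 : (2 : ℚ) ^ b < 2 ^ (0 : ℤ) := zpow_lt_zpow_right₀ one_lt_two hb
      have h2 : (2 : ℚ) ^ (1 : ℤ) ≤ 2 ^ a := zpow_le_zpow_right₀ one_le_two (by omega)
      rw [zpow_zero] at h1
      rw [zpow_one] at h2
      linarith
    · refine ⟨?_, rfl⟩
      rw [zpow_zero] at h
      exact zpow_right_injective₀ (a := (2 : ℚ)) (by norm_num) (by norm_num) (by norm_num [h])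
    · have h1 : (2 : ℚ) ^ (0 : ℤ) < 2 ^ b := zpow_lt_zpow_right₀ one_lt_two hb
      have h2 : (2 : ℚ) ^ (b + 1) ≤ 2 ^ a := zpow_le_zpow_right₀ one_le_two (by omega)
      rw [zpow_add₀ two_ne_zero, zpow_one] at h2
      rw [zpow_zero] at h1
      linarith
  have ha : (0 : ℚ) < 2 ^ a := by positivity
  have hb : (0 : ℚ) < 2 ^ b := by positivity
  rcases abs_choice x with hx' | hx' <;> rcases abs_choice y with hy' | hy' <;>
    rw [hx'] at hx <;> rw [hy'] at hy
  · have hlt : ∀ {a : ℤ}, (2 : ℚ) ^ a < 1 →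
      (2 : ℚ) ^ a ≤ 1 / 2 ∧ (2 ^ a = (1 / 2 : ℚ) → a = -1) := by
      intro a ha
      rw [← zpow_zero (2 : ℚ), zpow_lt_zpow_iff_right₀ one_lt_two] at ha
      have : (2 : ℚ) ^ (-1 : ℤ) = 1 / 2 := by norm_num
      rw [← this]
      exact ⟨zpow_le_zpow_right₀ one_le_two (by omega),
        fun h => zpow_right_injective₀ (a := (2 : ℚ)) (by norm_num) (by norm_num) h⟩
    obtain ⟨h1, h2⟩ := hlt (a := a) (by linarith)
    obtain ⟨h3, h4⟩ := hlt (a := b) (by linarith)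
    exact Or.inr (Or.inr ⟨h2 (by linarith), h4 (by linarith), by linarith⟩)
  · obtain ⟨rfl, rfl⟩ := key (a := a) (b := b) (by linarith)
    exact Or.inl ⟨rfl, rfl, by simpa using hx⟩
  · obtain ⟨rfl, rfl⟩ := key (a := b) (b := a) (by linarith)
    exact Or.inr (Or.inl ⟨rfl, rfl, by norm_num at hx; linarith⟩)
  · linarith

variable {S : Type*} [CommRing S]

/-- The group of all `± α ^ i * β ^ k`. -/
def signedPowers (α β : Sˣ) : Subgroup Sˣ where
  carrier := {g | ∃ i k : ℤ, g = α ^ i * β ^ k ∨ g = -(α ^ i * β ^ k)}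
  mul_mem' := by
    rintro _ _ ⟨i, k, h⟩ ⟨i', k', h'⟩
    refine ⟨i + i', k + k', ?_⟩
    rw [zpow_add, zpow_add, mul_mul_mul_comm]
    rcases h with rfl | rfl <;> rcases h' with rfl | rfl <;> simp
  one_mem' := ⟨0, 0, by simp⟩
  inv_mem' := by
    rintro _ ⟨i, k, h⟩
    refine ⟨-i, -k, ?_⟩
    rcases h with rfl | rfl <;> simp [mul_comm]

variable {α β : Sˣ}

theorem neg_mem_signedPowers {g : Sˣ} (hg : g ∈ signedPowers α β) : -g ∈ signedPowers α β := by
  obtain ⟨i, k, rfl | rfl⟩ := hg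
  · exact ⟨i, k, Or.inr rfl⟩
  · exact ⟨i, k, Or.inl (neg_neg _)⟩

theorem left_mem_signedPowers : α ∈ signedPowers α β := ⟨1, 0, by simp⟩

theorem right_mem_signedPowers : β ∈ signedPowers α β := ⟨0, 1, by simp⟩

/-- The elements `g` of the group such that `1 - g` is zero or in the group. -/
def fundamental (α β : Sˣ) : Fin 7 → Sˣ :=
  ![1, α, β, α⁻¹, β⁻¹, -(α * β⁻¹), -(α⁻¹ * β)]

theorem fundamental_mem (t : Fin 7) : fundamental α β t ∈ signedPowers α β := by
  have ha : α ∈ signedPowers α β := left_mem_signedPowers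
  have hb : β ∈ signedPowers α β := right_mem_signedPowers
  have ha' := inv_mem ha
  have hb' := inv_mem hb
  fin_cases t
  exacts [one_mem _, ha, hb, ha', hb', neg_mem_signedPowers (mul_mem ha hb'),
    neg_mem_signedPowers (mul_mem ha' hb)]

theorem mem_one_sub_fundamental (h : (α : S) + β = 1) (t : Fin 7) :
    Mem (signedPowers α β) (1 - (fundamental α β t : S)) := by
  have hα := α.mul_inv
  have hβ := β.mul_inv
  have e : ∃ g, Mem (signedPowers α β) g ∧ 1 - (fundamental α β t : S) = g := by
    fin_cases t
    · exact ⟨0, .zero, by simp [fundamental]⟩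
    · exact ⟨_, mem_coe (fundamental_mem 2), by simp [fundamental, ← h]⟩
    · exact ⟨_, mem_coe (fundamental_mem 1), by simp [fundamental, ← h]⟩
    · refine ⟨_, mem_coe (fundamental_mem 6), ?_⟩
      simp [fundamental]
      linear_combination (↑α⁻¹ : S) * h - hα
    · refine ⟨_, mem_coe (fundamental_mem 5), ?_⟩
      simp [fundamental]
      linear_combination (↑β⁻¹ : S) * h - hβ
    · refine ⟨_, mem_coe (fundamental_mem 4), ?_⟩
      simp [fundamental]
      linear_combination (↑β⁻¹ : S) * h - hβ
    · refine ⟨_, mem_coe (fundamental_mem 3), ?_⟩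
      simp [fundamental]
      linear_combination (↑α⁻¹ : S) * h - hα
  obtain ⟨g, hg, e⟩ := e
  rwa [e]

theorem abs_map_signedPowers {g : Sˣ} {i k : ℤ} (hg : g = α ^ i * β ^ k ∨ g = -(α ^ i * β ^ k))
    (q : S →+* ℚ) : |q g| = |q α| ^ i * |q β| ^ k := by
  have : ∀ (u : Sˣ) (i : ℤ), q ((u ^ i : Sˣ) : S) = q u ^ i := fun u i => by
    have := Units.coe_map (q : S →* ℚ) (u ^ i)
    rw [map_zpow, Units.val_zpow_eq_zpow_val] at this
    exact this.symm
  rcases hg with rfl | rfl <;> simp [this, abs_mul, abs_zpow]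

theorem exists_eq_fundamental {q₁ q₂ q₃ : S →+* ℚ} (h₁ : q₁ α = 2 ∧ q₁ β = -1)
    (h₂ : q₂ α = -1 ∧ q₂ β = 2) (h₃ : q₃ α = 1 / 2 ∧ q₃ β = 1 / 2) {g : Sˣ}
    (hg : g ∈ signedPowers α β) (hg' : Mem (signedPowers α β) (1 - (g : S))) :
    ∃ t, g = fundamental α β t := by
  rcases hg' with hg' | ⟨h, ⟨i', k', hh⟩, hgh⟩
  · exact ⟨0, by ext; simpa [fundamental] using (sub_eq_zero.1 hg').symm⟩
  obtain ⟨i, k, hg⟩ := hg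
  have key : ∀ q : S →+* ℚ, q g + q h = 1 := fun q => by rw [hgh]; simp
  have r₁ := abs_add_eq_one (a := i) (b := i') (key q₁)
    (by rw [abs_map_signedPowers hg, h₁.1, h₁.2]; norm_num)
    (by rw [abs_map_signedPowers hh, h₁.1, h₁.2]; norm_num)
  have r₂ := abs_add_eq_one (a := k) (b := k') (key q₂)
    (by rw [abs_map_signedPowers hg, h₂.1, h₂.2]; norm_num)
    (by rw [abs_map_signedPowers hh, h₂.1, h₂.2]; norm_num)
  have r₃ := abs_add_eq_one (a := -i - k) (b := -i' - k') (key q₃)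
    (by
      rw [abs_map_signedPowers hg, h₃.1, h₃.2, ← zpow_add₀ (by norm_num), abs_of_pos (by norm_num),
        one_div, inv_zpow']
      congr 1
      ring)
    (by
      rw [abs_map_signedPowers hh, h₃.1, h₃.2, ← zpow_add₀ (by norm_num), abs_of_pos (by norm_num),
        one_div, inv_zpow']
      congr 1
      ring)
  rcases r₁ with ⟨ha, hb, e⟩ | ⟨ha, hb, e⟩ | ⟨ha, hb, e⟩ <;>
    rcases r₂ with ⟨hc, hd, e'⟩ | ⟨hc, hd, e'⟩ | ⟨hc, hd, e'⟩ <;>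
    try omega
  all_goals
    subst ha hc
    rcases hg with rfl | rfl
  all_goals
    simp only [h₁, Units.val_neg, Units.val_mul, map_neg, map_mul, zpow_one, zpow_zero,
      zpow_neg, mul_one, one_mul] at e
    first
    | (refine ⟨1, ?_⟩; simp [fundamental]; done)
    | (refine ⟨2, ?_⟩; simp [fundamental]; done)
    | (refine ⟨3, ?_⟩; simp [fundamental]; done)
    | (refine ⟨4, ?_⟩; simp [fundamental]; done)
    | (refine ⟨5, ?_⟩; simp [fundamental]; done)
    | (refine ⟨6, ?_⟩; simp [fundamental]; done)
    | norm_num [h₁] at e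

theorem map_inv_eq {P : Type*} [CommRing P] (π : S →+* P) (u : Sˣ) {p q : P} (hp : π u = p)
    (h : q * p = 1) : π (u⁻¹ : Sˣ) = q := by
  have : p * π (u⁻¹ : Sˣ) = 1 := by rw [← hp, ← map_mul, u.mul_inv, map_one]
  rw [← one_mul (π _), ← h, mul_assoc, this, mul_one]

theorem lifting_signedPowers {q₁ q₂ q₃ : S →+* ℚ} {π : S →+* F4 × ZMod 5}
    (h₁ : q₁ α = 2 ∧ q₁ β = -1) (h₂ : q₂ α = -1 ∧ q₂ β = 2) (h₃ : q₃ α = 1 / 2 ∧ q₃ β = 1 / 2)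
    (h : (α : S) + β = 1) (hπ : π α = (F4.omega, 2)) : Lifting (signedPowers α β) π := by
  have hπ' : π β = (F4.omega + 1, 4) := by
    rw [← sub_eq_of_eq_add' h.symm, map_sub, hπ, map_one]
    decide
  obtain ⟨val, hval⟩ : ∃ val : Fin 7 → F4 × ZMod 5, val = ![1, (F4.omega, 2), (F4.omega + 1, 4),
    (F4.omega + 1, 3), (F4.omega, 4), (F4.omega + 1, 2), (F4.omega, 3)] := ⟨_, rfl⟩
  have hf : ∀ t, π (fundamental α β t : Sˣ) = val t := by
    have hα := map_inv_eq π α (q := (F4.omega + 1, 3)) hπ (by decide)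
    have hβ := map_inv_eq π β (q := (F4.omega, 4)) hπ' (by decide)
    intro t
    subst hval
    fin_cases t
    · simp [fundamental]
    · simpa [fundamental] using hπ
    · simpa [fundamental] using hπ'
    · simpa [fundamental] using hα
    · simpa [fundamental] using hβ
    · simp only [fundamental]
      change π (-(α * β⁻¹) : Sˣ) = (F4.omega + 1, 2)
      rw [Units.val_neg, Units.val_mul, map_neg, map_mul, hπ, hβ]
      decide
    · change π (-(α⁻¹ * β) : Sˣ) = (F4.omega, 3)
      rw [Units.val_neg, Units.val_mul, map_neg, map_mul, hπ', hα]
      decide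
  refine ⟨neg_mem_signedPowers (one_mem _), fun p hp => ?_, fun p hp hp' => ?_,
    fun g hg g' hg' hm hm' e => ?_, eq_of_valid⟩
  · have : ∀ p : F4 × ZMod 5, p.1 ≠ 0 ∧ p.2 ≠ 0 → ∃ i : Fin 12, (F4.omega, 2) ^ (i : ℕ) = p := by
      decide +kernel
    obtain ⟨i, rfl⟩ := this p (by simpa [Prod.isUnit_iff] using hp)
    exact ⟨α ^ (i : ℕ), pow_mem left_mem_signedPowers _, by simp [hπ]⟩
  · have : ∀ p : F4 × ZMod 5, p.1 ≠ 0 ∧ p.2 ≠ 0 → ZeroOrUnitProd (1 - p) → ∃ t, ![1,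
        (F4.omega, 2), (F4.omega + 1, 4), (F4.omega + 1, 3), (F4.omega, 4), (F4.omega + 1, 2),
        (F4.omega, 3)] t = p := by
      decide +kernel
    obtain ⟨t, ht⟩ := this p (by simpa [Prod.isUnit_iff] using hp) (zeroOrUnit_prod.1 hp')
    exact ⟨_, fundamental_mem t, by rw [hf, hval, ht], mem_one_sub_fundamental h t⟩
  · obtain ⟨t, rfl⟩ := exists_eq_fundamental h₁ h₂ h₃ hg hm
    obtain ⟨t', rfl⟩ := exists_eq_fundamental h₁ h₂ h₃ hg' hm'
    rw [hf, hf, hval] at e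
    have : ∀ t t' : Fin 7, (![1, (F4.omega, 2), (F4.omega + 1, 4), (F4.omega + 1, 3),
        (F4.omega, 4), (F4.omega + 1, 2), (F4.omega, 3)] : Fin 7 → F4 × ZMod 5) t = ![1,
        (F4.omega, 2), (F4.omega + 1, 4), (F4.omega + 1, 3), (F4.omega, 4), (F4.omega + 1, 2),
        (F4.omega, 3)] t' → t = t' := by
      decide +kernel
    rw [this t t' e]

/-- A matrix over `F4 × ZMod 5` which is valid has a counterpart with the same vanishing minors over
every field with at least three elements. -/
theorem Valid.exists_field_matrix {R C Q : Type*} [CommRing Q] [Nontrivial Q]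
    {A : Matrix R C (F4 × ZMod 5)} (hV : Valid A) (ρ : F4 × ZMod 5 →+* Q) {K : Type*}
    [Field K] {a : K} (h0 : a ≠ 0) (h1 : a ≠ 1) :
    ∃ B : Matrix R C K, ∀ (n : ℕ) (f : Fin n → R) (g : Fin n → C),
      (B.submatrix f g).det = 0 ↔ ρ (A.submatrix f g).det = 0 := by
  have hα : IsUnit (((2, -1, 1 / 2), (F4.omega, 2), a) :
      (ℚ × ℚ × ℚ) × (F4 × ZMod 5) × K) := by
    simp only [Prod.isUnit_iff, isUnit_iff_ne_zero]
    exact ⟨by norm_num, ⟨by decide, by decide⟩, h0⟩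
  have hβ : IsUnit (((-1, 2, 1 / 2), (F4.omega + 1, 4), 1 - a) :
      (ℚ × ℚ × ℚ) × (F4 × ZMod 5) × K) := by
    simp only [Prod.isUnit_iff, isUnit_iff_ne_zero]
    exact ⟨by norm_num, ⟨by decide, by decide⟩, sub_ne_zero.2 h1.symm⟩
  obtain ⟨α, hα⟩ := hα
  obtain ⟨β, hβ⟩ := hβ
  have L := lifting_signedPowers (α := α) (β := β)
    (q₁ := (RingHom.fst ℚ (ℚ × ℚ)).comp (RingHom.fst _ _))
    (q₂ := (RingHom.fst ℚ ℚ).comp ((RingHom.snd ℚ (ℚ × ℚ)).comp (RingHom.fst _ _)))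
    (q₃ := (RingHom.snd ℚ ℚ).comp ((RingHom.snd ℚ (ℚ × ℚ)).comp (RingHom.fst _ _)))
    (π := (RingHom.fst (F4 × ZMod 5) K).comp (RingHom.snd _ _))
    (by simp [hα, hβ]) (by simp [hα, hβ]) (by simp [hα, hβ])
    (by
      rw [hα, hβ]
      refine Prod.ext (Prod.ext ?_ (Prod.ext ?_ ?_)) (Prod.ext ?_ ?_)
      · norm_num
      · norm_num
      · norm_num
      · exact (by decide : (F4.omega, (2 : ZMod 5)) + (F4.omega + 1, 4) = 1)
      · simp) (by simp [hα])
  obtain ⟨B, hB, h⟩ := L.exists_isMatrix hV ρ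
  let κ := (RingHom.snd (F4 × ZMod 5) K).comp (RingHom.snd (ℚ × ℚ × ℚ) _)
  refine ⟨B.map κ, fun n f g => ?_⟩
  rw [← h, Matrix.submatrix_map, ← RingHom.mapMatrix_apply, ← RingHom.map_det,
    (hB n f g).map_eq_zero_iff κ]

end UnitEquation

section StandardForm

variable {R C ι F : Type*} [Field F]

/-- The columns of the matrix `[1 | D]`, where `ψ` lists the columns of `D`. -/
noncomputable def std (ψ : C → R →₀ F) : R ⊕ C → R →₀ F :=
  Sum.elim (fun r => Finsupp.single r 1) ψ

theorem linearIndependent_sum_single (Z : Set R) (u : ι → R →₀ F) :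
    LinearIndependent F (Sum.elim (fun r : ↥Zᶜ => Finsupp.single (r : R) (1 : F)) u) ↔
      LinearIndependent F fun i (z : Z) => u i z := by
  let p : (R →₀ F) →ₗ[F] (Z → F) := LinearMap.funLeft F F Subtype.val ∘ₗ Finsupp.lcoeFun
  have hp : LinearMap.ker p =
      Submodule.span F (range fun r : ↥Zᶜ => Finsupp.single (r : R) (1 : F)) := by
    have : (range fun r : ↥Zᶜ => Finsupp.single (r : R) (1 : F)) =
        (fun r => Finsupp.single r (1 : F)) '' Zᶜ := by
      rw [image_eq_range]
    rw [this, ← Finsupp.supported_eq_span_single]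
    ext x
    rw [Finsupp.mem_supported', LinearMap.mem_ker, funext_iff]
    simp [p]
  have hs : LinearIndependent F fun r : ↥Zᶜ => Finsupp.single (r : R) (1 : F) :=
    (Finsupp.linearIndependent_single_one F R).comp _ Subtype.val_injective
  have hu : (fun i (z : Z) => u i z) = p ∘ u := rfl
  rw [linearIndependent_sum, hu]
  simp only [Sum.elim_comp_inl, Sum.elim_comp_inr, hs, true_and, ← hp]
  refine ⟨fun h => (LinearMap.linearIndependent_iff_of_disjoint p h.2.symm).2 h.1,
    fun h => ⟨h.of_comp p, ?_⟩⟩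
  rw [Submodule.disjoint_def]
  intro x hx hx'
  obtain ⟨l, rfl⟩ := (Finsupp.mem_span_range_iff_exists_finsupp).1 hx'
  rw [LinearMap.mem_ker] at hx
  have : l = 0 := linearIndependent_iff.1 h l (by
    rw [← hx, Finsupp.linearCombination_apply, Finsupp.sum, Finsupp.sum, map_sum]
    simp)
  simp [this]

theorem linearIndependent_iff_exists_det_ne_zero {X : Type*} (u : ι → X → F) :
    LinearIndependent F u ↔ ∀ (n : ℕ) (g : Fin n → ι), Function.Injective g →
      ∃ f : Fin n → X, (Matrix.of fun a b => u (g b) (f a)).det ≠ 0 := by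
  constructor
  · intro h n g hg
    have hspan : Submodule.span F (range fun x b => u (g b) x) = ⊤ := by
      by_contra hne
      obtain ⟨w, hw, hle⟩ := Submodule.exists_le_ker_of_lt_top _ (lt_top_iff_ne_top.2 hne)
      refine hw ?_
      have hw' : ∀ y, w y = ∑ b, y b * w (Pi.single b 1) := fun y => by
        conv_lhs => rw [← LinearMap.sum_single_apply (fun _ => F) y, map_sum]
        refine Finset.sum_congr rfl fun b _ => ?_
        rw [← smul_eq_mul, ← map_smul, ← Pi.single_smul, smul_eq_mul, mul_one]
      have h0 := Fintype.linearIndependent_iff.1 (h.comp g hg) (fun b => w (Pi.single b 1)) (by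
        ext x
        have : w (fun b => u (g b) x) = 0 := hle (Submodule.subset_span ⟨x, rfl⟩)
        rw [hw'] at this
        simpa [mul_comm] using this)
      ext y
      simp [h0]
    obtain ⟨f, hf⟩ : ∃ f : Fin n → X, LinearIndependent F fun a b => u (g b) (f a) := by
      obtain ⟨k, hk, -, hli⟩ := Submodule.exists_fun_fin_finrank_span_eq F
        (range fun x b => u (g b) x)
      have hn : n = Module.finrank F (Submodule.span F (range fun x b => u (g b) x)) := by
        rw [hspan, finrank_top, Module.finrank_fin_fun]
      choose f hf using hk
      obtain rfl : (fun x b => u (g b) (f x)) = k := funext hf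
      exact ⟨fun a => f (Fin.cast hn a), hli.comp _ (Fin.cast_injective hn)⟩
    refine ⟨f, ?_⟩
    rw [← isUnit_iff_ne_zero, ← Matrix.isUnit_iff_isUnit_det]
    exact Matrix.linearIndependent_rows_iff_isUnit.1 hf
  · intro h
    rw [linearIndependent_iff_finset_linearIndependent]
    intro s
    obtain ⟨f, hf⟩ := h s.card (fun b => (s.equivFin.symm b : ι))
      (Subtype.val_injective.comp s.equivFin.symm.injective)
    rw [← linearIndependent_equiv s.equivFin.symm]
    refine LinearIndependent.of_comp (LinearMap.funLeft F F f) ?_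
    rw [← isUnit_iff_ne_zero, ← Matrix.isUnit_iff_isUnit_det] at hf
    exact Matrix.linearIndependent_cols_iff_isUnit.2 hf

theorem linearIndepOn_std_iff (ψ : C → R →₀ F) (J : Set (R ⊕ C)) :
    LinearIndepOn F (std ψ) J ↔ ∀ (n : ℕ) (g : Fin n → C), Function.Injective g →
      (∀ b, Sum.inr (g b) ∈ J) → ∃ f : Fin n → R, (∀ a, Sum.inl (f a) ∉ J) ∧
        (Matrix.of fun a b => ψ (g b) (f a)).det ≠ 0 := by
  let e : ↥{r | Sum.inl r ∉ J}ᶜ ⊕ ↥{c | Sum.inr c ∈ J} ≃ J :=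
    ((Equiv.subtypeEquivRight fun r => not_not).sumCongr (Equiv.refl _)).trans
      Equiv.subtypeSum.symm
  have he : (fun x : J => std ψ x) ∘ e = Sum.elim
      (fun r : ↥{r | Sum.inl r ∉ J}ᶜ => Finsupp.single (r : R) (1 : F))
        fun c : ↥{c | Sum.inr c ∈ J} => ψ c := by
    ext1 x
    rcases x with x | x <;> rfl
  rw [LinearIndepOn, ← linearIndependent_equiv e, he, linearIndependent_sum_single,
    linearIndependent_iff_exists_det_ne_zero]
  constructor
  · intro h n g hg hJ
    obtain ⟨f, hf⟩ := h n (fun b => ⟨g b, hJ b⟩) fun a b hab => hg (Subtype.ext_iff.1 hab)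
    exact ⟨fun a => f a, fun a => (f a).2, hf⟩
  · intro h n g hg
    obtain ⟨f, hf, hdet⟩ := h n (fun b => g b) (Subtype.val_injective.comp hg) fun b => (g b).2
    exact ⟨fun a => ⟨f a, hf a⟩, hdet⟩

end StandardForm

section StandardRepresentation

variable {α : Type u} {M : Matroid α} {R C F : Type*} [Field F] {e : R ⊕ C → α}

/-- The matroid `M` is represented by the matrix `[1 | D]`, whose columns are labelled by `e`. -/
def StdRep (M : Matroid α) (e : R ⊕ C → α) (D : Matrix R C F) : Prop :=
  ∃ ψ : C → R →₀ F, (∀ i j, ψ j i = D i j) ∧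
    ∀ J, M.Indep (e '' J) ↔ LinearIndepOn F (std ψ) J

theorem StdRep.indep_iff {D : Matrix R C F} (h : StdRep M e D) (J : Set (R ⊕ C)) :
    M.Indep (e '' J) ↔ ∀ (n : ℕ) (g : Fin n → C), Function.Injective g →
      (∀ b, Sum.inr (g b) ∈ J) → ∃ f : Fin n → R, (∀ a, Sum.inl (f a) ∉ J) ∧
        (D.submatrix f g).det ≠ 0 := by
  obtain ⟨ψ, hψ, h⟩ := h
  rw [h, linearIndepOn_std_iff]
  simp only [hψ]
  rfl

theorem StdRep.of_det_eq_zero_iff {K : Type*} [Field K] {D : Matrix R C F} {D' : Matrix R C K}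
    (h : StdRep M e D) (hD : ∀ (n : ℕ) (f : Fin n → R) (g : Fin n → C),
      (D'.submatrix f g).det = 0 ↔ (D.submatrix f g).det = 0) : StdRep M e D' := by
  have h' := h.indep_iff
  obtain ⟨ψ, hψ, -⟩ := h
  have h0 : ∀ i j, D' i j ≠ 0 → ψ j i ≠ 0 := fun i j => by
    have := hD 1 (fun _ => i) fun _ => j
    simp only [Matrix.det_unique, Matrix.submatrix_apply] at this
    rw [hψ, ne_eq, ne_eq, this]
    exact id
  refine ⟨fun j => Finsupp.onFinset (ψ j).support (fun i => D' i j) fun i hi =>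
    Finsupp.mem_support_iff.2 (h0 i j hi), fun i j => rfl, fun J => ?_⟩
  rw [h', linearIndepOn_std_iff]
  refine forall₄_congr fun n g _ _ => exists_congr fun f => and_congr_right fun _ => ?_
  rw [ne_eq, ← hD]
  rfl

open Classical in
theorem StdRep.piv {D : Matrix R C F} (h : StdRep M e D) {r : R} {c : C} (h0 : D r c ≠ 0) :
    StdRep M (e ∘ Equiv.swap (Sum.inl r) (Sum.inr c)) (piv D r c) := by
  obtain ⟨ψ, hψ, h⟩ := h
  set σ : Equiv.Perm (R ⊕ C) := Equiv.swap (Sum.inl r) (Sum.inr c) with hσ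
  obtain ⟨S, hS⟩ : ∃ S : (R →₀ F) →ₗ[F] R →₀ F, ∀ x,
      S x = x - ((D r c)⁻¹ * x r) • (ψ c - Finsupp.single r 1) :=
    ⟨LinearMap.id - ((D r c)⁻¹ • Finsupp.lapply r).smulRight (ψ c - Finsupp.single r 1),
      fun x => by simp⟩
  have hS' : ∀ x i, i ≠ r → S x i = x i - (D r c)⁻¹ * x r * D i c := fun x i hi => by
    simp [hS, hψ, hi]
  have hSr : ∀ x, S x r = (D r c)⁻¹ * x r := fun x => by
    simp [hS, hψ]
    field_simp
    ring
  have hinj : Function.Injective S := by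
    rw [← LinearMap.ker_eq_bot, LinearMap.ker_eq_bot']
    intro x hx
    have hr : x r = 0 := by simpa [hx, h0] using hSr x
    simpa [hS, hr] using hx
  refine ⟨fun j => if j = c then S (-Finsupp.single r 1) else S (ψ j), fun i j => ?_, fun J => ?_⟩
  · by_cases hj : j = c <;> by_cases hi : i = r <;>
      simp [PartialField.piv, schur, hi, hj, hSr, hS', hψ, Ring.inverse_eq_inv', mul_comm]
    all_goals ring
  · rw [image_comp, h, ← linearIndepOn_equiv, ← S.linearIndepOn_iff_of_injOn hinj.injOn]
    refine (LinearIndependent.units_smul_iff _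
      (fun x : J => if (x : R ⊕ C) = Sum.inr c then -1 else 1)).symm.trans
      (linearIndependent_equiv' (Equiv.refl J) (funext fun ⟨x, _⟩ => ?_))
    rw [Pi.smul_apply', Function.comp_apply, Function.comp_apply]
    rcases x with i | j
    · by_cases hi : i = r
      · subst hi
        ext k
        by_cases hk : k = i
        · simp [std, hσ, hk, hSr, hψ, h0]
        · simp [std, hσ, hk, hS', hψ, h0]
      · have hx : σ (Sum.inl i) = Sum.inl i :=
          Equiv.swap_apply_of_ne_of_ne (by simpa using hi) (by simp)
        simp [std, hx, hS, hi]
    · by_cases hj : j = c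
      · subst hj
        simp [std, hσ]
      · have hx : σ (Sum.inr j) = Sum.inr j :=
          Equiv.swap_apply_of_ne_of_ne (by simp) (by simpa using hj)
        simp [std, hx, hj]

theorem injective_elim_val (E B : Set α) :
    Function.Injective (Sum.elim Subtype.val Subtype.val : B ⊕ ↥(E \ B) → α) :=
  Subtype.val_injective.sumElim Subtype.val_injective fun b x hbx => x.2.2 (hbx ▸ b.2)

theorem range_elim_val {E B : Set α} (hB : B ⊆ E) :
    range (Sum.elim Subtype.val Subtype.val : B ⊕ ↥(E \ B) → α) = E := by
  rw [Sum.elim_range, Subtype.range_val, Subtype.range_val, union_sdiff_cancel hB]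

theorem exists_stdRep (h : Paper.Representable M F) {B : Set α} (hB : M.IsBase B) :
    ∃ D : Matrix B ↥(M.E \ B) F, StdRep M (Sum.elim Subtype.val Subtype.val) D := by
  obtain ⟨V, _, _, φ, h⟩ := h
  have hBi := (h B hB.subset_ground).1 hB.indep
  have hmem : ∀ x : ↥(M.E \ B), ∃ l : B →₀ F, Finsupp.linearCombination F (fun b : B => φ b) l =
      φ x := by
    rintro ⟨x, hx, hxB⟩
    have hd : ¬ LinearIndepOn F φ (insert x B) := fun hd => hxB <| by
      rw [hB.eq_of_subset_indep ((h _ (insert_subset hx hB.subset_ground)).2 hd)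
        (subset_insert x B)]
      exact mem_insert x B
    rw [linearIndepOn_insert hxB, not_and, not_not] at hd
    rw [← LinearMap.mem_range, Finsupp.range_linearCombination, ← image_eq_range]
    exact hd hBi
  choose ψ hψ using hmem
  refine ⟨fun i j => ψ j i, ψ, fun _ _ => rfl, fun J => ?_⟩
  rw [h _ ((image_subset_range _ _).trans (range_elim_val hB.subset_ground).subset),
    ← (Finsupp.linearCombination F fun b : B => φ b).linearIndepOn_iff_of_injOn hBi.injOn]
  refine (linearIndependent_equiv' (Equiv.Set.image _ J (injective_elim_val _ _))
    (funext fun ⟨x, _⟩ => ?_)).symm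
  rcases x with x | x <;> simp [std, hψ]

end StandardRepresentation

theorem StdRep.representable {α : Type u} {M : Matroid α} {K : Type v} [Field K] {R : Type u}
    {C : Type*} {e : R ⊕ C → α} {D : Matrix R C K} (h : StdRep M e D)
    (he : Function.Injective e) (hE : range e = M.E) : Paper.Representable M K := by
  obtain ⟨ψ, -, h⟩ := h
  refine ⟨R →₀ K, inferInstance, inferInstance, Function.extend e (std ψ) 0, fun I hI => ?_⟩
  obtain ⟨J, rfl⟩ := subset_range_iff_exists_image_eq.1 (hE ▸ hI)
  rw [h]
  exact linearIndependent_equiv' (Equiv.Set.image e J he) (funext fun x => by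
    simp [he.extend_apply])

section Uniform

variable {α : Type u} {M : Matroid α} {R C F : Type*} [Field F] {e : R ⊕ C → α}
  {D : Matrix R C F}

theorem exists_det_ne_zero_iff_card_le {W : Finset R} {U : Finset C}
    (hWU : W.card ≤ 2 ∨ U.card ≤ 2) (h1 : ∀ i ∈ W, ∀ j ∈ U, D i j ≠ 0)
    (h2 : ∀ i ∈ W, ∀ i' ∈ W, ∀ j ∈ U, ∀ j' ∈ U, i ≠ i' → j ≠ j' →
      D i j * D i' j' - D i j' * D i' j ≠ 0) :
    (∀ (n : ℕ) (g : Fin n → C), Function.Injective g → (∀ b, g b ∈ U) →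
      ∃ f : Fin n → R, (∀ a, f a ∈ W) ∧ (D.submatrix f g).det ≠ 0) ↔ U.card ≤ W.card := by
  constructor
  · intro h
    obtain ⟨f, hf, hdet⟩ := h U.card (fun b => (U.equivFin.symm b : C))
      (Subtype.val_injective.comp U.equivFin.symm.injective) fun b => Subtype.property _
    have hinj : Function.Injective f := fun a a' haa' => by_contra fun hne =>
      hdet (Matrix.det_zero_of_row_eq hne (by ext; simp [haa']))
    simpa using Finset.card_le_card_of_injOn (s := Finset.univ) (t := W) f (fun a _ => hf a)
      hinj.injOn
  · intro h n g hg hU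
    have hn : n ≤ U.card := by
      simpa using Finset.card_le_card_of_injOn (s := Finset.univ) (t := U) g (fun a _ => hU a)
        hg.injOn
    have hn2 : n ≤ 2 := by omega
    interval_cases n
    · exact ⟨Fin.elim0, fun a => a.elim0, by simp⟩
    · obtain ⟨i, hi⟩ := Finset.card_pos.1 (hn.trans h)
      exact ⟨fun _ => i, fun _ => hi, by simpa using h1 i hi _ (hU 0)⟩
    · obtain ⟨i, hi, i', hi', hne⟩ := Finset.one_lt_card.1 (hn.trans h)
      refine ⟨![i, i'], fun a => by fin_cases a <;> simpa, ?_⟩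
      rw [Matrix.det_fin_two]
      exact h2 i hi i' hi' _ (hU 0) _ (hU 1) hne
        (hg.ne Fin.zero_ne_one)

theorem StdRep.hasUniformMinor (h : StdRep M e D) (he : Function.Injective e)
    (hE : range e = M.E) {Z : Finset R} {Y : Finset C} (hZY : Z.card ≤ 2 ∨ Y.card ≤ 2)
    (h1 : ∀ i ∈ Z, ∀ j ∈ Y, D i j ≠ 0)
    (h2 : ∀ i ∈ Z, ∀ i' ∈ Z, ∀ j ∈ Y, ∀ j' ∈ Y, i ≠ i' → j ≠ j' →
      D i j * D i' j' - D i j' * D i' j ≠ 0) :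
    Paper.HasUniformMinor M Z.card (Z.card + Y.card) := by
  classical
  set X : Finset (R ⊕ C) := Z.disjSum Y with hX
  set K : Set (R ⊕ C) := Sum.inl '' (Z : Set R)ᶜ with hK
  have hXK : Disjoint (X : Set (R ⊕ C)) K := by
    rw [Set.disjoint_left]
    rintro _ hx ⟨i, hi, rfl⟩
    exact hi (by simpa [hX] using hx)
  have hground : ((M ／ (e '' K)) ＼ (e '' (X ∪ K)ᶜ)).E = e '' X := by
    rw [delete_ground, contract_ground, ← hE, ← image_univ, ← image_sdiff he, ← image_sdiff he]
    congr 1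
    ext x
    have := fun hx : x ∈ (X : Set (R ⊕ C)) => Set.disjoint_left.1 hXK hx
    simp
    tauto
  refine ⟨(M ／ (e '' K)) ＼ (e '' (X ∪ K)ᶜ), ⟨e '' K, e '' (X ∪ K)ᶜ, rfl⟩, ?_, ?_, ?_⟩
  · rw [hground]
    exact X.finite_toSet.image e
  · rw [hground, ncard_image_of_injective _ he, ncard_coe_finset, hX, Finset.card_disjSum]
  intro I hI
  rw [hground] at hI
  obtain ⟨T, hTX, rfl⟩ := subset_image_iff.1 hI
  lift T to Finset (R ⊕ C) using X.finite_toSet.subset hTX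
  rw [Finset.coe_subset] at hTX
  have hleft : T.toLeft ⊆ Z := fun i hi => by
    simpa [hX] using hTX (Finset.mem_toLeft.1 hi)
  have hright : T.toRight ⊆ Y := fun i hi => by
    simpa [hX] using hTX (Finset.mem_toRight.1 hi)
  have hKi : M.Indep (e '' K) := by
    rw [h.indep_iff]
    intro n g _ hg
    obtain rfl : n = 0 := by
      by_contra hn
      simpa [hK] using hg ⟨0, Nat.pos_of_ne_zero hn⟩
    exact ⟨Fin.elim0, fun a => a.elim0, by simp⟩
  have hTK : Disjoint (e '' T) (e '' K) :=
    (disjoint_image_iff he).2 (hXK.mono_left (Finset.coe_subset.2 hTX))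
  rw [delete_indep_iff, hKi.contract_indep_iff, ← image_union, h.indep_iff,
    ncard_image_of_injective _ he, ncard_coe_finset]
  have hdisj : Disjoint (e '' T) (e '' (X ∪ K)ᶜ) :=
    (disjoint_image_iff he).2 (Set.disjoint_left.2 fun x hx hx' => hx' (Or.inl (hTX hx)))
  have key := exists_det_ne_zero_iff_card_le (D := D) (W := Z \ T.toLeft) (U := T.toRight)
    (hZY.imp ((Finset.card_le_card Finset.sdiff_subset).trans)
      ((Finset.card_le_card hright).trans))
    (fun i hi j hj => h1 i (Finset.sdiff_subset hi) j (hright hj))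
    fun i hi i' hi' j hj j' hj' => h2 i (Finset.sdiff_subset hi) i' (Finset.sdiff_subset hi') j
      (hright hj) j' (hright hj')
  have hcard := Finset.card_sdiff_add_card_eq_card hleft
  have hcard' := Finset.card_toLeft_add_card_toRight (u := T)
  have hle : T.toRight.card ≤ (Z \ T.toLeft).card ↔ T.card ≤ Z.card := by omega
  rw [← hle, ← key]
  have hl : ∀ i, Sum.inl i ∉ (T ∪ K : Set (R ⊕ C)) ↔ i ∈ Z \ T.toLeft := fun i => by
    simp [hK]
    tauto
  have hr : ∀ j, Sum.inr j ∈ (T ∪ K : Set (R ⊕ C)) ↔ j ∈ T.toRight := fun j => by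
    simp [hK]
  simp only [hl, hr, hTK, hdisj, true_and, and_true]

end Uniform

section Pair

variable {α : Type u} {M : Matroid α} {R C F K : Type*} [Field F] [Field K] {e : R ⊕ C → α}

theorem StdRep.map {D : Matrix R C F} (h : StdRep M e D) (φ : F →+* K) : StdRep M e (D.map φ) :=
  h.of_det_eq_zero_iff fun n f g => by
    rw [Matrix.submatrix_map, ← RingHom.mapMatrix_apply, ← RingHom.map_det, map_eq_zero]

theorem StdRep.indep_insert_iff {D : Matrix R C F} (h : StdRep M e D) (i : R) (j : C) :
    M.Indep (e '' insert (Sum.inr j) (Sum.inl '' {i}ᶜ)) ↔ D i j ≠ 0 := by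
  rw [h.indep_iff]
  constructor
  · intro h
    obtain ⟨f, hf, hdet⟩ := h 1 (fun _ => j) (Function.injective_of_subsingleton _) (by simp)
    obtain hi : f 0 = i := by simpa using hf 0
    simpa [hi] using hdet
  · intro h0
    simpa using (exists_det_ne_zero_iff_card_le (D := D) (W := {i}) (U := {j}) (by simp)
      (by simpa) (by simp)).2 (by simp)

theorem minor_ne_zero_of_two_rows [DecidableEq R] [DecidableEq C] {D : Matrix R C F} {r s : R}
    {c d f : C} (hcd : D r c * D s d - D r d * D s c ≠ 0)
    (hcf : D r c * D s f - D r f * D s c ≠ 0) (hdf : D r d * D s f - D r f * D s d ≠ 0)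
    {i i' : R} (hi : i ∈ ({r, s} : Finset R)) (hi' : i' ∈ ({r, s} : Finset R)) {j j' : C}
    (hj : j ∈ ({c, d, f} : Finset C)) (hj' : j' ∈ ({c, d, f} : Finset C)) (hii' : i ≠ i')
    (hjj' : j ≠ j') : D i j * D i' j' - D i j' * D i' j ≠ 0 := by
  suffices D r j * D s j' - D r j' * D s j ≠ 0 by
    simp only [Finset.mem_insert, Finset.mem_singleton] at hi hi'
    rcases hi with rfl | rfl <;> rcases hi' with rfl | rfl
    · exact absurd rfl hii'
    · exact this
    · exact fun h => this (by linear_combination -h)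
    · exact absurd rfl hii'
  simp only [Finset.mem_insert, Finset.mem_singleton] at hj hj'
  rcases hj with rfl | rfl | rfl <;> rcases hj' with rfl | rfl | rfl <;>
    first
    | exact absurd rfl hjj'
    | assumption
    | exact fun h => hcd (by linear_combination -h)
    | exact fun h => hcf (by linear_combination -h)
    | exact fun h => hdf (by linear_combination -h)

/-- The matroid `M` is represented by both components of `[1 | A]`. -/
def PairRep (M : Matroid α) (e : R ⊕ C → α) (A : Matrix R C (F × K)) : Prop :=
  StdRep M e (A.map Prod.fst) ∧ StdRep M e (A.map Prod.snd)

variable {A : Matrix R C (F × K)}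

theorem PairRep.zeroOrUnit (h : PairRep M e A) (i : R) (j : C) : ZeroOrUnit (A i j) := by
  have := (h.1.indep_insert_iff i j).symm.trans (h.2.indep_insert_iff i j)
  exact zeroOrUnit_prod.2 (not_iff_not.1 this)

theorem PairRep.isUnit (h : PairRep M e A) {i : R} {j : C} (h0 : A i j ≠ 0) : IsUnit (A i j) :=
  (h.zeroOrUnit i j).resolve_left h0

open Classical in
theorem PairRep.piv (h : PairRep M e A) {r : R} {c : C} (h0 : A r c ≠ 0) :
    PairRep M (e ∘ Equiv.swap (Sum.inl r) (Sum.inr c)) (piv A r c) := by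
  have hu := h.isUnit h0
  have hu' := Prod.isUnit_iff.1 hu
  exact ⟨map_piv (RingHom.fst F K) hu ▸ h.1.piv hu'.1.ne_zero,
    map_piv (RingHom.snd F K) hu ▸ h.2.piv hu'.2.ne_zero⟩

theorem PairRep.isUnit_det (h : PairRep M e A) {r s : R} {c d : C} (h0 : A r c ≠ 0)
    (hdet : A r c * A s d - A r d * A s c ≠ 0) : IsUnit (A r c * A s d - A r d * A s c) := by
  have hu := h.isUnit h0
  have hrs : s ≠ r := fun hrs => hdet (by rw [hrs]; ring)
  have hcd : d ≠ c := fun hcd => hdet (by rw [hcd]; ring)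
  have e' : A r c * A s d - A r d * A s c = A r c * PartialField.piv A r c s d := by
    have := Ring.mul_inverse_cancel _ hu
    simp only [PartialField.piv, schur, hrs, hcd, if_false]
    linear_combination (A s c * A r d) * this
  rw [e'] at hdet ⊢
  exact hu.mul ((h.piv h0).isUnit (right_ne_zero_of_mul hdet))

theorem PairRep.tame (hM : Paper.NoLargeUniformMinors M) (h : PairRep M e A)
    (he : Function.Injective e) (hE : range e = M.E) : Tame A := by
  classical
  have h0 : ∀ {i j}, A i j ≠ 0 → (A.map Prod.fst) i j ≠ 0 := fun hij =>
    (Prod.isUnit_iff.1 (h.isUnit hij)).1.ne_zero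
  have hdet : ∀ {i i' j j'}, A i j ≠ 0 → A i j * A i' j' - A i j' * A i' j ≠ 0 →
      (A.map Prod.fst) i j * (A.map Prod.fst) i' j' -
        (A.map Prod.fst) i j' * (A.map Prod.fst) i' j ≠ 0 := fun hij hd =>
    (Prod.isUnit_iff.1 (h.isUnit_det hij hd)).1.ne_zero
  refine ⟨h.zeroOrUnit, fun r s c d f ⟨⟨hrc, hrd, hrf⟩, ⟨hsc, hsd, hsf⟩, hcd, hcf, hdf⟩ => hM.1 ?_,
    fun c d r s t ⟨⟨hrc, hsc, htc⟩, ⟨hrd, hsd, htd⟩, hrs, hrt, hst⟩ => hM.2 ?_⟩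
  · have hrs' : r ≠ s := fun hrs => hcd (by rw [hrs]; ring)
    have hcd' : c ≠ d := fun hcd' => hcd (by rw [hcd']; ring)
    have hcf' : c ≠ f := fun hcf' => hcf (by rw [hcf']; ring)
    have hdf' : d ≠ f := fun hdf' => hdf (by rw [hdf']; ring)
    have hcd := hdet hrc hcd
    have hcf := hdet hrc hcf
    have hdf := hdet hrd hdf
    have := h.1.hasUniformMinor he hE (Z := {r, s}) (Y := {c, d, f})
      (.inl Finset.card_le_two) (by clear hdet; grind) fun i hi i' hi' j hj j' hj' =>
        minor_ne_zero_of_two_rows hcd hcf hdf hi hi' hj hj'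
    rwa [Finset.card_pair hrs', Finset.card_eq_three.2 ⟨c, d, f, hcd', hcf', hdf', rfl⟩] at this
  · rw [Matrix.transpose_apply, Matrix.transpose_apply] at hrs hrt hst
    rw [Matrix.transpose_apply, Matrix.transpose_apply] at hrs hrt hst
    have hcd' : c ≠ d := fun hcd => hrs (by rw [hcd]; ring)
    have hrs' : r ≠ s := fun hrs' => hrs (by rw [hrs']; ring)
    have hrt' : r ≠ t := fun hrt' => hrt (by rw [hrt']; ring)
    have hst' : s ≠ t := fun hst' => hst (by rw [hst']; ring)
    have hrs := hdet hrc (i' := s) (j' := d) (by rwa [mul_comm (A r d)])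
    have hrt := hdet hrc (i' := t) (j' := d) (by rwa [mul_comm (A r d)])
    have hst := hdet hsc (i' := t) (j' := d) (by rwa [mul_comm (A s d)])
    rw [mul_comm ((A.map Prod.fst) _ d)] at hrs hrt hst
    have := h.1.hasUniformMinor he hE (Z := {r, s, t}) (Y := {c, d})
      (.inr Finset.card_le_two) (by clear hdet; grind [Matrix.transpose_apply])
      fun i hi i' hi' j hj j' hj' hii' hjj' => by
        rw [mul_comm ((A.map Prod.fst) i j')]
        exact minor_ne_zero_of_two_rows (D := (A.map Prod.fst).transpose) hrs hrt hst
          hj hj' hi hi' hjj' hii'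
    rwa [Finset.card_pair hcd', Finset.card_eq_three.2 ⟨r, s, t, hrs', hrt', hst', rfl⟩] at this

theorem PairRep.valid (hM : Paper.NoLargeUniformMinors M) (h : PairRep M e A)
    (he : Function.Injective e) (hE : range e = M.E) : Valid A := by
  classical
  intro B hB
  suffices ∃ e : R ⊕ C → α, Function.Injective e ∧ range e = M.E ∧ PairRep M e B by
    obtain ⟨e, he, hE, h⟩ := this
    exact h.tame hM he hE
  induction hB with
  | refl => exact ⟨e, he, hE, h⟩
  | tail _ hstep ih =>
    obtain ⟨e, he, hE, h⟩ := ih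
    obtain ⟨r, c, h0, rfl⟩ := hstep
    exact ⟨_, he.comp (Equiv.injective _), by rw [EquivLike.range_comp, hE], h.piv h0⟩

end Pair

section Representability

variable {α : Type u} {M : Matroid α}

theorem representable_of_ringHom {F : Type v} {K : Type w} [Field F] [Field K]
    (h : Paper.Representable M F) (φ : F →+* K) : Paper.Representable M K := by
  obtain ⟨B, hB⟩ := M.exists_isBase
  obtain ⟨D, hD⟩ := exists_stdRep h hB
  exact (hD.map φ).representable (injective_elim_val _ _) (range_elim_val hB.subset_ground)

theorem representable_of_F4_of_ZMod (hM : Paper.NoLargeUniformMinors M)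
    (h₄ : Paper.Representable M F4) (h₅ : Paper.Representable M (ZMod 5)) {K : Type v} [Field K]
    {a : K} (h0 : a ≠ 0) (h1 : a ≠ 1) : Paper.Representable M K := by
  obtain ⟨B, hB⟩ := M.exists_isBase
  obtain ⟨D₄, hD₄⟩ := exists_stdRep h₄ hB
  obtain ⟨D₅, hD₅⟩ := exists_stdRep h₅ hB
  have he := injective_elim_val M.E B
  have hE := range_elim_val hB.subset_ground
  have h : PairRep M (Sum.elim Subtype.val Subtype.val)
    (fun i j => (D₄ i j, D₅ i j) : Matrix B ↥(M.E \ B) (F4 × ZMod 5)) := ⟨hD₄, hD₅⟩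
  obtain ⟨D, hD⟩ := (h.valid hM he hE).exists_field_matrix (RingHom.fst _ _) h0 h1
  refine (hD₄.of_det_eq_zero_iff fun n f g => ?_ : StdRep M _ D).representable he hE
  rw [hD, RingHom.map_det]
  rfl

end Representability

end PartialField

/-- Let `M` be a matroid without large uniform minors. Then `M` is
representable over both `𝔽₄` and `𝔽₅` if and only if `M` is representable over every field
with at least three elements. -/
theorem representable_F4_and_F5_iff_representable_over_fields_with_three_elements
    {α : Type u} (M : Matroid α) (hM : Paper.NoLargeUniformMinors M) :
    (Paper.Representable M (GaloisField 2 2) ∧ Paper.Representable M (ZMod 5)) ↔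
      ∀ (K : Type v) [Field K], 3 ≤ Cardinal.mk K → Paper.Representable M K := by
  have hcard : Nat.card (GaloisField 2 2) = 4 := GaloisField.card 2 2 two_ne_zero
  constructor
  · rintro ⟨h₄, h₅⟩ K _ hK
    obtain ⟨a, h0, h1⟩ := Cardinal.exists_ne_ne_of_three_le hK 0 1
    let _ := Fintype.ofFinite (GaloisField 2 2)
    let φ : GaloisField 2 2 ≃+* PartialField.F4 := FiniteField.ringEquivOfCardEq (by
      rw [← Nat.card_eq_fintype_card, hcard, PartialField.F4.card])
    exact PartialField.representable_of_F4_of_ZMod hM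
      (PartialField.representable_of_ringHom h₄ φ.toRingHom) h₅ h0 h1
  · intro h
    have key : ∀ (F : Type) [Field F] [Finite F], 3 ≤ Nat.card F → Paper.Representable M F := by
      intro F _ _ hF
      refine PartialField.representable_of_ringHom (h (ULift.{v} F) ?_)
        (ULift.ringEquiv : ULift.{v} F ≃+* F).toRingHom
      rw [Cardinal.mk_uLift, ← Nat.cast_card, Cardinal.lift_natCast]
      exact_mod_cast hF
    exact ⟨key _ (by rw [hcard]; norm_num), key _ (by rw [Nat.card_zmod]; norm_num)⟩
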